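/- arXiv:1805.12339 — 3 statements merged into one kernel-verified Lean document; each statement's English description precedes it below -/
import Mathlib

section
/- With notation as in the context, assume for every maximal ideal p of A: (a) vδ + L_pδ ⊆ v′ + L′_p; (b) vδ + L_pδ = v′ + L′_p whenever v ∉ L_p; (c) pL′_p ⊊ L_pδ. Then for every ω ∈ Ω^r one has Σ_{γ∈R}(E_{k,v+L}|_k γ)(ω) = E_{k, v′+L′}(ω). (Corollary 14.8.) -/
open scoped BigOperators

/-- The pairing of a row vector `x` with a column vector `ω`: `xω = ∑ i, x i * ω i`. -/
noncomputable def rvPair {K : Type*} [Field K] {r : ℕ} (x ω : Fin r → K) : K :=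
  ∑ i, x i * ω i

/-- A subset `M` of a seminormed additive group is strongly discrete if `M ∩ B` is finite
for every bounded subset `B`. -/
def StronglyDiscrete {E : Type*} [SeminormedAddCommGroup E] (M : Set E) : Prop :=
  ∀ B : Set E, Bornology.IsBounded B → (M ∩ B).Finite

/-- The coset `v + L`. -/
def cosetOf {G : Type*} [AddGroup G] (v : G) (L : Set G) : Set G := {x | x - v ∈ L}

/-- The last index of `Fin r`. -/
def lastIdx (r : ℕ) (hr : 0 < r) : Fin r := ⟨r - 1, by omega⟩

/-- The factor of automorphy `j(γ,ω) = ξ⁻¹ · (last entry of γω)`. -/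
noncomputable def jfac {K : Type*} [Field K] {r : ℕ} (hr : 0 < r) (ξ : K)
    (γ : Matrix (Fin r) (Fin r) K) (ω : Fin r → K) : K :=
  ξ⁻¹ * (γ.mulVec ω) (lastIdx r hr)

/-- The action `γ(ω) = j(γ,ω)⁻¹ · γω`. -/
noncomputable def actOmega {K : Type*} [Field K] {r : ℕ} (hr : 0 < r) (ξ : K)
    (γ : Matrix (Fin r) (Fin r) K) (ω : Fin r → K) : Fin r → K :=
  (jfac hr ξ γ ω)⁻¹ • γ.mulVec ω

/-- The Drinfeld period domain `Ω^r`. -/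
def OmegaSet {K : Type*} [Field K] (r : ℕ) (hr : 0 < r) (Finf : Subfield K) (ξ : K) :
    Set (Fin r → K) :=
  {ω | (∀ x : Fin r → K, (∀ i, x i ∈ Finf) → rvPair x ω = 0 → x = 0) ∧ ω (lastIdx r hr) = ξ}

/-- The Eisenstein series value `E_k(S)(ω) = ∑_{x ∈ S, x ≠ 0} (σ(x)ω)^{-k}`, where the
coset `S ⊆ F^r` is embedded into `K^r` via `σ : F →+* K`. -/
noncomputable def EisF {FF K : Type*} [Field FF] [NormedField K] (σ : FF →+* K) {r : ℕ}
    (k : ℕ) (S : Set (Fin r → FF)) (ω : Fin r → K) : K :=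
  ∑' x : {x : Fin r → FF // x ∈ S ∧ x ≠ 0}, ((∑ i, σ ((x : Fin r → FF) i) * ω i) ^ k)⁻¹

/-- The localization `M_p = A_p·M` of `M ⊆ F^r` at the prime `p` of `A = 𝔽_q[t]`:
elements of the form `m/s` with `m ∈ M` and `s ∈ A∖p`. -/
def locSet {Fq : Type*} [Field Fq] {r : ℕ} (M : Set (Fin r → RatFunc Fq))
    (p : Ideal (Polynomial Fq)) : Set (Fin r → RatFunc Fq) :=
  {x | ∃ s : Polynomial Fq, s ∉ p ∧ (fun i => algebraMap (Polynomial Fq) (RatFunc Fq) s * x i) ∈ M}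

/-- The image of `γ ∈ GL_r(F)` in `GL_r(K)` (as a matrix), via `σ : F →+* K`. -/
def matOf {FF K : Type*} [Field FF] [Field K] (σ : FF →+* K) {r : ℕ}
    (γ : GL (Fin r) FF) : Matrix (Fin r) (Fin r) K :=
  (γ : Matrix (Fin r) (Fin r) FF).map σ

/-- The stabilizer `Γ_{v+L} = {γ ∈ GL_r(F) : vγ + Lγ = v + L}`. -/
def GammaSet {FF : Type*} [Field FF] {r : ℕ} (v : Fin r → FF) (L : Set (Fin r → FF)) :
    Set (GL (Fin r) FF) :=
  {γ | (fun x => Matrix.vecMul x (γ : Matrix (Fin r) (Fin r) FF)) '' cosetOf v L =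
    cosetOf v L}

/-- The number of `d`-dimensional subspaces through a given vector is `1` modulo the
characteristic. -/
theorem card_submodule_mem_modEq_one {k : Type*} [Field k] [Finite k] (p : ℕ) [Fact p.Prime]
    [CharP k p] (n : ℕ) : ∀ (V : Type*) [AddCommGroup V] [Module k V] [Module.Finite k V] (y : V)
      (d : ℕ), Module.finrank k V = n → d ≤ n → (y = 0 ∨ 1 ≤ d) →
      Nat.card {W : Submodule k V // Module.finrank k W = d ∧ y ∈ W} ≡ 1 [MOD p] := by
  induction n with
  | zero =>
    intro V _ _ _ y d hV hd hy
    have hs : Subsingleton V := Module.finrank_zero_iff.mp hV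
    have : Nat.card {W : Submodule k V // Module.finrank k W = d ∧ y ∈ W} = 1 := by
      rw [Nat.card_eq_one_iff_unique]
      refine ⟨⟨fun W W' => Subsingleton.elim _ _⟩, ⟨⟨⊤, ?_, trivial⟩⟩⟩
      simp [hV]; omega
    rw [this]
  | succ m ih =>
    intro V _ _ _ y d hV hd hy
    rcases hd.eq_or_lt with rfl | hlt
    · have : Nat.card {W : Submodule k V // Module.finrank k W = m + 1 ∧ y ∈ W} = 1 := by
        rw [Nat.card_eq_one_iff_unique]
        refine ⟨⟨fun W W' => ?_⟩, ⟨⟨⊤, by simp [hV], trivial⟩⟩⟩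
        apply Subtype.ext
        rw [Submodule.eq_top_of_finrank_eq (W.2.1.trans hV.symm),
          Submodule.eq_top_of_finrank_eq (W'.2.1.trans hV.symm)]
      rw [this]
    · have hspan : Submodule.span k {y} < ⊤ := by
        rw [lt_top_iff_ne_top]
        intro h
        have h1 : Module.finrank k (Submodule.span k {y}) = m + 1 := by rw [h, finrank_top, hV]
        rcases hy with rfl | hy
        · rw [Submodule.span_zero_singleton, finrank_bot] at h1
          omega
        · have := finrank_span_le_card (R := k) ({y} : Set V)
          simp at this
          omega
      obtain ⟨f, hf, hfspan⟩ := Submodule.exists_le_ker_of_lt_top _ hspan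
      have hfy : f y = 0 := hfspan (Submodule.mem_span_singleton_self y)
      set H := LinearMap.ker f with hH
      have hHm : Module.finrank k H = m := by
        have : Module.finrank k H + 1 = _ := Module.Dual.finrank_ker_add_one_of_ne_zero hf
        omega
      have : Finite V := Module.finite_of_finite k
      let X := {W : Submodule k V // Module.finrank k W = d ∧ y ∈ W}
      let T : H → V ≃ₗ[k] V := fun u => LinearEquiv.transvection (f := f) (v := u) u.2
      have hT : ∀ (u : H) (x : V), T u x = x + f x • (u : V) := fun u x => rfl
      have hT0 : ∀ x, T 0 x = x := by intro x; simp [hT]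
      have hTadd : ∀ (u u' : H) x, T (u + u') x = T u (T u' x) := by
        intro u u' x
        have : f (u' : V) = 0 := u'.2
        simp [hT, this, add_comm, add_left_comm]
      let act : MulAction (Multiplicative H) X :=
        { smul := fun u W => ⟨W.1.map (T u.toAdd).toLinearMap, by
            rw [LinearEquiv.finrank_map_eq]; exact W.2.1,
            ⟨y, W.2.2, by
              change T _ y = y
              rw [hT, hfy, zero_smul, add_zero]⟩⟩
          one_smul := by
            intro W
            apply Subtype.ext
            change W.1.map (T 0).toLinearMap = W.1
            apply SetLike.coe_injective
            rw [Submodule.map_coe]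
            exact (Set.image_congr fun x _ => hT0 x).trans (Set.image_id' _)
          mul_smul := by
            intro u u' W
            apply Subtype.ext
            change W.1.map (T (u.toAdd + u'.toAdd)).toLinearMap =
              (W.1.map (T u'.toAdd).toLinearMap).map (T u.toAdd).toLinearMap
            apply SetLike.coe_injective
            simp only [Submodule.map_coe, Set.image_image]
            exact Set.image_congr fun x _ => hTadd _ _ x }
      have hsmul : ∀ (u : Multiplicative H) (W : X),
        (u • W).1 = W.1.map (T u.toAdd).toLinearMap := fun _ _ => rfl
      have hp : IsPGroup p (Multiplicative H) := by
        intro g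
        refine ⟨1, ?_⟩
        have : p • g.toAdd = 0 := by
          rw [← Nat.cast_smul_eq_nsmul k, CharP.cast_eq_zero, zero_smul]
        rw [pow_one]
        exact this
      have hfix : ∀ W : X, W ∈ MulAction.fixedPoints (Multiplicative H) X ↔ W.1 ≤ H := by
        intro W
        constructor
        · intro hW x hx
          by_contra hfx
          have hfx : f x ≠ 0 := hfx
          have hle : H ≤ W.1 := by
            intro u hu
            have h1 : T ⟨u, hu⟩ x ∈ W.1 := by
              have h2 := congrArg Subtype.val (hW (Multiplicative.ofAdd ⟨u, hu⟩))
              rw [hsmul] at h2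
              rw [← h2]
              exact ⟨x, hx, rfl⟩
            rw [hT] at h1
            have h3 := (Submodule.add_mem_iff_right _ hx).mp h1
            exact (Submodule.smul_mem_iff _ hfx).mp h3
          have hlt' : H < W.1 := lt_of_le_of_ne hle (fun h => hfx (by
            rw [← h] at hx; exact hx))
          have := Submodule.finrank_lt_finrank_of_lt hlt'
          have := W.2.1
          omega
        · intro hW u
          apply Subtype.ext
          rw [hsmul]
          have hid : ∀ x ∈ W.1, T u.toAdd x = x := by
            intro x hx
            have : f x = 0 := hW hx
            simp [hT, this]
          ext x
          constructor
          · rintro ⟨z, hz, rfl⟩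
            change T u.toAdd z ∈ _
            rw [hid z hz]; exact hz
          · intro hx
            exact ⟨x, hx, hid x hx⟩
      have key := hp.card_modEq_card_fixedPoints X
      refine key.trans ?_
      have e : MulAction.fixedPoints (Multiplicative H) X ≃
          {W : Submodule k H // Module.finrank k W = d ∧ (⟨y, hfy⟩ : H) ∈ W} :=
        { toFun := fun W => ⟨W.1.1.comap H.subtype, by
            exact (Submodule.comapSubtypeEquivOfLe ((hfix _).mp W.2)).finrank_eq.trans W.1.2.1, W.1.2.2⟩
          invFun := fun W => ⟨⟨W.1.map H.subtype, by
            exact (LinearEquiv.finrank_eq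
              (Submodule.equivMapOfInjective _ H.injective_subtype W.1)).symm.trans W.2.1,
            ⟨_, W.2.2, rfl⟩⟩, (hfix _).mpr (Submodule.map_subtype_le _ _)⟩
          left_inv := by
            intro W
            apply Subtype.ext
            apply Subtype.ext
            simp only [Submodule.map_comap_subtype]
            exact inf_eq_right.mpr ((hfix _).mp W.2)
          right_inv := by
            intro W
            apply Subtype.ext
            exact Submodule.comap_map_eq_of_injective H.injective_subtype _ }
      rw [Nat.card_congr e]
      refine ih H ⟨y, hfy⟩ d hHm (by omega) ?_
      rcases hy with h | h
      · left; exact Subtype.ext h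
      · right; exact h

/-- Two subspaces of equal dimension differ by an automorphism of the ambient space. -/
theorem exists_linearEquiv_map_eq {k V : Type*} [Field k] [AddCommGroup V] [Module k V]
    [Module.Finite k V] {W W' : Submodule k V} (h : Module.finrank k W = Module.finrank k W') :
    ∃ g : V ≃ₗ[k] V, W.map g.toLinearMap = W' := by
  obtain ⟨C, hC⟩ := W.exists_isCompl
  obtain ⟨C', hC'⟩ := W'.exists_isCompl
  have h1 := Submodule.finrank_add_eq_of_isCompl hC
  have h2 := Submodule.finrank_add_eq_of_isCompl hC'
  let e := LinearEquiv.ofFinrankEq W W' h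
  let e' := LinearEquiv.ofFinrankEq (R := k) C C' (by omega)
  let g := (W.prodEquivOfIsCompl C hC).symm ≪≫ₗ (e.prodCongr e') ≪≫ₗ
    (W'.prodEquivOfIsCompl C' hC')
  refine ⟨g, Submodule.eq_of_le_of_finrank_eq ?_ ?_⟩
  · rintro _ ⟨x, hx, rfl⟩
    have : (W.prodEquivOfIsCompl C hC).symm x = (⟨x, hx⟩, 0) :=
      Submodule.prodEquivOfIsCompl_symm_apply_left W C hC (⟨x, hx⟩ : W)
    simp [g, this]
  · rw [LinearEquiv.finrank_map_eq, h]

/-- The monoid generated by the elementary matrices with off-diagonal entry divisible by `a`. -/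
def elementaryMonoid (r : ℕ) {S : Type*} [CommRing S] (a : S) :
    Submonoid (Matrix (Fin r) (Fin r) S) :=
  Submonoid.closure {T | ∃ i j, i ≠ j ∧ ∃ b, T = Matrix.transvection i j (a * b)}

theorem list_transvec_prod_mem_elementaryMonoid {r : ℕ} {k : Type*} [Field k]
    (l : List (Matrix.TransvectionStruct (Fin r) k)) :
    (l.map Matrix.TransvectionStruct.toMatrix).prod ∈ elementaryMonoid r (1 : k) := by
  apply Submonoid.list_prod_mem
  intro x hx
  obtain ⟨t, -, rfl⟩ := List.mem_map.mp hx
  exact Submonoid.subset_closure ⟨t.i, t.j, t.hij, t.c, by simp [Matrix.TransvectionStruct.toMatrix]⟩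

theorem elementaryMonoid_mul_diagonal {r : ℕ} {k : Type*} [Field k] {D : Fin r → k}
    (hD : ∀ i, D i ≠ 0) {T : Matrix (Fin r) (Fin r) k} (hT : T ∈ elementaryMonoid r (1 : k)) :
    ∃ T' ∈ elementaryMonoid r (1 : k), T * Matrix.diagonal D = Matrix.diagonal D * T' := by
  induction hT using Submonoid.closure_induction with
  | mem x hx =>
    obtain ⟨i, j, hij, b, rfl⟩ := hx
    refine ⟨Matrix.transvection i j (1 * ((D i)⁻¹ * b * D j)),
      Submonoid.subset_closure ⟨i, j, hij, _, rfl⟩, ?_⟩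
    simp only [Matrix.transvection, mul_add, add_mul, mul_one, one_mul]
    congr 1
    ext a c
    simp only [Matrix.mul_diagonal, Matrix.diagonal_mul, Matrix.single_apply]
    split_ifs with h
    · obtain ⟨rfl, rfl⟩ := h
      field_simp [hD]
    · simp
  | one => exact ⟨1, one_mem _, by simp⟩
  | mul x y _ _ hx hy =>
    obtain ⟨x', hx', hx⟩ := hx
    obtain ⟨y', hy', hy⟩ := hy
    refine ⟨x' * y', mul_mem hx' hy', ?_⟩
    rw [mul_assoc, hy, ← mul_assoc, hx, mul_assoc]

theorem exists_mem_elementaryMonoid_mul_eq_one {r : ℕ} {S : Type*} [CommRing S] {a : S}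
    {T : Matrix (Fin r) (Fin r) S} (hT : T ∈ elementaryMonoid r a) :
    ∃ T' ∈ elementaryMonoid r a, T * T' = 1 := by
  induction hT using Submonoid.closure_induction with
  | mem x hx =>
    obtain ⟨i, j, hij, b, rfl⟩ := hx
    refine ⟨Matrix.transvection i j (a * -b), Submonoid.subset_closure ⟨i, j, hij, _, rfl⟩, ?_⟩
    rw [Matrix.transvection_mul_transvection_same _ _ hij]
    simp
  | one => exact ⟨1, one_mem _, by simp⟩
  | mul x y _ _ hx hy =>
    obtain ⟨x', hx', hx⟩ := hx
    obtain ⟨y', hy', hy⟩ := hy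
    refine ⟨y' * x', mul_mem hy' hx', ?_⟩
    rw [mul_assoc, ← mul_assoc y, hy, one_mul, hx]

theorem det_of_mem_elementaryMonoid {r : ℕ} {S : Type*} [CommRing S] {a : S}
    {T : Matrix (Fin r) (Fin r) S} (hT : T ∈ elementaryMonoid r a) : T.det = 1 := by
  induction hT using Submonoid.closure_induction with
  | mem x hx =>
    obtain ⟨i, j, hij, b, rfl⟩ := hx
    exact Matrix.det_transvection_of_ne i j hij _
  | one => simp
  | mul x y _ _ hx hy => rw [Matrix.det_mul, hx, hy, one_mul]

theorem map_vecMulLinear_mul {r : ℕ} {k : Type*} [Field k] (V : Submodule k (Fin r → k))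
    (M N : Matrix (Fin r) (Fin r) k) :
    V.map (M * N).vecMulLinear = (V.map M.vecMulLinear).map N.vecMulLinear := by
  ext x
  simp only [Submodule.mem_map, Matrix.vecMulLinear_apply, exists_exists_and_eq_and,
    Matrix.vecMul_vecMul]

/-- Elementary matrices act transitively on subspaces of a given dimension. -/
theorem exists_mem_elementaryMonoid_map_eq {r : ℕ} {k : Type*} [Field k]
    {V W : Submodule k (Fin r → k)} (h : Module.finrank k V = Module.finrank k W) :
    ∃ T ∈ elementaryMonoid r (1 : k), V.map T.vecMulLinear = W := by
  have hdr : Module.finrank k V ≤ r := by simpa using Submodule.finrank_le V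
  set d := Module.finrank k V with hd
  let b : Fin d → Fin r → k := fun i => Pi.single (Fin.castLE hdr i) 1
  let C : Submodule k (Fin r → k) := Submodule.span k (Set.range b)
  have hC : Module.finrank k C = d := by
    have hb : LinearIndependent k b := by
      have := (Pi.basisFun k (Fin r)).linearIndependent.comp _ (Fin.castLE_injective hdr)
      convert this using 1
      ext i
      simp [b]
    rw [finrank_span_eq_card hb, Fintype.card_fin]
  have hCD : ∀ D : Fin r → k, C.map (Matrix.diagonal D).vecMulLinear ≤ C := by
    intro D
    rw [Submodule.map_span_le]
    rintro _ ⟨i, rfl⟩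
    have : (Matrix.diagonal D).vecMulLinear (b i) = D (Fin.castLE hdr i) • b i := by
      ext j
      simp only [Matrix.vecMulLinear_apply, Matrix.vecMul_diagonal, b, Pi.smul_apply,
        Pi.single_apply, smul_eq_mul]
      split_ifs with h
      · rw [h]; ring
      · simp
    rw [this]
    exact C.smul_mem _ (Submodule.subset_span ⟨i, rfl⟩)
  have key : ∀ U : Submodule k (Fin r → k), Module.finrank k U = d →
      ∃ T ∈ elementaryMonoid r (1 : k), C.map T.vecMulLinear = U := by
    intro U hU
    obtain ⟨g, hg⟩ := exists_linearEquiv_map_eq (hC.trans hU.symm)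
    obtain ⟨l, l', D, hM⟩ := Matrix.Pivot.exists_list_transvec_mul_diagonal_mul_list_transvec
      (LinearMap.toMatrix' g.toLinearMap).transpose
    have hgM : (LinearMap.toMatrix' g.toLinearMap).transpose.vecMulLinear = g.toLinearMap := by
      refine LinearMap.ext fun x => ?_
      rw [Matrix.vecMulLinear_apply, Matrix.vecMul_transpose, LinearMap.toMatrix'_mulVec]
    have hdet : (LinearMap.toMatrix' g.toLinearMap).transpose.det ≠ 0 := by
      rw [Matrix.det_transpose, LinearMap.det_toMatrix']
      exact (LinearEquiv.isUnit_det' g).ne_zero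
    have hD : ∀ i, D i ≠ 0 := by
      rw [hM, Matrix.det_mul, Matrix.det_mul, Matrix.det_diagonal] at hdet
      intro i hi
      exact hdet (by rw [Finset.prod_eq_zero (Finset.mem_univ i) hi]; simp)
    obtain ⟨T', hT', hTD⟩ := elementaryMonoid_mul_diagonal hD
      (list_transvec_prod_mem_elementaryMonoid l)
    refine ⟨T' * _, mul_mem hT' (list_transvec_prod_mem_elementaryMonoid l'), ?_⟩
    have hle : U ≤ C.map (T' * (l'.map Matrix.TransvectionStruct.toMatrix).prod).vecMulLinear := by
      rw [← hg, ← hgM, hM, hTD, mul_assoc, map_vecMulLinear_mul]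
      exact Submodule.map_mono (hCD D)
    refine (Submodule.eq_of_le_of_finrank_le hle ?_).symm
    rw [hU, ← hC]
    exact Submodule.finrank_map_le _ _
  obtain ⟨T, hT, hTV⟩ := key V hd.symm
  obtain ⟨S, hS, hSW⟩ := key W h.symm
  obtain ⟨T', hT', hTT⟩ := exists_mem_elementaryMonoid_mul_eq_one hT
  refine ⟨T' * S, mul_mem hT' hS, ?_⟩
  rw [← hTV, ← map_vecMulLinear_mul, ← mul_assoc, hTT, one_mul, hSW]

/-- Families of products of elementary matrices over jointly surjective residue fields lift. -/
theorem exists_mem_elementaryMonoid_map_ringHom_eq {r : ℕ} {A : Type*} [CommRing A] {ι : Type*}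
    [Finite ι] {k : ι → Type*} [∀ i, Field (k i)] (π : ∀ i, A →+* k i)
    (hπ : ∀ c : ∀ i, k i, ∃ a, ∀ i, π i a = c i) {φ : A} (hφ : ∀ i, π i φ = 1)
    (T : ∀ i, Matrix (Fin r) (Fin r) (k i)) (hT : ∀ i, T i ∈ elementaryMonoid r (1 : k i)) :
    ∃ G ∈ elementaryMonoid r φ, ∀ i, G.map (π i) = T i := by
  classical
  let Φ : Matrix (Fin r) (Fin r) A →* ∀ i, Matrix (Fin r) (Fin r) (k i) :=
    MonoidHom.pi fun i => (π i).mapMatrix.toMonoidHom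
  have hmem : T ∈ (elementaryMonoid r φ).map Φ := by
    apply Submonoid.pi_mem_of_mulSingle_mem
    intro i
    have hle : elementaryMonoid r (1 : k i) ≤ ((elementaryMonoid r φ).map Φ).comap
        (MonoidHom.mulSingle (fun i => Matrix (Fin r) (Fin r) (k i)) i) := by
      refine Submonoid.closure_le.mpr ?_
      rintro _ ⟨a, b, hab, c, rfl⟩
      obtain ⟨x, hx⟩ := hπ (Pi.single i c)
      refine ⟨Matrix.transvection a b (φ * x), Submonoid.subset_closure ⟨a, b, hab, x, rfl⟩, ?_⟩
      funext j
      have h1 : Φ (Matrix.transvection a b (φ * x)) j = Matrix.transvection a b (π j x) := by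
        simp [Φ, Matrix.transvection, hφ, Matrix.map_add]
      rw [h1, hx]
      by_cases hij : j = i
      · subst hij
        simp
      · simp [hij]
    exact hle (hT i)
  obtain ⟨G, hG, hGT⟩ := hmem
  exact ⟨G, hG, fun i => congrFun hGT i⟩

/-- Right multiplication by `γ` on row vectors, as an automorphism over the base ring. -/
def rowEquiv (A : Type*) {F : Type*} [CommRing A] [Field F] [Algebra A F] {r : ℕ}
    (γ : GL (Fin r) F) : (Fin r → F) ≃ₗ[A] (Fin r → F) where
  toFun x := Matrix.vecMul x (γ : Matrix (Fin r) (Fin r) F)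
  map_add' x y := Matrix.add_vecMul _ x y
  map_smul' a x := Matrix.smul_vecMul a x _
  invFun x := Matrix.vecMul x ((γ⁻¹ : GL (Fin r) F) : Matrix (Fin r) (Fin r) F)
  left_inv x := by
    change Matrix.vecMul (Matrix.vecMul x γ.1) γ⁻¹.1 = x
    rw [Matrix.vecMul_vecMul, ← Units.val_mul, mul_inv_cancel]; simp
  right_inv x := by
    change Matrix.vecMul (Matrix.vecMul x γ⁻¹.1) γ.1 = x
    rw [Matrix.vecMul_vecMul, ← Units.val_mul, inv_mul_cancel]; simp

section rowEquiv

variable {A F : Type*} [CommRing A] [Field F] [Algebra A F] {r : ℕ}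

theorem rowEquiv_mul (γ γ' : GL (Fin r) F) (x : Fin r → F) :
    rowEquiv A (γ * γ') x = rowEquiv A γ' (rowEquiv A γ x) := by
  simp [rowEquiv, Matrix.vecMul_vecMul]

/-- The image of a lattice under right multiplication. -/
abbrev latMul (L : Submodule A (Fin r → F)) (γ : GL (Fin r) F) : Submodule A (Fin r → F) :=
  L.map (rowEquiv A γ).toLinearMap

theorem latMul_mul (L : Submodule A (Fin r → F)) (γ γ' : GL (Fin r) F) :
    latMul L (γ * γ') = latMul (latMul L γ) γ' := by
  ext x
  simp only [Submodule.mem_map, exists_exists_and_eq_and, LinearEquiv.coe_coe, rowEquiv_mul]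

theorem rowEquiv_mem_latMul {L : Submodule A (Fin r → F)} {γ : GL (Fin r) F} {x : Fin r → F} :
    rowEquiv A γ x ∈ latMul L γ ↔ x ∈ L := by
  constructor
  · rintro ⟨y, hy, h⟩
    rwa [← (rowEquiv A γ).injective h]
  · exact fun h => ⟨x, h, rfl⟩

theorem image_vecMul_cosetOf (v : Fin r → F) (L : Submodule A (Fin r → F)) (γ : GL (Fin r) F) :
    (fun x => Matrix.vecMul x (γ : Matrix (Fin r) (Fin r) F)) '' cosetOf v (L : Set (Fin r → F)) =
      cosetOf (rowEquiv A γ v) (latMul L γ : Set (Fin r → F)) := by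
  ext y
  constructor
  · rintro ⟨x, hx, rfl⟩
    change rowEquiv A γ x - rowEquiv A γ v ∈ latMul L γ
    rw [← map_sub, rowEquiv_mem_latMul]
    exact hx
  · intro hy
    obtain ⟨x, rfl⟩ := (rowEquiv A γ).surjective y
    refine ⟨x, ?_, rfl⟩
    change rowEquiv A γ x - rowEquiv A γ v ∈ latMul L γ at hy
    rw [← map_sub, rowEquiv_mem_latMul] at hy
    exact hy

theorem cosetOf_eq_cosetOf_iff {a b : Fin r → F} {M N : Submodule A (Fin r → F)} :
    cosetOf a (M : Set (Fin r → F)) = cosetOf b (N : Set (Fin r → F)) ↔ M = N ∧ a - b ∈ N := by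
  have hmem : ∀ (a x : Fin r → F) (M : Submodule A (Fin r → F)),
    x ∈ cosetOf a (M : Set (Fin r → F)) ↔ x - a ∈ M := fun _ _ _ => Iff.rfl
  constructor
  · intro h
    have hab : a - b ∈ N := by rw [← hmem, ← h, hmem]; simp
    refine ⟨?_, hab⟩
    ext x
    have h1 := (hmem a (x + a) M).symm.trans ((Set.ext_iff.mp h (x + a)).trans (hmem b (x + a) N))
    rw [add_sub_cancel_right, add_sub_assoc, N.add_mem_iff_left hab] at h1
    exact h1
  · rintro ⟨rfl, hab⟩
    ext x
    rw [hmem, hmem, ← sub_add_sub_cancel x a b, M.add_mem_iff_left hab]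

theorem mem_GammaSet_iff {v : Fin r → F} {L : Submodule A (Fin r → F)} {γ : GL (Fin r) F} :
    γ ∈ GammaSet v (L : Set (Fin r → F)) ↔ latMul L γ = L ∧ rowEquiv A γ v - v ∈ L := by
  rw [GammaSet, Set.mem_ofPred_eq, image_vecMul_cosetOf (A := A), cosetOf_eq_cosetOf_iff]

/-- The left coset `Γ_{v+L} γ` consists of the elements translating `v + L` to `(v + L)γ`. -/
theorem exists_mem_GammaSet_eq_mul_iff {v : Fin r → F} {L : Submodule A (Fin r → F)}
    {g γ : GL (Fin r) F} :
    (∃ c ∈ GammaSet v (L : Set (Fin r → F)), g = c * γ) ↔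
      latMul L g = latMul L γ ∧ rowEquiv A g v - rowEquiv A γ v ∈ latMul L γ := by
  have h : (∃ c ∈ GammaSet v (L : Set (Fin r → F)), g = c * γ) ↔
      g * γ⁻¹ ∈ GammaSet v (L : Set (Fin r → F)) := by
    constructor
    · rintro ⟨c, hc, rfl⟩
      simpa using hc
    · intro h
      exact ⟨_, h, by simp⟩
  rw [h, mem_GammaSet_iff (A := A)]
  obtain ⟨c, rfl⟩ : ∃ c, g = c * γ := ⟨g * γ⁻¹, by simp⟩
  rw [mul_inv_cancel_right, latMul_mul, rowEquiv_mul, ← map_sub, rowEquiv_mem_latMul]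
  refine and_congr_left fun _ => ?_
  exact (Submodule.map_injective_of_injective (rowEquiv A γ).injective).eq_iff.symm

/-- The row lattice of an invertible matrix `h`, parametrized by coordinates. -/
def coordMap (A : Type*) {F : Type*} [CommRing A] [Field F] [Algebra A F] {r : ℕ}
    (h : GL (Fin r) F) : (Fin r → A) →ₗ[A] (Fin r → F) :=
  (rowEquiv A h).toLinearMap ∘ₗ (Algebra.linearMap A F).compLeft (Fin r)

/-- Coordinatewise reduction of vectors along a ring homomorphism. -/
def redMap {k : Type*} [Field k] (r : ℕ) (π : A →+* k) : (Fin r → A) →ₛₗ[π] (Fin r → k) where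
  toFun z i := π (z i)
  map_add' x y := by ext; simp
  map_smul' a x := by ext; simp

theorem coordMap_apply (h : GL (Fin r) F) (z : Fin r → A) :
    coordMap A h z = Matrix.vecMul (algebraMap A F ∘ z) (h : Matrix (Fin r) (Fin r) F) := rfl

theorem coordMap_injective [FaithfulSMul A F] (h : GL (Fin r) F) :
    Function.Injective (coordMap A h) := by
  refine (rowEquiv A h).injective.comp fun x y hxy => funext fun i => ?_
  exact FaithfulSMul.algebraMap_injective A F (congrFun hxy i)

theorem redMap_vecMul {k : Type*} [Field k] (π : A →+* k) (z : Fin r → A)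
    (G : Matrix (Fin r) (Fin r) A) :
    redMap r π (Matrix.vecMul z G) = (G.map π).vecMulLinear (redMap r π z) := by
  funext i
  exact RingHom.map_vecMul π G z i

/-- The reduction of the part of `M` inside the row lattice of `h`. -/
def redSub (h : GL (Fin r) F) {k : Type*} [Field k] (π : A →+* k) [RingHomSurjective π]
    (M : Submodule A (Fin r → F)) : Submodule k (Fin r → k) :=
  (M.comap (coordMap A h)).map (redMap r π)

/-- `G` is the matrix of `c` in the basis given by the rows of `h`. -/
theorem coordMap_vecMul {h c : GL (Fin r) F} {G : Matrix (Fin r) (Fin r) A}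
    (hG : G.map (algebraMap A F) * (h : Matrix (Fin r) (Fin r) F) = h * c) (z : Fin r → A) :
    coordMap A h (Matrix.vecMul z G) = rowEquiv A c (coordMap A h z) := by
  rw [coordMap_apply, coordMap_apply]
  change _ = Matrix.vecMul (Matrix.vecMul (algebraMap A F ∘ z) h.1) c.1
  rw [Matrix.vecMul_vecMul, ← hG, ← Matrix.vecMul_vecMul]
  congr 1
  funext i
  exact RingHom.map_vecMul (algebraMap A F) G z i

theorem redSub_latMul {h c : GL (Fin r) F} {G : Matrix (Fin r) (Fin r) A} (hGu : IsUnit G)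
    (hG : G.map (algebraMap A F) * (h : Matrix (Fin r) (Fin r) F) = h * c)
    {k : Type*} [Field k] (π : A →+* k) [RingHomSurjective π] (M : Submodule A (Fin r → F)) :
    redSub h π (latMul M c) = (redSub h π M).map (G.map π).vecMulLinear := by
  ext x
  constructor
  · rintro ⟨z, hz, rfl⟩
    obtain ⟨u, rfl⟩ := hGu
    obtain ⟨z, rfl⟩ : ∃ z', z = Matrix.vecMul z' u.1 := ⟨Matrix.vecMul z u⁻¹.1, by simp⟩
    refine ⟨redMap r π z, ⟨z, ?_, rfl⟩, (redMap_vecMul π z _).symm⟩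
    change coordMap A h _ ∈ latMul M c at hz
    rw [coordMap_vecMul hG, rowEquiv_mem_latMul] at hz
    exact hz
  · rintro ⟨_, ⟨z, hz, rfl⟩, rfl⟩
    refine ⟨Matrix.vecMul z G, ?_, redMap_vecMul π z _⟩
    change coordMap A h _ ∈ latMul M c
    rw [coordMap_vecMul hG, rowEquiv_mem_latMul]
    exact hz

/-- An automorphism of the row lattice of `h` has an invertible coordinate matrix. -/
theorem exists_isUnit_map_mul_eq [FaithfulSMul A F] {h c : GL (Fin r) F}
    (hc : latMul (LinearMap.range (coordMap A h)) c = LinearMap.range (coordMap A h)) :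
    ∃ G : Matrix (Fin r) (Fin r) A, IsUnit G ∧
      G.map (algebraMap A F) * (h : Matrix (Fin r) (Fin r) F) = h * c := by
  have key : ∀ c : GL (Fin r) F, (∀ z, rowEquiv A c (coordMap A h z) ∈
      LinearMap.range (coordMap A h)) → ∃ G : Matrix (Fin r) (Fin r) A,
      G.map (algebraMap A F) * (h : Matrix (Fin r) (Fin r) F) = h * c := by
    intro c hc
    choose G hG using fun i : Fin r => hc (Pi.single i 1)
    refine ⟨Matrix.of G, Matrix.ext fun i j => ?_⟩
    have h1 := congrFun (hG i) j
    have h2 : (algebraMap A F ∘ (Pi.single i 1 : Fin r → A)) = Pi.single i 1 := by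
      funext j
      by_cases hj : j = i
      · subst hj; simp
      · simp [hj]
    rw [coordMap_apply, coordMap_apply, h2] at h1
    change _ = Matrix.vecMul (Matrix.vecMul (Pi.single i 1 : Fin r → F) h.1) c.1 j at h1
    rw [Matrix.vecMul_vecMul, Matrix.single_one_vecMul] at h1
    exact h1
  obtain ⟨G, hG⟩ := key c fun z => by
    rw [← hc, rowEquiv_mem_latMul]; exact ⟨z, rfl⟩
  obtain ⟨G', hG'⟩ := key c⁻¹ fun z => by
    rw [← rowEquiv_mem_latMul (γ := c), ← rowEquiv_mul, hc]
    simp [rowEquiv]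
  refine ⟨G, ?_, hG⟩
  refine IsUnit.of_mul_eq_one G' ?_
  have hinj : Function.Injective fun M : Matrix (Fin r) (Fin r) A => M.map (algebraMap A F) :=
    Matrix.map_injective (FaithfulSMul.algebraMap_injective A F)
  apply hinj
  change (G * G').map _ = (1 : Matrix _ _ A).map _
  rw [Matrix.map_mul, Matrix.map_one _ (map_zero _) (map_one _)]
  have h3 : G.map (algebraMap A F) * G'.map (algebraMap A F) * (h : Matrix (Fin r) (Fin r) F) =
      1 * h := by
    rw [mul_assoc, hG', ← mul_assoc, hG, mul_assoc, ← Units.val_mul, mul_inv_cancel]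
    simp
  exact h.isUnit.mul_left_injective h3

end rowEquiv

section Hecke

variable {A F : Type*} [CommRing A] [Field F] [Algebra A F] {r : ℕ}

/-- Elementary matrices congruent to the identity modulo `φ` move vectors killed by `φ` modulo
the standard lattice by elements of that lattice. -/
theorem vecMul_sub_mem_of_mem_elementaryMonoid {φ : A} {G : Matrix (Fin r) (Fin r) A}
    (hG : G ∈ elementaryMonoid r φ) :
    ∀ w : Fin r → F, (∃ z : Fin r → A, algebraMap A F ∘ z = φ • w) →
      ∃ z : Fin r → A, algebraMap A F ∘ z = Matrix.vecMul w (G.map (algebraMap A F)) - w := by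
  induction hG using Submonoid.closure_induction with
  | one =>
    intro w _
    refine ⟨0, ?_⟩
    rw [Matrix.map_one _ (map_zero _) (map_one _), Matrix.vecMul_one, sub_self]
    ext; simp
  | mul G₁ G₂ _ _ h₁ h₂ =>
    intro w hw
    obtain ⟨z₁, hz₁⟩ := h₁ w hw
    obtain ⟨z₂, hz₂⟩ := h₂ w hw
    refine ⟨Matrix.vecMul z₁ G₂ + z₂, ?_⟩
    have h : algebraMap A F ∘ (Matrix.vecMul z₁ G₂ + z₂) =
        Matrix.vecMul (algebraMap A F ∘ z₁) (G₂.map (algebraMap A F)) + algebraMap A F ∘ z₂ := by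
      funext i
      simp only [Function.comp_apply, Pi.add_apply, map_add]
      rw [RingHom.map_vecMul]
    rw [h, hz₁, hz₂, Matrix.map_mul, Matrix.sub_vecMul, Matrix.vecMul_vecMul]
    abel
  | mem T hT =>
    obtain ⟨i, j, hij, b, rfl⟩ := hT
    rintro w ⟨z, hz⟩
    refine ⟨Pi.single j (z i * b), ?_⟩
    have hzi : algebraMap A F (z i) = algebraMap A F φ * w i := by
      have := congrFun hz i
      rwa [Function.comp_apply, Pi.smul_apply, Algebra.smul_def] at this
    have h1 : (Matrix.transvection i j (φ * b)).map (algebraMap A F) =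
        Matrix.transvection i j (algebraMap A F (φ * b)) := by
      rw [Matrix.transvection, Matrix.transvection, Matrix.map_add _ (map_add _),
        Matrix.map_one _ (map_zero _) (map_one _), Matrix.map_single]
    rw [h1, Matrix.transvection, Matrix.vecMul_add, Matrix.vecMul_one, add_sub_cancel_left]
    funext c
    by_cases hc : c = j
    · subst hc
      simp [Matrix.vecMul, dotProduct, Matrix.single_apply, hzi]
      ring
    · simp [Matrix.vecMul, dotProduct, hc, Ne.symm hc]

/-- Elementary matrices congruent to the identity modulo `φ` give automorphisms of any coset of
the row lattice of `h` that is killed by `φ`. -/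
theorem exists_latMul_eq_of_mem_elementaryMonoid (h : GL (Fin r) F) {φ : A}
    {G : Matrix (Fin r) (Fin r) A} (hG : G ∈ elementaryMonoid r φ) {b : Fin r → F}
    (hb : φ • b ∈ LinearMap.range (coordMap A h)) :
    IsUnit G ∧ ∃ c : GL (Fin r) F,
      G.map (algebraMap A F) * (h : Matrix (Fin r) (Fin r) F) = h * c ∧
      latMul (LinearMap.range (coordMap A h)) c = LinearMap.range (coordMap A h) ∧
      rowEquiv A c b - b ∈ LinearMap.range (coordMap A h) := by
  have hGu : IsUnit G := by
    rw [Matrix.isUnit_iff_isUnit_det, det_of_mem_elementaryMonoid hG]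
    exact isUnit_one
  refine ⟨hGu, ?_⟩
  obtain ⟨u, hu⟩ := hGu.map (algebraMap A F).mapMatrix
  have hu : u.1 = G.map (algebraMap A F) := hu
  have hc : G.map (algebraMap A F) * (h : Matrix (Fin r) (Fin r) F) =
      h * (h⁻¹ * u * h : GL (Fin r) F) := by
    rw [← hu, ← Units.val_mul, ← Units.val_mul]
    congr 1
    group
  refine ⟨h⁻¹ * u * h, hc, ?_, ?_⟩
  · obtain ⟨u', rfl⟩ := hGu
    apply le_antisymm
    · rintro _ ⟨_, ⟨z, rfl⟩, rfl⟩
      exact ⟨_, coordMap_vecMul hc z⟩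
    · rintro _ ⟨z, rfl⟩
      refine ⟨_, ⟨Matrix.vecMul z u'⁻¹.1, rfl⟩, (coordMap_vecMul hc _).symm.trans ?_⟩
      simp
  · obtain ⟨w, rfl⟩ := (rowEquiv A h).surjective b
    obtain ⟨z, hz⟩ := hb
    rw [← map_smul] at hz
    obtain ⟨z', hz'⟩ := vecMul_sub_mem_of_mem_elementaryMonoid hG w
      ⟨z, (rowEquiv A h).injective hz⟩
    refine ⟨z', ?_⟩
    change rowEquiv A h (algebraMap A F ∘ z') = _
    rw [hz', map_sub, ← hu]
    congr 1
    change rowEquiv A h (rowEquiv A u w) = _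
    rw [← rowEquiv_mul, ← rowEquiv_mul]
    congr 2
    group

/-- Cosets `(v + L)γ` obtained from `(v + L)δ` by automorphisms of `v' + L'` share the
local properties of `(v + L)δ`. -/
theorem redSub_of_latMul_eq [FaithfulSMul A F] {h : GL (Fin r) F} {ι : Type*} {k : ι → Type*}
    [∀ i, Field (k i)] (π : ∀ i, A →+* k i) [∀ i, RingHomSurjective (π i)]
    {L : Submodule A (Fin r → F)} {v v' : Fin r → F} {δ γ c : GL (Fin r) F}
    (hle : latMul L δ ≤ LinearMap.range (coordMap A h))
    (hv : rowEquiv A δ v - v' ∈ LinearMap.range (coordMap A h))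
    (hloc : ∀ z, (∀ i, redMap r (π i) z ∈ redSub h (π i) (latMul L δ)) →
      coordMap A h z ∈ latMul L δ)
    (hc : latMul (LinearMap.range (coordMap A h)) c = LinearMap.range (coordMap A h))
    (hcv : rowEquiv A c v' - v' ∈ LinearMap.range (coordMap A h))
    (hγ : latMul L γ = latMul L (δ * c))
    (hγv : rowEquiv A γ v - rowEquiv A (δ * c) v ∈ latMul L (δ * c)) :
    latMul L γ ≤ LinearMap.range (coordMap A h) ∧
    rowEquiv A γ v - v' ∈ LinearMap.range (coordMap A h) ∧
    (∀ z, (∀ i, redMap r (π i) z ∈ redSub h (π i) (latMul L γ)) →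
      coordMap A h z ∈ latMul L γ) ∧
    ∀ i, Module.finrank (k i) (redSub h (π i) (latMul L γ)) =
      Module.finrank (k i) (redSub h (π i) (latMul L δ)) := by
  obtain ⟨G, hGu, hG⟩ := exists_isUnit_map_mul_eq hc
  have hle' : latMul L (δ * c) ≤ LinearMap.range (coordMap A h) := by
    rw [latMul_mul, ← hc]
    exact Submodule.map_mono hle
  have hred : ∀ i, redSub h (π i) (latMul L (δ * c)) =
      (redSub h (π i) (latMul L δ)).map (G.map (π i)).vecMulLinear := fun i => by
    rw [latMul_mul, redSub_latMul hGu hG]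
  have hinj : ∀ i, Function.Injective (G.map (π i)).vecMulLinear := fun i => by
    have : IsUnit (G.map (π i)) := hGu.map (π i).mapMatrix
    exact Matrix.vecMul_injective_of_isUnit this
  rw [hγ]
  refine ⟨hle', ?_, fun z hz => ?_, fun i => ?_⟩
  · have h1 := add_mem (hle' hγv) (add_mem (?_ : rowEquiv A (δ * c) v - rowEquiv A c v' ∈ _) hcv)
    · convert h1 using 1
      abel
    · rw [rowEquiv_mul, ← map_sub, ← hc, rowEquiv_mem_latMul]
      exact hv
  · obtain ⟨u, rfl⟩ := hGu
    obtain ⟨z, rfl⟩ : ∃ z', z = Matrix.vecMul z' u.1 := ⟨Matrix.vecMul z u⁻¹.1, by simp⟩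
    rw [coordMap_vecMul hG, latMul_mul, rowEquiv_mem_latMul]
    refine hloc z fun i => ?_
    have h1 := hz i
    rw [hred, redMap_vecMul] at h1
    obtain ⟨x, hx, hxz⟩ := h1
    rwa [← hinj i hxz]
  · rw [hred]
    exact (Submodule.equivMapOfInjective _ (hinj i) _).finrank_eq.symm


/-- Membership in a coset `(v + L)γ` inside `v' + L'` can be tested after reduction. -/
theorem sub_mem_latMul_iff_forall_redMap_mem {h : GL (Fin r) F} {ι : Type*} {k : ι → Type*}
    [∀ i, Field (k i)] (π : ∀ i, A →+* k i) [∀ i, RingHomSurjective (π i)]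
    {L : Submodule A (Fin r → F)} {v v' : Fin r → F} {γ : GL (Fin r) F}
    (hle : latMul L γ ≤ LinearMap.range (coordMap A h))
    (hv : rowEquiv A γ v - v' ∈ LinearMap.range (coordMap A h))
    (hloc : ∀ z, (∀ i, redMap r (π i) z ∈ redSub h (π i) (latMul L γ)) →
      coordMap A h z ∈ latMul L γ)
    {φ : A} (hφ : ∀ i, π i φ = 1) (hφv : φ • v ∈ L) {y : Fin r → F}
    (hy : y - v' ∈ LinearMap.range (coordMap A h)) {w : Fin r → A}
    (hw : coordMap A h w = φ • y) [FaithfulSMul A F] :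
    y - rowEquiv A γ v ∈ latMul L γ ↔
      ∀ i, redMap r (π i) w ∈ redSub h (π i) (latMul L γ) := by
  obtain ⟨u, hu⟩ : y - rowEquiv A γ v ∈ LinearMap.range (coordMap A h) := by
    have := sub_mem hy hv
    rwa [sub_sub_sub_cancel_right] at this
  have hφγ : φ • rowEquiv A γ v ∈ latMul L γ := by
    rw [← map_smul, rowEquiv_mem_latMul]
    exact hφv
  obtain ⟨t, ht⟩ := hle hφγ
  have hwut : w = φ • u + t := by
    apply coordMap_injective (A := A) h
    rw [map_add, map_smul, hu, ht, hw, smul_sub, sub_add_cancel]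
  have hred : ∀ i, redMap r (π i) w = redMap r (π i) u + redMap r (π i) t := fun i => by
    rw [hwut, map_add, map_smulₛₗ, hφ, one_smul]
  have htm : ∀ i, redMap r (π i) t ∈ redSub h (π i) (latMul L γ) := fun i =>
    ⟨t, by change coordMap A h t ∈ latMul L γ; rwa [ht], rfl⟩
  rw [← hu]
  refine ⟨fun hm i => ?_, fun hm => hloc u fun i => ?_⟩
  · rw [hred]
    exact add_mem ⟨u, hm, rfl⟩ (htm i)
  · have := hm i
    rw [hred] at this
    exact ((redSub h (π i) (latMul L γ)).add_mem_iff_left (htm i)).mp this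

theorem prod_modEq_one {ι : Type*} (s : Finset ι) {f : ι → ℕ} {n : ℕ}
    (h : ∀ i ∈ s, f i ≡ 1 [MOD n]) : ∏ i ∈ s, f i ≡ 1 [MOD n] := by
  refine Finset.prod_induction f (· ≡ 1 [MOD n]) (fun a b ha hb => ?_) rfl h
  simpa using ha.mul hb

/-- Each element of `v' + L'` lies in a number of cosets `(v + L)γ` congruent to `1` modulo `p`,
where `γ` runs over representatives of `Γ_{v+L} \ Γ_{v+L} δ Γ_{v'+L'}`. -/
theorem card_sub_mem_latMul_modEq_one [FaithfulSMul A F] {h : GL (Fin r) F} {ι : Type*} [Finite ι]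
    {k : ι → Type*} [∀ i, Field (k i)] [∀ i, Finite (k i)] (p : ℕ) [Fact p.Prime]
    [∀ i, CharP (k i) p] (π : ∀ i, A →+* k i) [∀ i, RingHomSurjective (π i)]
    (hπ : ∀ c : ∀ i, k i, ∃ a, ∀ i, π i a = c i)
    {L : Submodule A (Fin r → F)} {v v' : Fin r → F} {δ : GL (Fin r) F}
    (hle : latMul L δ ≤ LinearMap.range (coordMap A h))
    (hv : rowEquiv A δ v - v' ∈ LinearMap.range (coordMap A h))
    (hloc : ∀ z, (∀ i, redMap r (π i) z ∈ redSub h (π i) (latMul L δ)) →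
      coordMap A h z ∈ latMul L δ)
    (hne : ∀ i, redSub h (π i) (latMul L δ) ≠ ⊥)
    {φ : A} (hφ : ∀ i, π i φ = 1) (hφv : φ • v ∈ L)
    {R : Set (GL (Fin r) F)}
    (hR : ∀ γ₁ ∈ R, ∀ γ₂ ∈ R, latMul L γ₁ = latMul L γ₂ →
      rowEquiv A γ₁ v - rowEquiv A γ₂ v ∈ latMul L γ₂ → γ₁ = γ₂)
    (hRsub : ∀ γ ∈ R, ∃ c : GL (Fin r) F,
      latMul (LinearMap.range (coordMap A h)) c = LinearMap.range (coordMap A h) ∧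
      rowEquiv A c v' - v' ∈ LinearMap.range (coordMap A h) ∧
      latMul L γ = latMul L (δ * c) ∧
      rowEquiv A γ v - rowEquiv A (δ * c) v ∈ latMul L (δ * c))
    (hRsup : ∀ c : GL (Fin r) F,
      latMul (LinearMap.range (coordMap A h)) c = LinearMap.range (coordMap A h) →
      rowEquiv A c v' - v' ∈ LinearMap.range (coordMap A h) →
      ∃ γ ∈ R, latMul L γ = latMul L (δ * c) ∧
        rowEquiv A γ v - rowEquiv A (δ * c) v ∈ latMul L (δ * c))
    {y : Fin r → F} (hy : y - v' ∈ LinearMap.range (coordMap A h)) :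
    Nat.card {γ // γ ∈ R ∧ y - rowEquiv A γ v ∈ latMul L γ} ≡ 1 [MOD p] := by
  have hgood := fun γ (hγ : γ ∈ R) =>
    let ⟨_, hc, hcv, hγL, hγv⟩ := hRsub γ hγ
    redSub_of_latMul_eq π hle hv hloc hc hcv hγL hγv
  have hφδ : φ • rowEquiv A δ v ∈ LinearMap.range (coordMap A h) := by
    rw [← map_smul]
    exact hle (rowEquiv_mem_latMul.mpr hφv)
  have hφv' : φ • v' ∈ LinearMap.range (coordMap A h) := by
    have := sub_mem hφδ (Submodule.smul_mem _ φ hv)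
    rwa [← smul_sub, sub_sub_cancel] at this
  have hφy : ∀ y, y - v' ∈ LinearMap.range (coordMap A h) → ∃ w, coordMap A h w = φ • y := by
    intro y hy
    have := add_mem (Submodule.smul_mem _ φ hy) hφv'
    rwa [← smul_add, sub_add_cancel] at this
  obtain ⟨w, hw⟩ := hφy y hy
  let Ψ : {γ // γ ∈ R ∧ y - rowEquiv A γ v ∈ latMul L γ} → ∀ i, {W : Submodule (k i) (Fin r → k i) //
      Module.finrank (k i) W = Module.finrank (k i) (redSub h (π i) (latMul L δ)) ∧
        redMap r (π i) w ∈ W} := fun γ i => ⟨redSub h (π i) (latMul L γ.1),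
    (hgood γ.1 γ.2.1).2.2.2 i,
    (sub_mem_latMul_iff_forall_redMap_mem π (hgood γ.1 γ.2.1).1 (hgood γ.1 γ.2.1).2.1
      (hgood γ.1 γ.2.1).2.2.1 hφ hφv hy hw).mp γ.2.2 i⟩
  have hle₂ : ∀ γ₁ ∈ R, ∀ γ₂ ∈ R,
      (∀ i, redSub h (π i) (latMul L γ₁) = redSub h (π i) (latMul L γ₂)) →
      latMul L γ₁ ≤ latMul L γ₂ := by
    intro γ₁ h₁ γ₂ h₂ heq x hx
    obtain ⟨z, rfl⟩ := (hgood γ₁ h₁).1 hx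
    refine (hgood γ₂ h₂).2.2.1 z fun i => ?_
    rw [← heq]
    exact ⟨z, hx, rfl⟩
  have hbij : Function.Bijective Ψ := by
    constructor
    · rintro ⟨γ₁, h₁, h₁y⟩ ⟨γ₂, h₂, h₂y⟩ heq
      have heq : ∀ i, redSub h (π i) (latMul L γ₁) = redSub h (π i) (latMul L γ₂) :=
        fun i => congrArg Subtype.val (congrFun heq i)
      have hLL := le_antisymm (hle₂ γ₁ h₁ γ₂ h₂ heq) (hle₂ γ₂ h₂ γ₁ h₁ fun i => (heq i).symm)
      refine Subtype.ext (hR γ₁ h₁ γ₂ h₂ hLL ?_)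
      rw [hLL] at h₁y
      have := sub_mem h₂y h₁y
      rwa [sub_sub_sub_cancel_left] at this
    · intro W
      choose T hT hTW using fun i =>
        exists_mem_elementaryMonoid_map_eq (W i).2.1.symm
      obtain ⟨G, hG, hGT⟩ := exists_mem_elementaryMonoid_map_ringHom_eq π hπ hφ T hT
      obtain ⟨hGu, c, hGc, hc, hcv⟩ := exists_latMul_eq_of_mem_elementaryMonoid h hG hφv'
      obtain ⟨γ, hγ, hγL, hγv⟩ := hRsup c hc hcv
      have hW : ∀ i, redSub h (π i) (latMul L γ) = (W i).1 := fun i => by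
        rw [hγL, latMul_mul, redSub_latMul hGu hGc, hGT, hTW]
      refine ⟨⟨γ, hγ, ?_⟩, funext fun i => Subtype.ext (hW i)⟩
      rw [sub_mem_latMul_iff_forall_redMap_mem π (hgood γ hγ).1 (hgood γ hγ).2.1
        (hgood γ hγ).2.2.1 hφ hφv hy hw]
      intro i
      rw [hW]
      exact (W i).2.2
  have := Fintype.ofFinite ι
  rw [Nat.card_eq_of_bijective Ψ hbij, Nat.card_pi]
  refine prod_modEq_one _ fun i _ => ?_
  refine card_submodule_mem_modEq_one p _ _ _ _ rfl (Submodule.finrank_le _) (Or.inr ?_)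
  exact Submodule.one_le_finrank_iff.mpr (hne i)

end Hecke

section RatFunc

variable {Fq : Type*} [Field Fq]

instance Polynomial.hasFiniteQuotients [Finite Fq] : Ring.HasFiniteQuotients (Polynomial Fq) where
  finiteQuotient {I} hI := by
    obtain ⟨g, hg, hg0⟩ := Submodule.exists_mem_ne_zero_of_ne_bot hI
    have hm := Polynomial.monic_mul_leadingCoeff_inv hg0
    have hle : Ideal.span {g * Polynomial.C g.leadingCoeff⁻¹} ≤ I := by
      rw [Ideal.span_singleton_le_iff_mem]
      exact I.mul_mem_right _ hg
    have := hm.finite_quotient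
    have : Finite (Polynomial Fq ⧸ Ideal.span {g * Polynomial.C g.leadingCoeff⁻¹}) :=
      Module.finite_of_finite Fq
    exact Finite.of_surjective _ (Ideal.Quotient.factor_surjective hle)

variable {r : ℕ}

theorem mem_locSet_iff {M : Submodule (Polynomial Fq) (Fin r → RatFunc Fq)}
    {p : Ideal (Polynomial Fq)} {x : Fin r → RatFunc Fq} :
    x ∈ locSet (M : Set (Fin r → RatFunc Fq)) p ↔ ∃ s ∉ p, s • x ∈ M := by
  have : ∀ s : Polynomial Fq,
      (fun i => algebraMap (Polynomial Fq) (RatFunc Fq) s * x i) = s • x := fun s => by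
    funext i
    rw [Pi.smul_apply, Algebra.smul_def]
  simp only [locSet, Set.mem_ofPred_eq, this, SetLike.mem_coe]

theorem mem_locSet_of_mem {M : Submodule (Polynomial Fq) (Fin r → RatFunc Fq)}
    {p : Ideal (Polynomial Fq)} (hp : p.IsMaximal) {x : Fin r → RatFunc Fq} (hx : x ∈ M) :
    x ∈ locSet (M : Set (Fin r → RatFunc Fq)) p :=
  mem_locSet_iff.mpr ⟨1, (Ideal.ne_top_iff_one p).mp hp.ne_top, by rwa [one_smul]⟩

theorem sub_mem_locSet {M : Submodule (Polynomial Fq) (Fin r → RatFunc Fq)}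
    {p : Ideal (Polynomial Fq)} (hp : p.IsMaximal) {x y : Fin r → RatFunc Fq}
    (hx : x ∈ locSet (M : Set (Fin r → RatFunc Fq)) p)
    (hy : y ∈ locSet (M : Set (Fin r → RatFunc Fq)) p) :
    x - y ∈ locSet (M : Set (Fin r → RatFunc Fq)) p := by
  obtain ⟨s, hs, hsx⟩ := mem_locSet_iff.mp hx
  obtain ⟨t, ht, hty⟩ := mem_locSet_iff.mp hy
  refine mem_locSet_iff.mpr ⟨s * t, hp.isPrime.mul_notMem hs ht, ?_⟩
  rw [smul_sub, mul_comm, mul_smul, mul_comm, mul_smul]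
  exact sub_mem (M.smul_mem _ hsx) (M.smul_mem _ hty)

theorem mem_of_forall_mem_locSet {M : Submodule (Polynomial Fq) (Fin r → RatFunc Fq)}
    {x : Fin r → RatFunc Fq} (h : ∀ p : Ideal (Polynomial Fq), p.IsMaximal →
      x ∈ locSet (M : Set (Fin r → RatFunc Fq)) p) : x ∈ M := by
  let I : Ideal (Polynomial Fq) := M.comap (LinearMap.toSpanSingleton _ _ x)
  have hI : I = ⊤ := by
    by_contra hI
    obtain ⟨p, hp, hIp⟩ := Ideal.exists_le_maximal I hI
    obtain ⟨s, hs, hsx⟩ := mem_locSet_iff.mp (h p hp)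
    exact hs (hIp hsx)
  have : (1 : Polynomial Fq) ∈ I := hI ▸ Submodule.mem_top
  simpa [I] using this

theorem exists_range_coordMap_eq {L : Submodule (Polynomial Fq) (Fin r → RatFunc Fq)}
    (hfg : L.FG) (hspan : Submodule.span (RatFunc Fq) (L : Set (Fin r → RatFunc Fq)) = ⊤) :
    ∃ h : GL (Fin r) (RatFunc Fq), LinearMap.range (coordMap (Polynomial Fq) h) = L := by
  have : L.IsLattice (RatFunc Fq) := ⟨hfg, hspan⟩
  have : Module.Free (Polynomial Fq) L := Submodule.IsLattice.free (RatFunc Fq) L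
  have hrank : Module.finrank (Polynomial Fq) L = r := by
    rw [Submodule.IsLattice.finrank_of_pi (K := RatFunc Fq) L, Fintype.card_fin]
  let b := Module.finBasisOfFinrankEq _ _ hrank
  let B := b.extendOfIsLattice (RatFunc Fq)
  have hu : IsUnit (Matrix.of fun i => B i) := by
    rw [← Matrix.linearIndependent_rows_iff_isUnit]
    exact B.linearIndependent
  obtain ⟨h, hh⟩ := hu
  have hsum : ∀ z, coordMap (Polynomial Fq) h z = ((∑ i, z i • b i : L) : Fin r → RatFunc Fq) := by
    intro z
    rw [coordMap_apply, hh]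
    funext j
    simp [Matrix.vecMul, dotProduct, B, Algebra.smul_def]
  refine ⟨h, le_antisymm ?_ fun x hx => ?_⟩
  · rintro _ ⟨z, rfl⟩
    rw [hsum]
    exact Subtype.property _
  · refine ⟨b.repr ⟨x, hx⟩, ?_⟩
    rw [hsum, b.sum_repr]

instance ringHomSurjective_algebraMap_residueField (p : Ideal (Polynomial Fq)) [p.IsMaximal] :
    RingHomSurjective (algebraMap (Polynomial Fq) p.ResidueField) :=
  ⟨p.algebraMap_residueField_surjective⟩

end RatFunc

section Local

variable {Fq : Type*} [Field Fq] {r : ℕ} {h δ : GL (Fin r) (RatFunc Fq)}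
  {L : Submodule (Polynomial Fq) (Fin r → RatFunc Fq)} {v v' : Fin r → RatFunc Fq}

theorem redMap_residueField_eq_zero_iff {p : Ideal (Polynomial Fq)} [p.IsPrime]
    {z : Fin r → Polynomial Fq} :
    redMap r (algebraMap (Polynomial Fq) p.ResidueField) z = 0 ↔ ∀ i, z i ∈ p := by
  rw [funext_iff]
  exact forall_congr' fun i => Ideal.algebraMap_residueField_eq_zero

theorem coordMap_mem_smul_range {p : Ideal (Polynomial Fq)} {z : Fin r → Polynomial Fq}
    (hz : ∀ i, z i ∈ p) :
    coordMap (Polynomial Fq) h z ∈ p • LinearMap.range (coordMap (Polynomial Fq) h) := by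
  rw [pi_eq_sum_univ' z, map_sum]
  refine sum_mem fun i _ => ?_
  rw [map_smul]
  exact Submodule.smul_mem_smul (hz i) ⟨_, rfl⟩

theorem redMap_mem_redSub_of_smul_mem {M : Submodule (Polynomial Fq) (Fin r → RatFunc Fq)}
    {p : Ideal (Polynomial Fq)} [p.IsMaximal] {z : Fin r → Polynomial Fq} {s : Polynomial Fq}
    (hs : s ∉ p) (hz : s • coordMap (Polynomial Fq) h z ∈ M) :
    redMap r (algebraMap (Polynomial Fq) p.ResidueField) z ∈
      redSub h (algebraMap (Polynomial Fq) p.ResidueField) M := by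
  have hs' : algebraMap (Polynomial Fq) p.ResidueField s ≠ 0 :=
    fun h => hs (Ideal.algebraMap_residueField_eq_zero.mp h)
  rw [← Submodule.smul_mem_iff _ hs', ← map_smulₛₗ]
  refine ⟨s • z, ?_, rfl⟩
  change coordMap (Polynomial Fq) h (s • z) ∈ M
  rwa [map_smul]

theorem redMap_surjective {p : Ideal (Polynomial Fq)} [p.IsMaximal] :
    Function.Surjective (redMap r (algebraMap (Polynomial Fq) p.ResidueField)) := fun x => by
  choose z hz using fun i => p.algebraMap_residueField_surjective (x i)
  exact ⟨z, funext hz⟩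

theorem rowEquiv_sub_mem_of_subset
    (hA : ∀ p : Ideal (Polynomial Fq), p.IsMaximal →
      rowEquiv (Polynomial Fq) δ '' cosetOf v (locSet (L : Set (Fin r → RatFunc Fq)) p) ⊆
        cosetOf v' (locSet (LinearMap.range (coordMap (Polynomial Fq) h) :
          Set (Fin r → RatFunc Fq)) p)) {x : Fin r → RatFunc Fq} (hx : x - v ∈ L) :
    rowEquiv (Polynomial Fq) δ x - v' ∈ LinearMap.range (coordMap (Polynomial Fq) h) :=
  mem_of_forall_mem_locSet fun p hp => hA p hp ⟨x, mem_locSet_of_mem hp hx, rfl⟩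

theorem exists_smul_mem_latMul_of_subset {p : Ideal (Polynomial Fq)} [hp : p.IsMaximal]
    (hC : locSet ((p • LinearMap.range (coordMap (Polynomial Fq) h) :
        Submodule (Polynomial Fq) (Fin r → RatFunc Fq)) : Set (Fin r → RatFunc Fq)) p ⊆
      rowEquiv (Polynomial Fq) δ '' locSet (L : Set (Fin r → RatFunc Fq)) p)
    {z : Fin r → Polynomial Fq}
    (hz : redMap r (algebraMap (Polynomial Fq) p.ResidueField) z = 0) :
    ∃ s ∉ p, s • coordMap (Polynomial Fq) h z ∈ latMul L δ := by
  obtain ⟨x, hx, hxz⟩ := hC (mem_locSet_of_mem hp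
    (coordMap_mem_smul_range (h := h) (redMap_residueField_eq_zero_iff.mp hz)))
  obtain ⟨s, hs, hsx⟩ := mem_locSet_iff.mp hx
  refine ⟨s, hs, ?_⟩
  rw [← hxz, ← map_smul, rowEquiv_mem_latMul]
  exact hsx

theorem redSub_ne_bot_of_ssubset {p : Ideal (Polynomial Fq)} [hp : p.IsMaximal]
    (hle : latMul L δ ≤ LinearMap.range (coordMap (Polynomial Fq) h))
    (hC : locSet ((p • LinearMap.range (coordMap (Polynomial Fq) h) :
        Submodule (Polynomial Fq) (Fin r → RatFunc Fq)) : Set (Fin r → RatFunc Fq)) p ⊂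
      rowEquiv (Polynomial Fq) δ '' locSet (L : Set (Fin r → RatFunc Fq)) p) :
    redSub h (algebraMap (Polynomial Fq) p.ResidueField) (latMul L δ) ≠ ⊥ := by
  intro hbot
  obtain ⟨_, ⟨x, hx, rfl⟩, hxp⟩ := Set.exists_of_ssubset hC
  obtain ⟨s, hs, hsx⟩ := mem_locSet_iff.mp hx
  have hsx' := rowEquiv_mem_latMul (γ := δ) |>.mpr hsx
  obtain ⟨z, hz⟩ := hle hsx'
  have hz0 : redMap r (algebraMap (Polynomial Fq) p.ResidueField) z ∈
      redSub h (algebraMap (Polynomial Fq) p.ResidueField) (latMul L δ) :=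
    ⟨z, by change coordMap _ h z ∈ latMul L δ; rwa [hz], rfl⟩
  rw [hbot, Submodule.mem_bot, redMap_residueField_eq_zero_iff] at hz0
  refine hxp (mem_locSet_iff.mpr ⟨s, hs, ?_⟩)
  rw [← map_smul, ← hz]
  exact coordMap_mem_smul_range hz0

theorem redSub_eq_top_of_image_eq {p : Ideal (Polynomial Fq)} [hp : p.IsMaximal]
    (hB : rowEquiv (Polynomial Fq) δ '' cosetOf v (locSet (L : Set (Fin r → RatFunc Fq)) p) =
        cosetOf v' (locSet (LinearMap.range (coordMap (Polynomial Fq) h) :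
          Set (Fin r → RatFunc Fq)) p)) :
    redSub h (algebraMap (Polynomial Fq) p.ResidueField) (latMul L δ) = ⊤ := by
  rw [eq_top_iff]
  rintro x -
  obtain ⟨z, rfl⟩ := redMap_surjective (p := p) x
  have key : ∀ z, v' + coordMap (Polynomial Fq) h z ∈
      rowEquiv (Polynomial Fq) δ '' cosetOf v (locSet (L : Set (Fin r → RatFunc Fq)) p) := by
    intro z
    rw [hB]
    refine mem_locSet_of_mem hp ?_
    rw [add_sub_cancel_left]
    exact ⟨z, rfl⟩
  obtain ⟨y, hy, hyz⟩ := key z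
  obtain ⟨y₀, hy₀, hyz₀⟩ := key 0
  have h1 := sub_mem_locSet hp hy hy₀
  rw [sub_sub_sub_cancel_right] at h1
  obtain ⟨s, hs, hsy⟩ := mem_locSet_iff.mp h1
  refine redMap_mem_redSub_of_smul_mem hs ?_
  rw [← rowEquiv_mem_latMul (γ := δ), map_smul, map_sub, hyz, hyz₀, map_zero] at hsy
  simpa using hsy

theorem coordMap_mem_latMul_of_forall_redMap_mem
    (hC : ∀ (p : Ideal (Polynomial Fq)) [p.IsMaximal] (z : Fin r → Polynomial Fq),
      redMap r (algebraMap (Polynomial Fq) p.ResidueField) z = 0 →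
      ∃ s ∉ p, s • coordMap (Polynomial Fq) h z ∈ latMul L δ)
    {z : Fin r → Polynomial Fq} (hz : ∀ (p : Ideal (Polynomial Fq)) [p.IsMaximal],
      redMap r (algebraMap (Polynomial Fq) p.ResidueField) z ∈
        redSub h (algebraMap (Polynomial Fq) p.ResidueField) (latMul L δ)) :
    coordMap (Polynomial Fq) h z ∈ latMul L δ := by
  refine mem_of_forall_mem_locSet fun p hp => mem_locSet_iff.mpr ?_
  obtain ⟨n, hn, hnz⟩ := hz p
  obtain ⟨s, hs, hsz⟩ := hC p (z - n) (by rw [map_sub, hnz, sub_self])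
  refine ⟨s, hs, ?_⟩
  rw [← sub_add_cancel z n, map_add, smul_add]
  exact add_mem hsz (Submodule.smul_mem _ s hn)

theorem finite_setOf_redSub_ne_top [Finite Fq]
    (hC : ∀ (p : Ideal (Polynomial Fq)) [p.IsMaximal] (z : Fin r → Polynomial Fq),
      redMap r (algebraMap (Polynomial Fq) p.ResidueField) z = 0 →
      ∃ s ∉ p, s • coordMap (Polynomial Fq) h z ∈ latMul L δ) :
    Finite {p : MaximalSpectrum (Polynomial Fq) //
      redSub h (algebraMap (Polynomial Fq) p.asIdeal.ResidueField) (latMul L δ) ≠ ⊤} := by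
  obtain ⟨p₀, hp₀⟩ := Ideal.exists_maximal (Polynomial Fq)
  obtain ⟨t, ht, ht0⟩ := Submodule.exists_mem_ne_zero_of_ne_bot
    (Ring.ne_bot_of_isMaximal_of_not_isField hp₀ (Polynomial.not_isField Fq))
  choose s hs hst using fun i : Fin r => hC p₀ (t • Pi.single i 1) <| by
    rw [map_smulₛₗ, Ideal.algebraMap_residueField_eq_zero.mpr ht, zero_smul]
  set a := (∏ i, s i) * t with ha
  have ha0 : a ≠ 0 := mul_ne_zero
    (Finset.prod_ne_zero_iff.mpr fun i _ h0 => hs i (h0 ▸ p₀.zero_mem)) ht0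
  have haz : ∀ z, a • coordMap (Polynomial Fq) h z ∈ latMul L δ := by
    intro z
    rw [pi_eq_sum_univ' z, map_sum, Finset.smul_sum]
    refine sum_mem fun i _ => ?_
    rw [map_smul, smul_comm]
    refine Submodule.smul_mem _ _ ?_
    rw [ha, mul_smul, ← map_smul (coordMap (Polynomial Fq) h) t]
    obtain ⟨b, hb⟩ := Finset.dvd_prod_of_mem s (Finset.mem_univ i)
    rw [hb, mul_comm, mul_smul]
    exact Submodule.smul_mem _ _ (hst i)
  have hfin := (Ring.HasFiniteQuotients.finite_setOfPred_mem a ha0).to_subtype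
  refine Finite.of_injective (β := {I : Ideal (Polynomial Fq) | a ∈ I})
    (fun P => ⟨P.1.asIdeal, ?_⟩) fun P Q hPQ => ?_
  · by_contra haP
    refine P.2 (eq_top_iff.mpr ?_)
    rintro x -
    obtain ⟨z, rfl⟩ := redMap_surjective (p := P.1.asIdeal) x
    exact redMap_mem_redSub_of_smul_mem haP (haz z)
  · exact Subtype.ext (MaximalSpectrum.ext (congrArg Subtype.val hPQ))

/-- Under the local conditions at all maximal ideals, each element of `v' + L'` lies in a number
of cosets `(v + L)γ` congruent to `1` modulo the characteristic, and these cosets are contained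
in `v' + L'`. -/
theorem card_sub_mem_latMul_modEq_one_of_local [Finite Fq] (p : ℕ) [Fact p.Prime] [CharP Fq p]
    (hA : ∀ P : Ideal (Polynomial Fq), P.IsMaximal →
      rowEquiv (Polynomial Fq) δ '' cosetOf v (locSet (L : Set (Fin r → RatFunc Fq)) P) ⊆
        cosetOf v' (locSet (LinearMap.range (coordMap (Polynomial Fq) h) :
          Set (Fin r → RatFunc Fq)) P))
    (hB : ∀ P : Ideal (Polynomial Fq), P.IsMaximal →
      v ∉ locSet (L : Set (Fin r → RatFunc Fq)) P →
      rowEquiv (Polynomial Fq) δ '' cosetOf v (locSet (L : Set (Fin r → RatFunc Fq)) P) =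
        cosetOf v' (locSet (LinearMap.range (coordMap (Polynomial Fq) h) :
          Set (Fin r → RatFunc Fq)) P))
    (hC : ∀ P : Ideal (Polynomial Fq), P.IsMaximal →
      locSet ((P • LinearMap.range (coordMap (Polynomial Fq) h) :
        Submodule (Polynomial Fq) (Fin r → RatFunc Fq)) : Set (Fin r → RatFunc Fq)) P ⊂
      rowEquiv (Polynomial Fq) δ '' locSet (L : Set (Fin r → RatFunc Fq)) P)
    {R : Set (GL (Fin r) (RatFunc Fq))}
    (hR : ∀ γ₁ ∈ R, ∀ γ₂ ∈ R, latMul L γ₁ = latMul L γ₂ →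
      rowEquiv (Polynomial Fq) γ₁ v - rowEquiv (Polynomial Fq) γ₂ v ∈ latMul L γ₂ → γ₁ = γ₂)
    (hRsub : ∀ γ ∈ R, ∃ c : GL (Fin r) (RatFunc Fq),
      latMul (LinearMap.range (coordMap (Polynomial Fq) h)) c =
        LinearMap.range (coordMap (Polynomial Fq) h) ∧
      rowEquiv (Polynomial Fq) c v' - v' ∈ LinearMap.range (coordMap (Polynomial Fq) h) ∧
      latMul L γ = latMul L (δ * c) ∧
      rowEquiv (Polynomial Fq) γ v - rowEquiv (Polynomial Fq) (δ * c) v ∈ latMul L (δ * c))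
    (hRsup : ∀ c : GL (Fin r) (RatFunc Fq),
      latMul (LinearMap.range (coordMap (Polynomial Fq) h)) c =
        LinearMap.range (coordMap (Polynomial Fq) h) →
      rowEquiv (Polynomial Fq) c v' - v' ∈ LinearMap.range (coordMap (Polynomial Fq) h) →
      ∃ γ ∈ R, latMul L γ = latMul L (δ * c) ∧
        rowEquiv (Polynomial Fq) γ v - rowEquiv (Polynomial Fq) (δ * c) v ∈ latMul L (δ * c)) :
    (∀ γ ∈ R, ∀ y, y - rowEquiv (Polynomial Fq) γ v ∈ latMul L γ →
      y - v' ∈ LinearMap.range (coordMap (Polynomial Fq) h)) ∧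
    ∀ y, y - v' ∈ LinearMap.range (coordMap (Polynomial Fq) h) →
      Nat.card {γ // γ ∈ R ∧ y - rowEquiv (Polynomial Fq) γ v ∈ latMul L γ} ≡ 1 [MOD p] := by
  have hv : rowEquiv (Polynomial Fq) δ v - v' ∈ LinearMap.range (coordMap (Polynomial Fq) h) :=
    rowEquiv_sub_mem_of_subset hA (by simp)
  have hle : latMul L δ ≤ LinearMap.range (coordMap (Polynomial Fq) h) := by
    rintro _ ⟨x, hx, rfl⟩
    have h1 := rowEquiv_sub_mem_of_subset hA (x := v + x) (by simpa using hx)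
    have h2 := sub_mem h1 hv
    simpa using h2
  have hC' : ∀ (P : Ideal (Polynomial Fq)) [P.IsMaximal] (z : Fin r → Polynomial Fq),
      redMap r (algebraMap (Polynomial Fq) P.ResidueField) z = 0 →
      ∃ s ∉ P, s • coordMap (Polynomial Fq) h z ∈ latMul L δ :=
    fun P hP z hz => exists_smul_mem_latMul_of_subset (hC P hP).subset hz
  let ι := {P : MaximalSpectrum (Polynomial Fq) //
      redSub h (algebraMap (Polynomial Fq) P.asIdeal.ResidueField) (latMul L δ) ≠ ⊤}
  have hι : Finite ι := finite_setOf_redSub_ne_top hC'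
  have := Fintype.ofFinite ι
  let k : ι → Type _ := fun P => P.1.asIdeal.ResidueField
  let _ : ∀ P, Field (k P) := fun P => inferInstanceAs (Field P.1.asIdeal.ResidueField)
  let π : ∀ P : ι, Polynomial Fq →+* k P := fun P =>
    algebraMap (Polynomial Fq) P.1.asIdeal.ResidueField
  have hπs : ∀ P, RingHomSurjective (π P) := fun P =>
    inferInstanceAs (RingHomSurjective (algebraMap (Polynomial Fq) P.1.asIdeal.ResidueField))
  have hchar : ∀ P, CharP (k P) p := fun P =>
    charP_of_injective_ringHom ((π P).comp Polynomial.C).injective p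
  have hfin : ∀ P, Finite (k P) := fun P => by
    have : Finite (Polynomial Fq ⧸ P.1.asIdeal) := Ring.HasFiniteQuotients.finiteQuotient
      (Ring.ne_bot_of_isMaximal_of_not_isField P.1.isMaximal (Polynomial.not_isField Fq))
    exact inferInstanceAs (Finite P.1.asIdeal.ResidueField)
  have hcop : Pairwise (Function.onFun IsCoprime fun P : ι => P.1.asIdeal) := fun P Q hPQ => by
    rw [Function.onFun, Ideal.isCoprime_iff_sup_eq]
    refine P.1.isMaximal.coprime_of_ne Q.1.isMaximal fun heq => hPQ ?_
    exact Subtype.ext (MaximalSpectrum.ext heq)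
  have hπ : ∀ c : ∀ P, k P, ∃ a, ∀ P, π P a = c P := by
    intro c
    choose a ha using fun P => (hπs P).is_surjective (c P)
    obtain ⟨b, hb⟩ := Ideal.exists_forall_sub_mem_ideal hcop a
    refine ⟨b, fun P => ?_⟩
    rw [← ha P, ← sub_eq_zero, ← map_sub]
    exact Ideal.algebraMap_residueField_eq_zero.mpr (hb P)
  obtain ⟨φ, hφ, hφv⟩ : ∃ φ, (∀ P, π P φ = 1) ∧ φ • v ∈ L := by
    let I : Ideal (Polynomial Fq) := L.comap (LinearMap.toSpanSingleton _ _ v)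
    have hI : ∀ P : ι, IsCoprime I P.1.asIdeal := fun P => by
      rw [Ideal.isCoprime_iff_sup_eq, sup_comm]
      by_contra hne
      have hIP : I ≤ P.1.asIdeal := by
        rw [← sup_eq_left]
        exact (P.1.isMaximal.eq_of_le hne le_sup_left).symm
      have hvP : v ∉ locSet (L : Set (Fin r → RatFunc Fq)) P.1.asIdeal := fun hv => by
        obtain ⟨s, hs, hsv⟩ := mem_locSet_iff.mp hv
        exact hs (hIP hsv)
      exact P.2 (redSub_eq_top_of_image_eq (hB _ P.1.isMaximal hvP))
    obtain ⟨a, ha, b, hb, hab⟩ := Ideal.isCoprime_iff_exists.mp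
      (IsCoprime.prod_right (t := Finset.univ) fun P _ => hI P)
    refine ⟨a, fun P => ?_, ha⟩
    have hbP : π P b = 0 := Ideal.algebraMap_residueField_eq_zero.mpr
      ((Ideal.prod_le_inf.trans (Finset.inf_le (Finset.mem_univ P))) hb)
    rw [← map_one (π P), ← hab, map_add, hbP, add_zero]
  have hloc : ∀ z, (∀ P, redMap r (π P) z ∈ redSub h (π P) (latMul L δ)) →
      coordMap (Polynomial Fq) h z ∈ latMul L δ := by
    intro z hz
    refine coordMap_mem_latMul_of_forall_redMap_mem hC' fun P hP => ?_
    by_cases hPt : redSub h (algebraMap (Polynomial Fq) P.ResidueField) (latMul L δ) = ⊤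
    · rw [hPt]
      exact Submodule.mem_top
    · exact hz ⟨⟨P, hP⟩, hPt⟩
  have hne : ∀ P, redSub h (π P) (latMul L δ) ≠ ⊥ := fun P =>
    redSub_ne_bot_of_ssubset hle (hC _ P.1.isMaximal)
  refine ⟨fun γ hγ y hy => ?_, fun y hy => card_sub_mem_latMul_modEq_one p π hπ hle hv hloc hne
    hφ hφv hR hRsub hRsup hy⟩
  obtain ⟨c, hc, hcv, hγL, hγv⟩ := hRsub γ hγ
  have hgood := redSub_of_latMul_eq π hle hv hloc hc hcv hγL hγv
  have := add_mem (hgood.1 hy) hgood.2.1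
  rwa [sub_add_sub_cancel] at this

end Local

section Eisenstein

variable {K : Type*} [NontriviallyNormedField K]

theorem jfac_ne_zero {FF : Type*} [Field FF] {σ : FF →+* K} {r : ℕ} (hr : 0 < r)
    {Finf : Subfield K} (hσ : ∀ z, σ z ∈ Finf) {ξ : K} (hξ : ξ ≠ 0) (γ : GL (Fin r) FF)
    {ω : Fin r → K} (hω : ω ∈ OmegaSet r hr Finf ξ) : jfac hr ξ (matOf σ γ) ω ≠ 0 := by
  refine mul_ne_zero (inv_ne_zero hξ) fun h0 => ?_
  have h1 : (fun j => σ (γ.1 (lastIdx r hr) j)) = 0 := hω.1 _ (fun i => hσ _) h0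
  have h2 : γ.1.det = 0 := Matrix.det_eq_zero_of_row_eq_zero (lastIdx r hr) fun j =>
    (map_eq_zero σ).mp (congrFun h1 j)
  exact ((Matrix.isUnit_iff_isUnit_det _).mp γ.isUnit).ne_zero h2

/-- Slashing an Eisenstein series by `γ` translates its index set by `γ`. -/
theorem jfac_zpow_mul_EisF {FF : Type*} [Field FF] {σ : FF →+* K} {r : ℕ} (hr : 0 < r) {ξ : K}
    (γ : GL (Fin r) FF) {ω : Fin r → K} (hj : jfac hr ξ (matOf σ γ) ω ≠ 0) (k : ℕ)
    (S : Set (Fin r → FF)) :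
    jfac hr ξ (matOf σ γ) ω ^ (-(k : ℤ)) * EisF σ k S (actOmega hr ξ (matOf σ γ) ω) =
      EisF σ k (rowEquiv FF γ '' S) ω := by
  let e : {x : Fin r → FF // x ∈ S ∧ x ≠ 0} ≃ {x : Fin r → FF // x ∈ rowEquiv FF γ '' S ∧ x ≠ 0} :=
    (rowEquiv FF γ).toEquiv.subtypeEquiv fun x => by simp
  rw [EisF, EisF, ← tsum_mul_left, ← e.tsum_eq]
  refine tsum_congr fun x => ?_
  have h1 : ∑ i, σ (x.1 i) * actOmega hr ξ (matOf σ γ) ω i =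
      (jfac hr ξ (matOf σ γ) ω)⁻¹ * ∑ i, σ ((e x).1 i) * ω i := by
    have h2 : ∀ i, σ ((e x).1 i) = Matrix.vecMul (σ ∘ x.1) (matOf σ γ) i := fun i =>
      RingHom.map_vecMul σ γ.1 x.1 i
    have h3 : ∑ i, σ ((e x).1 i) * ω i = dotProduct (σ ∘ x.1) ((matOf σ γ).mulVec ω) := by
      rw [Matrix.dotProduct_mulVec]
      exact Finset.sum_congr rfl fun i _ => by rw [h2]
    rw [h3, dotProduct, Finset.mul_sum]
    refine Finset.sum_congr rfl fun i _ => ?_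
    simp only [actOmega, Pi.smul_apply, smul_eq_mul, Function.comp_apply]
    ring
  rw [h1, mul_pow, mul_inv, inv_pow, inv_inv, zpow_neg, zpow_natCast, inv_mul_cancel_left₀]
  exact pow_ne_zero k hj

theorem exists_norm_le_mul_norm_rvPair {r : ℕ} {Finf : Subfield K}
    (hclosed : IsClosed (Finf : Set K)) [CompleteSpace K] (hnt : ∃ x ∈ Finf, 1 < ‖x‖)
    {ω : Fin r → K} (hω : ∀ x : Fin r → K, (∀ i, x i ∈ Finf) → rvPair x ω = 0 → x = 0) :
    ∃ C : ℝ, ∀ x : Fin r → K, (∀ i, x i ∈ Finf) → ‖x‖ ≤ C * ‖rvPair x ω‖ := by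
  obtain ⟨x₀, hx₀, hx₀1⟩ := hnt
  let _ : NontriviallyNormedField Finf :=
    { (inferInstance : NormedField Finf) with non_trivial := ⟨⟨x₀, hx₀⟩, hx₀1⟩ }
  let _ : NormedSpace Finf K := { norm_smul_le := fun a b => (norm_mul_le a.1 b) }
  have : CompleteSpace Finf := hclosed.completeSpace_coe
  let T : (Fin r → Finf) →ₗ[Finf] K :=
    { toFun := fun x => rvPair (fun i => (x i : K)) ω
      map_add' := fun x y => by simp [rvPair, add_mul, Finset.sum_add_distrib]
      map_smul' := fun a x => by
        simp [rvPair, Finset.mul_sum, mul_assoc, Subfield.smul_def] }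
  have hT : LinearMap.ker T = ⊥ := by
    rw [LinearMap.ker_eq_bot']
    intro x hx
    have := hω (fun i => (x i : K)) (fun i => (x i).2) hx
    exact funext fun i => Subtype.ext (congrFun this i)
  obtain ⟨C, -, hC⟩ := T.exists_antilipschitzWith hT
  refine ⟨C, fun x hx => ?_⟩
  have h1 := hC.le_mul_norm_sub (fun i => (⟨x i, hx i⟩ : Finf)) 0
  rw [map_zero, add_zero, add_zero, norm_neg, norm_neg] at h1
  refine le_trans (le_of_eq ?_) h1
  rfl


theorem exists_one_lt_norm {Fq : Type*} [Field Fq] {σ : RatFunc Fq →+* K} {r : ℕ} (hr : 0 < r)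
    (h : GL (Fin r) (RatFunc Fq))
    (hdisc : StronglyDiscrete ((fun x : Fin r → RatFunc Fq => fun i => σ (x i)) ''
      (LinearMap.range (coordMap (Polynomial Fq) h) : Set (Fin r → RatFunc Fq)))) :
    ∃ z, 1 < ‖σ z‖ := by
  by_contra! hle
  have hfin := hdisc _ (Metric.isBounded_closedBall (x := 0) (r := 1))
  have : Nonempty (Fin r) := ⟨⟨0, hr⟩⟩
  refine Set.infinite_of_injective_forall_mem
    (f := fun p : Polynomial Fq => fun i => σ (coordMap (Polynomial Fq) h (fun _ => p) i))
    (fun p q hpq => ?_) (fun p => ?_) hfin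
  · have h1 := coordMap_injective (A := Polynomial Fq) h
      (funext fun i => σ.injective (congrFun hpq i))
    exact congrFun h1 ⟨0, hr⟩
  · refine ⟨⟨_, ⟨_, rfl⟩, rfl⟩, ?_⟩
    rw [mem_closedBall_zero_iff, pi_norm_le_iff_of_nonneg zero_le_one]
    exact fun i => hle _

/-- The series defining `E_{k,v+L}(ω)` converges. -/
theorem summable_indicator_inv_pow [IsUltrametricDist K] [CompleteSpace K]
    {FF : Type*} [Field FF] {σ : FF →+* K} {r : ℕ}
    {M : Set (Fin r → FF)}
    (hdisc : StronglyDiscrete ((fun x : Fin r → FF => fun i => σ (x i)) '' M)) (v : Fin r → FF)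
    {ω : Fin r → K} {C : ℝ}
    (hC : ∀ x : Fin r → FF, ‖fun i => σ (x i)‖ ≤ C * ‖∑ i, σ (x i) * ω i‖)
    {k : ℕ} (hk : 1 ≤ k) :
    Summable ({y : Fin r → FF | y ∈ cosetOf v M ∧ y ≠ 0}.indicator
      fun y => ((∑ i, σ (y i) * ω i) ^ k)⁻¹) := by
  have hfin : ∀ D : ℝ, {y : Fin r → FF | y ∈ cosetOf v M ∧ ‖∑ i, σ (y i) * ω i‖ ≤ D}.Finite := by
    intro D
    have hinj : Function.Injective fun y : Fin r → FF => fun i => σ ((y - v) i) := fun y z hyz =>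
      sub_left_injective (funext fun i => σ.injective (congrFun hyz i))
    refine ((hdisc _ (Metric.isBounded_closedBall (x := 0)
      (r := |C| * D + ‖fun i => σ (v i)‖))).preimage hinj.injOn).subset fun y hy => ?_
    refine ⟨⟨y - v, hy.1, rfl⟩, ?_⟩
    rw [mem_closedBall_zero_iff]
    have h1 : (fun i => σ ((y - v) i)) = (fun i => σ (y i)) - fun i => σ (v i) := by
      funext i
      simp
    refine (congrArg norm h1).trans_le ?_
    refine (norm_sub_le _ _).trans (add_le_add_left ((hC y).trans ?_) _)
    exact mul_le_mul (le_abs_self C) hy.2 (norm_nonneg _) (abs_nonneg C)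
  refine NonarchimedeanAddGroup.summable_of_tendsto_cofinite_zero ?_
  rw [Metric.tendsto_nhds]
  intro ε hε
  rw [Filter.eventually_cofinite]
  refine (hfin (max 1 ε⁻¹)).subset fun y hy => ?_
  have hy : ε ≤ ‖{y : Fin r → FF | y ∈ cosetOf v M ∧ y ≠ 0}.indicator
      (fun y => ((∑ i, σ (y i) * ω i) ^ k)⁻¹) y‖ := by
    simpa using hy
  by_cases hyM : y ∈ {y : Fin r → FF | y ∈ cosetOf v M ∧ y ≠ 0}
  · refine ⟨hyM.1, ?_⟩
    rw [Set.indicator_of_mem hyM, norm_inv, norm_pow] at hy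
    by_contra! hlt
    obtain ⟨h1, h2⟩ := max_lt_iff.mp hlt
    have h3 : ‖∑ i, σ (y i) * ω i‖ ≤ ‖∑ i, σ (y i) * ω i‖ ^ k :=
      le_self_pow₀ h1.le (by omega)
    have h4 := inv_lt_of_inv_lt₀ hε (h2.trans_le h3)
    exact absurd hy (not_le.mpr h4)
  · rw [Set.indicator_of_notMem hyM, norm_zero] at hy
    exact absurd hy (not_le.mpr hε)

theorem EisF_eq_tsum_indicator {FF : Type*} [Field FF] (σ : FF →+* K) {r : ℕ} (k : ℕ)
    (S : Set (Fin r → FF)) (ω : Fin r → K) :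
    EisF σ k S ω = ∑' y, {y : Fin r → FF | y ∈ S ∧ y ≠ 0}.indicator
      (fun y => ((∑ i, σ (y i) * ω i) ^ k)⁻¹) y :=
  tsum_subtype {y : Fin r → FF | y ∈ S ∧ y ≠ 0} fun y => ((∑ i, σ (y i) * ω i) ^ k)⁻¹

/-- A sum of Eisenstein series over sets covering a set with constant multiplicity `1` in `K`
is the Eisenstein series of that set. -/
theorem sum_EisF_eq {FF : Type*} [Field FF] {σ : FF →+* K} {r k : ℕ} {ω : Fin r → K}
    [IsUltrametricDist K] [CompleteSpace K] {J : Type*} (R : Finset J) (S : J → Set (Fin r → FF))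
    {T : Set (Fin r → FF)} (hST : ∀ γ ∈ R, S γ ⊆ T)
    (hcard : ∀ y ∈ T, (Nat.card {γ // γ ∈ R ∧ y ∈ S γ} : K) = 1)
    (hsum : Summable ({y : Fin r → FF | y ∈ T ∧ y ≠ 0}.indicator
      fun y => ((∑ i, σ (y i) * ω i) ^ k)⁻¹)) :
    ∑ γ ∈ R, EisF σ k (S γ) ω = EisF σ k T ω := by
  classical
  simp only [EisF_eq_tsum_indicator]
  rw [← Summable.tsum_finsetSum]
  · refine tsum_congr fun y => ?_
    set f : (Fin r → FF) → K := fun y => ((∑ i, σ (y i) * ω i) ^ k)⁻¹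
    simp only [Set.indicator_apply, Set.mem_ofPred_eq]
    by_cases hy : y ∈ T ∧ y ≠ 0
    · have h1 := hcard y hy.1
      rw [Nat.subtype_card (R.filter fun γ => y ∈ S γ) (fun γ => Finset.mem_filter)] at h1
      simp only [hy.1, hy.2, ne_eq, not_false_eq_true, and_true, if_true]
      rw [← Finset.sum_filter, Finset.sum_const, nsmul_eq_mul, h1, one_mul]
    · rw [if_neg hy]
      exact Finset.sum_eq_zero fun γ hγ => if_neg fun h => hy ⟨hST γ hγ h.1, h.2⟩
  · intro γ hγ
    have h1 := hsum.indicator {y | y ∈ S γ ∧ y ≠ 0}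
    have h2 : {y | y ∈ S γ ∧ y ≠ 0} ⊆ {y | y ∈ T ∧ y ≠ 0} := fun y hy =>
      ⟨hST γ hγ hy.1, hy.2⟩
    rwa [Set.indicator_indicator, Set.inter_eq_left.mpr h2] at h1

end Eisenstein

/-- Corollary 14.8: under conditions (a), (b), (c) at every maximal ideal
`p` of `A = 𝔽_q[t]`, the Hecke operator `T_δ` sends `E_{k,v+L}` to `E_{k,v′+L′}`. -/
theorem hecke_eisenstein_image
    (K : Type*) [NontriviallyNormedField K] [IsUltrametricDist K] [CompleteSpace K]
    [IsAlgClosed K]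
    (Finf : Subfield K) (hFinfclosed : IsClosed (Finf : Set K))
    (hFinfloc : LocallyCompactSpace Finf)
    (ξ : K) (hξ : ξ ≠ 0)
    (Fq : Type*) [Field Fq] [Fintype Fq]
    (σ : RatFunc Fq →+* K) (hσ : ∀ z : RatFunc Fq, σ z ∈ Finf)
    (r k : ℕ) (hr : 2 ≤ r) (hk : 1 ≤ k)
    (L L' : Submodule (Polynomial Fq) (Fin r → RatFunc Fq))
    (hLfg : L.FG) (hL'fg : L'.FG)
    (hLspan : Submodule.span (RatFunc Fq) (L : Set (Fin r → RatFunc Fq)) = ⊤)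
    (hL'span : Submodule.span (RatFunc Fq) (L' : Set (Fin r → RatFunc Fq)) = ⊤)
    (hLdisc : StronglyDiscrete ((fun x : Fin r → RatFunc Fq => fun i => σ (x i)) ''
      (L : Set (Fin r → RatFunc Fq))))
    (hL'disc : StronglyDiscrete ((fun x : Fin r → RatFunc Fq => fun i => σ (x i)) ''
      (L' : Set (Fin r → RatFunc Fq))))
    (v v' : Fin r → RatFunc Fq) (δ : GL (Fin r) (RatFunc Fq))
    -- (a): `vδ + L_pδ ⊆ v′ + L′_p`
    (hA : ∀ p : Ideal (Polynomial Fq), p.IsMaximal →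
      (fun x => Matrix.vecMul x (δ : Matrix (Fin r) (Fin r) (RatFunc Fq))) ''
          cosetOf v (locSet (L : Set (Fin r → RatFunc Fq)) p) ⊆
        cosetOf v' (locSet (L' : Set (Fin r → RatFunc Fq)) p))
    -- (b): equality whenever `v ∉ L_p`
    (hB : ∀ p : Ideal (Polynomial Fq), p.IsMaximal →
      v ∉ locSet (L : Set (Fin r → RatFunc Fq)) p →
      (fun x => Matrix.vecMul x (δ : Matrix (Fin r) (Fin r) (RatFunc Fq))) ''
          cosetOf v (locSet (L : Set (Fin r → RatFunc Fq)) p) =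
        cosetOf v' (locSet (L' : Set (Fin r → RatFunc Fq)) p))
    -- (c): `pL′_p ⊊ L_pδ`
    (hC : ∀ p : Ideal (Polynomial Fq), p.IsMaximal →
      locSet ((p • L' : Submodule (Polynomial Fq) (Fin r → RatFunc Fq)) :
          Set (Fin r → RatFunc Fq)) p ⊂
        (fun x => Matrix.vecMul x (δ : Matrix (Fin r) (Fin r) (RatFunc Fq))) ''
          locSet (L : Set (Fin r → RatFunc Fq)) p)
    -- `R` is a set of representatives for `Γ_{v+L}∖Γ_{v+L}δΓ_{v′+L′}`
    (R : Finset (GL (Fin r) (RatFunc Fq)))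
    (hcover : (⋃ γ ∈ R, {g : GL (Fin r) (RatFunc Fq) |
        ∃ c ∈ GammaSet v (L : Set (Fin r → RatFunc Fq)), g = c * γ}) =
      {g : GL (Fin r) (RatFunc Fq) | ∃ c ∈ GammaSet v (L : Set (Fin r → RatFunc Fq)),
        ∃ c' ∈ GammaSet v' (L' : Set (Fin r → RatFunc Fq)), g = c * δ * c'})
    (hdisj : ∀ γ1 ∈ R, ∀ γ2 ∈ R,
      {g : GL (Fin r) (RatFunc Fq) |
          ∃ c ∈ GammaSet v (L : Set (Fin r → RatFunc Fq)), g = c * γ1} =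
        {g : GL (Fin r) (RatFunc Fq) |
          ∃ c ∈ GammaSet v (L : Set (Fin r → RatFunc Fq)), g = c * γ2} →
      γ1 = γ2) :
    ∀ ω ∈ OmegaSet r (by omega) Finf ξ,
      (∑ γ ∈ R, (jfac (by omega : 0 < r) ξ (matOf σ γ) ω) ^ (-(k : ℤ)) *
          EisF σ k (cosetOf v (L : Set (Fin r → RatFunc Fq)))
            (actOmega (by omega) ξ (matOf σ γ) ω)) =
        EisF σ k (cosetOf v' (L' : Set (Fin r → RatFunc Fq))) ω := by
  intro ω hω
  have hr0 : 0 < r := by omega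
  obtain ⟨h, rfl⟩ := exists_range_coordMap_eq hL'fg hL'span
  obtain ⟨p, _⟩ := CharP.exists Fq
  have : Fact p.Prime := ⟨CharP.char_is_prime Fq p⟩
  have : CharP K p :=
    charP_of_injective_ringHom (σ.comp (algebraMap Fq (RatFunc Fq))).injective p
  have hcos : ∀ g : GL (Fin r) (RatFunc Fq),
      (∃ γ ∈ R, ∃ c ∈ GammaSet v (L : Set (Fin r → RatFunc Fq)), g = c * γ) ↔ ∃ c ∈ GammaSet v (L : Set (Fin r → RatFunc Fq)),
        ∃ c' ∈ GammaSet v' (LinearMap.range (coordMap (Polynomial Fq) h) :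
          Set (Fin r → RatFunc Fq)), g = c * δ * c' := by
    intro g
    have := Set.ext_iff.mp hcover g
    simpa using this
  have hone : ∀ (v : Fin r → RatFunc Fq) (L : Submodule (Polynomial Fq) (Fin r → RatFunc Fq)),
      1 ∈ GammaSet v (L : Set (Fin r → RatFunc Fq)) := fun v L => by simp [GammaSet]
  obtain ⟨hsub, hcount⟩ := card_sub_mem_latMul_modEq_one_of_local (R := (R : Set _)) p hA hB hC
    (fun γ₁ h₁ γ₂ h₂ hLL hv => by
      refine hdisj γ₁ h₁ γ₂ h₂ (Set.ext fun g => ?_)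
      change (∃ c ∈ _, g = c * γ₁) ↔ (∃ c ∈ _, g = c * γ₂)
      rw [exists_mem_GammaSet_eq_mul_iff, exists_mem_GammaSet_eq_mul_iff, hLL,
        ← sub_add_sub_cancel _ (rowEquiv (Polynomial Fq) γ₁ v) (rowEquiv (Polynomial Fq) γ₂ v),
        (latMul L γ₂).add_mem_iff_left hv])
    (fun γ hγ => by
      obtain ⟨c₀, hc₀, c, hc, hγc⟩ := (hcos γ).mp ⟨γ, hγ, 1, hone _ _, (one_mul γ).symm⟩
      obtain ⟨hcL, hcv⟩ := mem_GammaSet_iff.mp hc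
      obtain ⟨h1, h2⟩ := exists_mem_GammaSet_eq_mul_iff.mp ⟨c₀, hc₀, hγc.trans (mul_assoc _ _ _)⟩
      exact ⟨c, hcL, hcv, h1, h2⟩)
    (fun c hc hcv => by
      obtain ⟨γ, hγ, c₀, hc₀, hγc⟩ := (hcos (δ * c)).mpr
        ⟨1, hone _ _, c, mem_GammaSet_iff.mpr ⟨hc, hcv⟩, by rw [one_mul]⟩
      obtain ⟨h1, h2⟩ := exists_mem_GammaSet_eq_mul_iff.mp ⟨c₀, hc₀, hγc⟩
      rw [← h1, ← neg_mem_iff, neg_sub] at h2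
      exact ⟨γ, hγ, h1.symm, h1 ▸ h2⟩)
  have hset : ∀ γ ∈ R, jfac hr0 ξ (matOf σ γ) ω ^ (-(k : ℤ)) *
      EisF σ k (cosetOf v (L : Set (Fin r → RatFunc Fq))) (actOmega hr0 ξ (matOf σ γ) ω) =
      EisF σ k (cosetOf (rowEquiv (Polynomial Fq) γ v)
        (latMul L γ : Set (Fin r → RatFunc Fq))) ω := fun γ _ => by
    rw [jfac_zpow_mul_EisF hr0 γ (jfac_ne_zero hr0 hσ hξ γ hω), ← image_vecMul_cosetOf]
    rfl
  rw [Finset.sum_congr rfl hset]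
  obtain ⟨z, hz⟩ := exists_one_lt_norm hr0 h hL'disc
  obtain ⟨C, hC⟩ := exists_norm_le_mul_norm_rvPair hFinfclosed ⟨_, hσ z, hz⟩ hω.1
  refine sum_EisF_eq R _ hsub (fun y hy => ?_)
    (summable_indicator_inv_pow hL'disc v' (fun x => hC _ fun i => hσ _) hk)
  rw [← Nat.cast_one]
  exact (CharP.natCast_eq_natCast K p).mpr (hcount y hy)
end

section
/- For all a, b ∈ A∖{0}, every ω ∈ K^r with ω_1,…,ω_r linearly independent over F_∞, and arbitrary choices of representative sets R_a, R_b, R_{ab}, one has Δ^L_{ab}(ω) = Δ^L_a(ω)·(Δ^L_b(ω))^{q^{r·deg(a)}}. (Multiplicativity of discriminant forms, proved in Proposition 16.3.) -/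
open scoped BigOperators

/-- The exponential function `e_Λ(z) = z·∏_{λ ∈ Λ, λ ≠ 0} (1 - z/λ)` of a subset `Λ ⊆ K`. -/
noncomputable def expF {K : Type*} [NormedField K] (Λ : Set K) (z : K) : K :=
  z * ∏' l : {l : K // l ∈ Λ ∧ l ≠ 0}, (1 - z / (l : K))

/-- `a⁻¹L = {x : a•x ∈ L}`. -/
def invSc {K : Type*} [Field K] {r : ℕ} (a : K) (L : Set (Fin r → K)) : Set (Fin r → K) :=
  {x | a • x ∈ L}

/-- `N⁻¹L = {x : b•x ∈ L for all b ∈ N}`, for an ideal `N` of a subring `A ⊆ K`. -/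
def invIdl {K : Type*} [Field K] {A : Subring K} {r : ℕ} (N : Ideal A)
    (L : Set (Fin r → K)) : Set (Fin r → K) :=
  {x | ∀ b : A, b ∈ N → (b : K) • x ∈ L}

/-- `R` contains exactly one element of each coset of `L` in `S` other than `L` itself. -/
def IsRepSet {K : Type*} [Field K] {r : ℕ} (L S : Set (Fin r → K))
    (R : Finset (Fin r → K)) : Prop :=
  (R : Set (Fin r → K)) ⊆ S \ L ∧ ∀ x ∈ S, x ∉ L → ∃! y, y ∈ R ∧ x - y ∈ L

/-- The discriminant value `a · ∏_{w ∈ R} e_{Lω}(wω)⁻¹`. -/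
noncomputable def discVal {K : Type*} [NormedField K] {r : ℕ} (a : K)
    (L : Set (Fin r → K)) (R : Finset (Fin r → K)) (ω : Fin r → K) : K :=
  a * ∏ w ∈ R, (expF ((fun x => rvPair x ω) '' L) (rvPair w ω))⁻¹

section InfiniteProduct

variable {K : Type*} [NormedField K] [IsUltrametricDist K]

theorem norm_prod_sub_one_le {ι : Type*} {f : ι → K} {ε : ℝ} (hε : 0 ≤ ε) (hε1 : ε ≤ 1)
    (s : Finset ι) (hs : ∀ i ∈ s, ‖f i - 1‖ ≤ ε) : ‖∏ i ∈ s, f i - 1‖ ≤ ε := by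
  classical
  induction s using Finset.induction_on with
  | empty => simpa using hε
  | insert i s hi ih =>
    rw [Finset.prod_insert hi]
    have h1 := hs i (Finset.mem_insert_self i s)
    have h2 := ih fun j hj => hs j (Finset.mem_insert_of_mem hj)
    have h3 : ‖f i‖ ≤ 1 := by
      have := IsUltrametricDist.norm_add_le_max (f i - 1) 1
      rw [sub_add_cancel, norm_one] at this
      exact this.trans (max_le (h1.trans hε1) le_rfl)
    have h4 : f i * ∏ j ∈ s, f j - 1 = f i * (∏ j ∈ s, f j - 1) + (f i - 1) := by ring
    rw [h4]
    refine (IsUltrametricDist.norm_add_le_max _ _).trans (max_le ?_ h1)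
    rw [norm_mul]
    exact (mul_le_of_le_one_left (norm_nonneg _) h3).trans h2

theorem norm_eq_one_of_norm_sub_one_lt {x : K} (hx : ‖x - 1‖ < 1) : ‖x‖ = 1 := by
  have h := IsUltrametricDist.norm_add_eq_max_of_norm_ne_norm (x := x - 1) (y := 1)
    (by rw [norm_one]; exact hx.ne)
  rwa [sub_add_cancel, norm_one, max_eq_right hx.le] at h

theorem multipliable_of_finite_le_norm_sub_one [CompleteSpace K] {ι : Type*} {f : ι → K}
    (hf : ∀ ε > 0, {i | ε ≤ ‖f i - 1‖}.Finite) : Multipliable f := by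
  classical
  have hsplit : ∀ s t : Finset ι, s ⊆ t →
      ∏ i ∈ t, f i = (∏ i ∈ s, f i) * ∏ i ∈ t \ s, f i := fun s t hst => by
    rw [mul_comm, Finset.prod_sdiff hst]
  have hcauchy : CauchySeq fun s : Finset ι => ∏ i ∈ s, f i := by
    rw [Metric.cauchySeq_iff']
    intro ε hε
    set s₀ := (hf 1 one_pos).toFinset with hs₀
    set C := ‖∏ i ∈ s₀, f i‖ with hC
    have hC0 : 0 ≤ C := norm_nonneg _
    set δ := min 1 (ε / (2 * (C + 1))) with hδ
    have hδ0 : 0 < δ := lt_min one_pos (by positivity)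
    refine ⟨s₀ ∪ (hf δ hδ0).toFinset, fun t ht => ?_⟩
    set N := s₀ ∪ (hf δ hδ0).toFinset with hN
    have hN1 : ‖∏ i ∈ N, f i‖ ≤ C := by
      rw [hsplit s₀ N Finset.subset_union_left, norm_mul, norm_prod (N \ s₀)]
      refine mul_le_of_le_one_right hC0 (Finset.prod_le_one (fun _ _ => norm_nonneg _) ?_)
      intro i hi
      have : ‖f i - 1‖ < 1 := by simpa [hs₀] using (Finset.mem_sdiff.1 hi).2
      exact (norm_eq_one_of_norm_sub_one_lt this).le
    have h2 : ‖∏ i ∈ t \ N, f i - 1‖ ≤ δ := by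
      refine norm_prod_sub_one_le hδ0.le (min_le_left _ _) _ fun i hi => ?_
      have hi' := (Finset.mem_sdiff.1 hi).2
      simp only [hN, Finset.mem_union, Set.Finite.mem_toFinset, Set.mem_ofPred_eq, not_or,
        not_le] at hi'
      exact hi'.2.le
    have h3 : (∏ i ∈ t, f i) - ∏ i ∈ N, f i = (∏ i ∈ N, f i) * (∏ i ∈ t \ N, f i - 1) := by
      rw [hsplit N t ht]; ring
    rw [dist_eq_norm, h3, norm_mul]
    calc _ ≤ C * (ε / (2 * (C + 1))) :=
          mul_le_mul hN1 (h2.trans (min_le_right _ _)) (norm_nonneg _) hC0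
      _ = (C / (C + 1)) * (ε / 2) := by field_simp
      _ ≤ 1 * (ε / 2) := by
          gcongr
          rw [div_le_one (by positivity)]; linarith
      _ < ε := by linarith
  obtain ⟨a, ha⟩ := cauchySeq_tendsto_of_complete hcauchy
  exact ⟨a, by simpa [HasProd] using ha⟩

theorem tprod_ne_zero_of_finite_le_norm_sub_one [CompleteSpace K] {ι : Type*} {f : ι → K}
    (hf : ∀ ε > 0, {i | ε ≤ ‖f i - 1‖}.Finite) (h0 : ∀ i, f i ≠ 0) : ∏' i, f i ≠ 0 := by
  have h1 := (multipliable_of_finite_le_norm_sub_one hf).hasProd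
  have h2 : HasProd (fun i => ‖f i‖) ‖∏' i, f i‖ := h1.norm
  have h3 : HasProd (fun i => ‖f i‖) (∏ i ∈ (hf 1 one_pos).toFinset, ‖f i‖) := by
    refine hasProd_prod_of_ne_finset_one fun i hi => norm_eq_one_of_norm_sub_one_lt ?_
    simpa using hi
  rw [← norm_ne_zero_iff, h2.unique h3]
  exact Finset.prod_ne_zero_iff.2 fun i _ => norm_ne_zero_iff.2 (h0 i)

end InfiniteProduct

section FiniteSubgroup

variable {K : Type*} [Field K]

theorem prod_add_right_periodic {V : Finset K} (hadd : ∀ v ∈ V, ∀ w ∈ V, v + w ∈ V)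
    (hneg : ∀ v ∈ V, -v ∈ V) {μ : K} (hμ : μ ∈ V) (z : K) :
    ∏ v ∈ V, (z + μ + v) = ∏ v ∈ V, (z + v) := by
  refine Finset.prod_nbij' (fun v => μ + v) (fun v => -μ + v) ?_ ?_ ?_ ?_ ?_
  · exact fun v hv => hadd _ hμ _ hv
  · exact fun v hv => hadd _ (hneg _ hμ) _ hv
  · simp
  · simp
  · intro v _
    ring

variable [DecidableEq K]

theorem mul_prod_one_sub_div_mul_prod {V : Finset K} (h0 : (0 : K) ∈ V)
    (hneg : ∀ v ∈ V, -v ∈ V) (z : K) :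
    (z * ∏ l ∈ V.erase 0, (1 - z / l)) * ∏ l ∈ V.erase 0, l = ∏ v ∈ V, (z + v) := by
  have h1 : ∏ l ∈ V.erase 0, (1 - z / l) = ∏ l ∈ V.erase 0, (1 + z / l) := by
    refine Finset.prod_nbij' Neg.neg Neg.neg ?_ ?_ ?_ ?_ ?_
    · intro v hv
      simp only [Finset.mem_erase, ne_eq, neg_eq_zero] at hv ⊢
      exact ⟨hv.1, hneg v hv.2⟩
    · intro v hv
      simp only [Finset.mem_erase, ne_eq, neg_eq_zero] at hv ⊢
      exact ⟨hv.1, hneg v hv.2⟩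
    · simp
    · simp
    · intro v _
      simp [div_neg, sub_eq_add_neg]
  rw [← Finset.mul_prod_erase V _ h0, h1, mul_assoc, ← Finset.prod_mul_distrib, add_zero]
  congr 1
  refine Finset.prod_congr rfl fun l hl => ?_
  have : l ≠ 0 := (Finset.mem_erase.1 hl).1
  field_simp
  ring

theorem prod_erase_zero_eq_mul_prod_cosets {M : Type*} [CommMonoid M] {V V' R : Finset K}
    (h0 : (0 : K) ∈ V) (hsub : V ⊆ V')
    (hmem : ∀ w ∈ R, ∀ v ∈ V, w + v ∈ V' ∧ w + v ∉ V)
    (hex : ∀ x ∈ V', x ∉ V → ∃ w ∈ R, x - w ∈ V)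
    (huniq : ∀ w ∈ R, ∀ w' ∈ R, ∀ v ∈ V, ∀ v' ∈ V, w + v = w' + v' → w = w') (g : K → M) :
    ∏ x ∈ V'.erase 0, g x = (∏ x ∈ V.erase 0, g x) * ∏ w ∈ R, ∏ v ∈ V, g (w + v) := by
  have hE : V.erase 0 ⊆ V'.erase 0 := Finset.erase_subset_erase 0 hsub
  rw [← Finset.prod_sdiff hE, mul_comm, ← Finset.prod_product']
  congr 1
  symm
  refine Finset.prod_nbij (fun p => p.1 + p.2) ?_ ?_ ?_ (fun _ _ => rfl)
  · rintro ⟨w, v⟩ hp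
    obtain ⟨hw, hv⟩ := Finset.mem_product.1 hp
    have := hmem w hw v hv
    simp only [Finset.mem_sdiff, Finset.mem_erase, not_and]
    exact ⟨⟨fun h => this.2 (h ▸ h0), this.1⟩, fun _ => this.2⟩
  · rintro ⟨w, v⟩ hp ⟨w', v'⟩ hp' h
    obtain ⟨hw, hv⟩ := Finset.mem_product.1 hp
    obtain ⟨hw', hv'⟩ := Finset.mem_product.1 hp'
    have h' : w + v = w' + v' := h
    obtain rfl := huniq w hw w' hw' v hv v' hv' h'
    rw [add_left_cancel h']
  · intro x hx
    simp only [Finset.coe_sdiff, Set.mem_sdiff, Finset.mem_coe, Finset.mem_erase, not_and] at hx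
    obtain ⟨w, hw, hv⟩ := hex x hx.1.2 (hx.2 hx.1.1)
    exact ⟨(w, x - w), Finset.mem_product.2 ⟨hw, hv⟩, by simp⟩

theorem finite_exp_mul_prod {V V' R : Finset K}
    (h0 : (0 : K) ∈ V) (hneg : ∀ v ∈ V, -v ∈ V) (hneg' : ∀ v ∈ V', -v ∈ V') (hsub : V ⊆ V')
    (hmem : ∀ w ∈ R, ∀ v ∈ V, w + v ∈ V' ∧ w + v ∉ V)
    (hex : ∀ x ∈ V', x ∉ V → ∃ w ∈ R, x - w ∈ V)
    (huniq : ∀ w ∈ R, ∀ w' ∈ R, ∀ v ∈ V, ∀ v' ∈ V, w + v = w' + v' → w = w') (z : K) :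
    (z * ∏ l ∈ V'.erase 0, (1 - z / l)) * ∏ w ∈ R, (w * ∏ l ∈ V.erase 0, (1 - w / l)) =
      (z * ∏ l ∈ V.erase 0, (1 - z / l)) *
        ∏ w ∈ R, ((z + w) * ∏ l ∈ V.erase 0, (1 - (z + w) / l)) := by
  have hP := prod_erase_zero_eq_mul_prod_cosets (M := K) h0 hsub hmem hex huniq
  have hE := mul_prod_one_sub_div_mul_prod h0 hneg
  have hE' := mul_prod_one_sub_div_mul_prod (hsub h0) hneg' z
  set c := ∏ l ∈ V.erase 0, l with hc
  have hc0 : c ≠ 0 := Finset.prod_ne_zero_iff.2 fun l hl => (Finset.mem_erase.1 hl).1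
  have h1 : ∏ v ∈ V', (z + v) = (∏ v ∈ V, (z + v)) * ∏ w ∈ R, ∏ v ∈ V, (z + w + v) := by
    rw [← Finset.mul_prod_erase V' _ (hsub h0), ← Finset.mul_prod_erase V _ h0, hP, mul_assoc]
    simp only [add_assoc]
  rw [h1, hP (fun x => x)] at hE'
  simp only [← hE, Finset.prod_mul_distrib (g := fun _ => c), Finset.prod_const] at hE'
  refine mul_right_cancel₀ (mul_ne_zero hc0 (pow_ne_zero R.card hc0)) ?_
  rw [← hc] at hE'
  linear_combination hE'

end FiniteSubgroup

section Exponential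

variable {K : Type*} [NormedField K]

/-- The elements of norm at most `n` in a strongly discrete set. -/
noncomputable def StronglyDiscrete.ball {Λ : Set K} (h : StronglyDiscrete Λ) (n : ℕ) : Finset K :=
  (h (Metric.closedBall 0 n) Metric.isBounded_closedBall).toFinset

theorem StronglyDiscrete.mem_ball {Λ : Set K} (h : StronglyDiscrete Λ) {n : ℕ} {x : K} :
    x ∈ h.ball n ↔ x ∈ Λ ∧ ‖x‖ ≤ n := by
  simp [StronglyDiscrete.ball]

theorem StronglyDiscrete.finite_le_norm_sub_one {Λ : Set K} (h : StronglyDiscrete Λ) (z : K)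
    (ε : ℝ) (hε : 0 < ε) :
    {l : {l : K // l ∈ Λ ∧ l ≠ 0} | ε ≤ ‖(1 - z / (l : K)) - 1‖}.Finite := by
  refine Set.Finite.of_finite_image (f := Subtype.val) ?_ Subtype.val_injective.injOn
  refine (h (Metric.closedBall 0 (‖z‖ / ε)) Metric.isBounded_closedBall).subset ?_
  rintro _ ⟨⟨l, hl, hl0⟩, hle, rfl⟩
  refine ⟨hl, ?_⟩
  have hl' : 0 < ‖l‖ := norm_pos_iff.2 hl0
  simp only [Set.mem_ofPred_eq, sub_sub_cancel_left, norm_neg, norm_div] at hle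
  rw [mem_closedBall_zero_iff, le_div_iff₀ hε]
  rw [le_div_iff₀ hl'] at hle
  linarith

theorem StronglyDiscrete.neg_mem_ball {Λ : AddSubgroup K} (h : StronglyDiscrete (Λ : Set K))
    {n : ℕ} : ∀ x ∈ h.ball n, -x ∈ h.ball n := by
  intro x hx
  rw [h.mem_ball] at hx ⊢
  exact ⟨Λ.neg_mem hx.1, by simpa using hx.2⟩

variable [IsUltrametricDist K] [CompleteSpace K]

theorem StronglyDiscrete.expF_ne_zero {Λ : Set K} (h : StronglyDiscrete Λ) {z : K} (hz0 : z ≠ 0)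
    (hz : z ∉ Λ) : expF Λ z ≠ 0 := by
  refine mul_ne_zero hz0 (tprod_ne_zero_of_finite_le_norm_sub_one (h.finite_le_norm_sub_one z) ?_)
  rintro ⟨l, hl, hl0⟩ heq
  rw [sub_eq_zero, eq_div_iff hl0, one_mul] at heq
  exact hz (heq ▸ hl)

theorem StronglyDiscrete.tendsto_expF [DecidableEq K] {Λ : Set K} (h : StronglyDiscrete Λ)
    (z : K) :
    Filter.Tendsto (fun n : ℕ => z * ∏ l ∈ (h.ball n).erase 0, (1 - z / l)) Filter.atTop
      (nhds (expF Λ z)) := by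
  classical
  refine Filter.Tendsto.const_mul z ?_
  have h1 := (multipliable_of_finite_le_norm_sub_one (h.finite_le_norm_sub_one z)).hasProd
  rw [HasProd, SummationFilter.unconditional_filter] at h1
  have h2 : Filter.Tendsto
      (fun n : ℕ => ((h.ball n).erase 0).subtype fun l => l ∈ Λ ∧ l ≠ 0)
      Filter.atTop Filter.atTop := by
    refine Filter.tendsto_atTop_finset_of_monotone ?_ ?_
    · intro m n hmn x hx
      simp only [Finset.mem_subtype, Finset.mem_erase, h.mem_ball] at hx ⊢
      exact ⟨hx.1, hx.2.1, hx.2.2.trans (by exact_mod_cast hmn)⟩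
    · rintro ⟨l, hl, hl0⟩
      obtain ⟨n, hn⟩ := exists_nat_ge ‖l‖
      refine ⟨n, ?_⟩
      simp only [Finset.mem_subtype, Finset.mem_erase, h.mem_ball]
      exact ⟨hl0, hl, hn⟩
  refine (h1.comp h2).congr fun n => ?_
  simp only [Function.comp]
  rw [Finset.prod_subtype_eq_prod_filter (f := fun l => 1 - z / l), Finset.filter_true_of_mem]
  intro l hl
  rw [Finset.mem_erase, h.mem_ball] at hl
  exact ⟨hl.2.1, hl.1⟩

theorem StronglyDiscrete.expF_add {Λ : AddSubgroup K} (h : StronglyDiscrete (Λ : Set K)) (z : K)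
    {μ : K} (hμ : μ ∈ Λ) : expF (Λ : Set K) (z + μ) = expF (Λ : Set K) z := by
  classical
  obtain ⟨N, hN⟩ := exists_nat_ge ‖μ‖
  refine tendsto_nhds_unique (h.tendsto_expF (z + μ)) ((h.tendsto_expF z).congr' ?_)
  filter_upwards [Filter.eventually_ge_atTop N] with n hn
  have h0 : (0 : K) ∈ h.ball n := h.mem_ball.2 ⟨Λ.zero_mem, by simp⟩
  have hadd : ∀ v ∈ h.ball n, ∀ w ∈ h.ball n, v + w ∈ h.ball n := by
    intro v hv w hw
    rw [h.mem_ball] at hv hw ⊢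
    exact ⟨Λ.add_mem hv.1 hw.1,
      (IsUltrametricDist.norm_add_le_max _ _).trans (max_le hv.2 hw.2)⟩
  have hμn : μ ∈ h.ball n := h.mem_ball.2 ⟨hμ, hN.trans (by exact_mod_cast hn)⟩
  have hc0 : ∏ l ∈ (h.ball n).erase 0, l ≠ 0 :=
    Finset.prod_ne_zero_iff.2 fun l hl => (Finset.mem_erase.1 hl).1
  refine mul_right_cancel₀ hc0 ?_
  rw [mul_prod_one_sub_div_mul_prod h0 h.neg_mem_ball,
    mul_prod_one_sub_div_mul_prod h0 h.neg_mem_ball,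
    prod_add_right_periodic hadd h.neg_mem_ball hμn]

theorem StronglyDiscrete.expF_mul_prod {Λ Λ' : AddSubgroup K} (h : StronglyDiscrete (Λ : Set K))
    (h' : StronglyDiscrete (Λ' : Set K)) (hle : Λ ≤ Λ') (R : Finset K)
    (hmem : ∀ w ∈ R, w ∈ Λ' ∧ w ∉ Λ) (hex : ∀ x ∈ Λ', x ∉ Λ → ∃ w ∈ R, x - w ∈ Λ)
    (huniq : ∀ w ∈ R, ∀ w' ∈ R, w - w' ∈ Λ → w = w') (z : K) :
    expF (Λ' : Set K) z * ∏ w ∈ R, expF (Λ : Set K) w =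
      expF (Λ : Set K) z * ∏ w ∈ R, expF (Λ : Set K) (z + w) := by
  classical
  obtain ⟨N, hN⟩ := exists_nat_ge (∑ w ∈ R, ‖w‖)
  have hR : ∀ w ∈ R, ‖w‖ ≤ N := fun w hw =>
    (Finset.single_le_sum (f := fun w => ‖w‖) (fun _ _ => norm_nonneg _) hw).trans hN
  refine tendsto_nhds_unique
    ((h'.tendsto_expF z).mul (tendsto_finsetProd R fun w _ => h.tendsto_expF w))
    (Filter.Tendsto.congr' ?_
      ((h.tendsto_expF z).mul (tendsto_finsetProd R fun w _ => h.tendsto_expF (z + w))))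
  filter_upwards [Filter.eventually_ge_atTop N] with n hn
  have hRn : ∀ w ∈ R, ‖w‖ ≤ n := fun w hw => (hR w hw).trans (by exact_mod_cast hn)
  symm
  apply finite_exp_mul_prod
  · exact h.mem_ball.2 ⟨Λ.zero_mem, by simp⟩
  · exact h.neg_mem_ball
  · exact h'.neg_mem_ball
  · intro x hx
    rw [h.mem_ball] at hx
    exact h'.mem_ball.2 ⟨hle hx.1, hx.2⟩
  · intro w hw v hv
    rw [h.mem_ball] at hv
    refine ⟨h'.mem_ball.2 ⟨Λ'.add_mem (hmem w hw).1 (hle hv.1),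
      (IsUltrametricDist.norm_add_le_max _ _).trans (max_le (hRn w hw) hv.2)⟩, fun hc => ?_⟩
    exact (hmem w hw).2 ((Λ.add_mem_cancel_right hv.1).1 (h.mem_ball.1 hc).1)
  · intro x hx hxn
    rw [h'.mem_ball] at hx
    obtain ⟨w, hw, hxw⟩ := hex x hx.1 fun hc => hxn (h.mem_ball.2 ⟨hc, hx.2⟩)
    refine ⟨w, hw, h.mem_ball.2 ⟨hxw, ?_⟩⟩
    rw [sub_eq_add_neg]
    refine (IsUltrametricDist.norm_add_le_max _ _).trans (max_le hx.2 ?_)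
    rw [norm_neg]
    exact hRn w hw
  · intro w hw w' hw' v hv v' hv' heq
    refine huniq w hw w' hw' ?_
    rw [show w - w' = v' - v by linear_combination heq]
    exact Λ.sub_mem (h.mem_ball.1 hv').1 (h.mem_ball.1 hv).1

end Exponential

section LatticeIndex

theorem relIndex_map_smul_span {A V ι : Type*} [CommRing A] [AddCommGroup V] [Module A V]
    [Fintype ι] {v : ι → V} (hv : LinearIndependent A v) (a : A) :
    ((Submodule.span A (Set.range v)).toAddSubgroup.map
        (DistribSMul.toAddMonoidHom V a)).relIndex (Submodule.span A (Set.range v)).toAddSubgroup =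
      Nat.card (A ⧸ Ideal.span {a}) ^ Fintype.card ι := by
  set ψ : (ι → A) →+ V := (Fintype.linearCombination A v).toAddMonoidHom with hψ
  have hinj : Function.Injective ψ := hv.fintypeLinearCombination_injective
  have hM : (Submodule.span A (Set.range v)).toAddSubgroup = (⊤ : AddSubgroup (ι → A)).map ψ := by
    ext x
    rw [Submodule.mem_toAddSubgroup, ← Fintype.range_linearCombination]
    simp [hψ, LinearMap.mem_range, -Fintype.range_linearCombination]
  have haM : (Submodule.span A (Set.range v)).toAddSubgroup.map (DistribSMul.toAddMonoidHom V a) =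
      (AddSubgroup.pi Set.univ fun _ : ι => (Ideal.span {a}).toAddSubgroup).map ψ := by
    rw [hM]
    ext x
    simp only [AddSubgroup.mem_map, AddSubgroup.mem_top, true_and, AddSubgroup.mem_pi,
      Set.mem_univ, forall_const, Submodule.mem_toAddSubgroup, Ideal.mem_span_singleton']
    constructor
    · rintro ⟨_, ⟨f, rfl⟩, rfl⟩
      exact ⟨a • f, fun i => ⟨f i, by simp [mul_comm]⟩, by simp [hψ]⟩
    · rintro ⟨f, hf, rfl⟩
      choose g hg using hf
      refine ⟨_, ⟨g, rfl⟩, ?_⟩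
      have : f = a • g := by
        ext i
        simp [← hg, mul_comm]
      simp [hψ, this]
  rw [haM, hM, AddSubgroup.relIndex_map_map_of_injective _ _ hinj, AddSubgroup.relIndex_top_right,
    AddSubgroup.index_pi, Finset.prod_const, Finset.card_univ]
  rfl

variable {A F V : Type*} [CommRing A] [IsDomain A] [Field F] [Algebra A F] [IsFractionRing A F]
  [AddCommGroup V] [Module F V] [Module A V] [IsScalarTower A F V]

theorem relIndex_ne_zero_of_span_eq (hquot : ∀ I : Ideal A, I ≠ ⊥ → Finite (A ⧸ I))
    {L : Submodule A V} (hL : L.FG) {s : Set V}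
    (hspan : Submodule.span F s = Submodule.span F (L : Set V)) :
    (Submodule.span A s).toAddSubgroup.relIndex L.toAddSubgroup ≠ 0 := by
  set N : Submodule A L := (Submodule.span A s).submoduleOf L with hN
  have : Module.Finite A L := Module.Finite.iff_fg.2 hL
  have htors : Module.IsTorsion A (L ⧸ N) := by
    intro y
    obtain ⟨x, rfl⟩ := Submodule.Quotient.mk_surjective N y
    obtain ⟨t, ht⟩ := multiple_mem_span_of_mem_localization_span (nonZeroDivisors A) F s (x : V)
      (hspan ▸ Submodule.subset_span x.2)
    exact ⟨t, (Submodule.Quotient.mk_eq_zero N).2 ht⟩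
  obtain ⟨d, hd, hd0⟩ := Submodule.annihilator_top_inter_nonZeroDivisors htors
  have : Finite (A ⧸ Ideal.span {d}) := hquot _ (by
    rw [Ne, Ideal.span_singleton_eq_bot]
    exact nonZeroDivisors.ne_zero hd0)
  have hfin := Submodule.finite_quotient_smul (Ideal.span {d})
    (N := (⊤ : Submodule A (L ⧸ N))) Module.Finite.fg_top
  have hbot : Ideal.span {d} • (⊤ : Submodule A (L ⧸ N)) = ⊥ := by
    rw [Submodule.ideal_span_singleton_smul, eq_bot_iff]
    rintro _ ⟨y, -, rfl⟩
    exact Submodule.mem_annihilator.1 hd y trivial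
  rw [hbot] at hfin
  have hfin' : Finite (L ⧸ N) := (Submodule.quotEquivOfEqBot ⊥ rfl).toEquiv.finite_iff.1 hfin
  exact (Nat.card_pos (α := L ⧸ N)).ne'

/-- A finitely generated submodule `L` of an `F`-vector space satisfies
`[L : aL] = |A / aA| ^ rank L`. -/
theorem relIndex_map_smul (hquot : ∀ I : Ideal A, I ≠ ⊥ → Finite (A ⧸ I))
    {L : Submodule A V} (hL : L.FG) [FiniteDimensional F (Submodule.span F (L : Set V))]
    {a : A} (ha : a ≠ 0) :
    (L.toAddSubgroup.map (DistribSMul.toAddMonoidHom V a)).relIndex L.toAddSubgroup =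
      Nat.card (A ⧸ Ideal.span {a}) ^ Module.finrank F (Submodule.span F (L : Set V)) := by
  obtain ⟨s, hsL, hspan, hli⟩ := exists_linearIndependent F (L : Set V)
  have hfin : FiniteDimensional F (Submodule.span F s) := hspan ▸ inferInstance
  have : Module.Finite F (Submodule.span F (Set.range ((↑) : s → V))) := by
    rwa [Subtype.range_coe]
  have : Finite s := Module.Finite.finite_basis (Module.Basis.span hli)
  have := Fintype.ofFinite s
  have hliA : LinearIndependent A ((↑) : s → V) :=
    hli.restrict_scalars fun x y h => IsFractionRing.injective A F (by
      simpa [Algebra.smul_def] using h)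
  have hcard := relIndex_map_smul_span hliA a
  rw [Subtype.range_coe] at hcard
  have hrank : Module.finrank F (Submodule.span F (L : Set V)) = Fintype.card s := by
    rw [← hspan]
    have := finrank_span_eq_card hli
    rwa [Subtype.range_coe] at this
  rw [hrank, ← hcard]
  set σ := DistribSMul.toAddMonoidHom V a with hσ
  have hinj : Function.Injective σ := by
    intro x y h
    have h' : a • x = a • y := h
    rw [← algebraMap_smul F a x, ← algebraMap_smul F a y] at h'
    exact smul_right_injective V
      ((map_ne_zero_iff _ (IsFractionRing.injective A F)).2 ha) h'
  set M := (Submodule.span A s).toAddSubgroup with hM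
  have hML : M ≤ L.toAddSubgroup := Submodule.span_le.2 hsL
  have hne : M.relIndex L.toAddSubgroup ≠ 0 := relIndex_ne_zero_of_span_eq hquot hL hspan
  have hσle : ∀ N : Submodule A V, N.toAddSubgroup.map σ ≤ N.toAddSubgroup := by
    rintro N _ ⟨x, hx, rfl⟩
    exact N.smul_mem a hx
  have h1 := AddSubgroup.relIndex_mul_relIndex _ _ _ (AddSubgroup.map_mono (f := σ) hML) (hσle L)
  have h2 := AddSubgroup.relIndex_mul_relIndex _ _ _ (hσle (Submodule.span A s)) hML
  rw [AddSubgroup.relIndex_map_map_of_injective _ _ hinj, ← h2, mul_comm] at h1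
  exact mul_right_cancel₀ hne h1

end LatticeIndex

section Representatives

variable {K : Type*} [Field K] {r : ℕ} {H S : AddSubgroup (Fin r → K)} {R : Finset (Fin r → K)}

theorem IsRepSet.eq_of_sub_mem (hR : IsRepSet (H : Set (Fin r → K)) (S : Set (Fin r → K)) R)
    {w w' : Fin r → K} (hw : w ∈ R) (hw' : w' ∈ R) (h : w - w' ∈ H) : w = w' :=
  (hR.2 w (hR.1 hw).1 (hR.1 hw).2).unique ⟨hw, by simp⟩ ⟨hw', h⟩

theorem IsRepSet.zero_notMem (hR : IsRepSet (H : Set (Fin r → K)) (S : Set (Fin r → K)) R) :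
    (0 : Fin r → K) ∉ R := fun h => (hR.1 h).2 H.zero_mem

theorem IsRepSet.prod_eq_prod {M ι : Type*} [CommMonoid M]
    (hR : IsRepSet (H : Set (Fin r → K)) (S : Set (Fin r → K)) R) {f : (Fin r → K) → M}
    (hf : ∀ x, ∀ h ∈ H, f (x + h) = f x) (s : Finset ι) (g : ι → Fin r → K)
    (hg : ∀ i ∈ s, g i ∈ S ∧ g i ∉ H) (hex : ∀ x ∈ S, x ∉ H → ∃ i ∈ s, x - g i ∈ H)
    (huniq : ∀ i ∈ s, ∀ j ∈ s, g i - g j ∈ H → i = j) :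
    ∏ x ∈ R, f x = ∏ i ∈ s, f (g i) := by
  choose j hjs hj using fun (x : Fin r → K) (hx : x ∈ R) => hex x (hR.1 hx).1 (hR.1 hx).2
  refine Finset.prod_bij j hjs ?_ ?_ ?_
  · intro x hx y hy hxy
    refine hR.eq_of_sub_mem hx hy ?_
    have h1 := hj x hx
    rw [hxy] at h1
    simpa using H.sub_mem h1 (hj y hy)
  · intro i hi
    obtain ⟨y, ⟨hy, hiy⟩, -⟩ := hR.2 (g i) (hg i hi).1 (hg i hi).2
    refine ⟨y, hy, huniq _ (hjs y hy) _ hi ?_⟩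
    simpa using H.neg_mem (H.add_mem hiy (hj y hy))
  · intro x hx
    rw [← hf (g (j x hx)) _ (hj x hx)]
    simp

variable [DecidableEq K]

theorem IsRepSet.eq_of_sub_mem_insert
    (hR : IsRepSet (H : Set (Fin r → K)) (S : Set (Fin r → K)) R)
    {w w' : Fin r → K} (hw : w ∈ insert 0 R) (hw' : w' ∈ insert 0 R) (h : w - w' ∈ H) :
    w = w' := by
  rcases Finset.mem_insert.1 hw with rfl | hw <;> rcases Finset.mem_insert.1 hw' with rfl | hw'
  · rfl
  · exact absurd (by simpa using h) (hR.1 hw').2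
  · exact absurd (by simpa using h) (hR.1 hw).2
  · exact hR.eq_of_sub_mem hw hw' h

theorem IsRepSet.exists_insert_sub_mem
    (hR : IsRepSet (H : Set (Fin r → K)) (S : Set (Fin r → K)) R) {x : Fin r → K} (hx : x ∈ S) :
    ∃ w ∈ insert 0 R, x - w ∈ H := by
  by_cases hxH : x ∈ H
  · exact ⟨0, Finset.mem_insert_self _ _, by simpa using hxH⟩
  · obtain ⟨w, ⟨hw, hxw⟩, -⟩ := hR.2 x hx hxH
    exact ⟨w, Finset.mem_insert_of_mem hw, hxw⟩

theorem IsRepSet.mem_of_mem_insert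
    (hR : IsRepSet (H : Set (Fin r → K)) (S : Set (Fin r → K)) R) {w : Fin r → K}
    (hw : w ∈ insert 0 R) : w ∈ S := by
  rcases Finset.mem_insert.1 hw with rfl | hw
  · exact S.zero_mem
  · exact (hR.1 hw).1

theorem IsRepSet.prod_mul {M : Type*} [CommMonoid M] {a b : K} (hb0 : b ≠ 0)
    (ha : ∀ x ∈ H, a • x ∈ H) (hb : ∀ x ∈ H, b • x ∈ H) {Ra Rb Rab : Finset (Fin r → K)}
    (hRa : IsRepSet (H : Set (Fin r → K)) (invSc a H) Ra)
    (hRb : IsRepSet (H : Set (Fin r → K)) (invSc b H) Rb)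
    (hRab : IsRepSet (H : Set (Fin r → K)) (invSc (a * b) H) Rab) {f : (Fin r → K) → M}
    (hf : ∀ x, ∀ h ∈ H, f (x + h) = f x) :
    ∏ x ∈ Rab, f x =
      (∏ w ∈ Rb, f w) * ∏ u ∈ Ra, ∏ w ∈ insert 0 Rb, f (b⁻¹ • u + w) := by
  change IsRepSet _ (H.comap (DistribSMul.toAddMonoidHom (Fin r → K) a) : Set (Fin r → K)) Ra
    at hRa
  change IsRepSet _ (H.comap (DistribSMul.toAddMonoidHom (Fin r → K) b) : Set (Fin r → K)) Rb
    at hRb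
  change IsRepSet _ (H.comap (DistribSMul.toAddMonoidHom (Fin r → K) (a * b)) :
    Set (Fin r → K)) Rab at hRab
  have hbR : ∀ w ∈ insert 0 Rb, b • w ∈ H := fun w hw => hRb.mem_of_mem_insert hw
  have hmul : ∀ u w : Fin r → K, b • (b⁻¹ • u + w) = u + b • w := fun u w => by
    rw [smul_add, smul_inv_smul₀ hb0]
  rw [hRab.prod_eq_prod hf (Rb.disjSum (Ra ×ˢ insert 0 Rb))
    (Sum.elim id fun p => b⁻¹ • p.1 + p.2), Finset.prod_disjSum, Finset.prod_product]
  · rfl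
  · intro i hi
    rcases i with w | ⟨u, w⟩
    · rw [Finset.inl_mem_disjSum] at hi
      refine ⟨?_, (hRb.1 hi).2⟩
      change (a * b) • w ∈ H
      rw [mul_smul]
      exact ha _ (hRb.1 hi).1
    · rw [Finset.inr_mem_disjSum, Finset.mem_product] at hi
      constructor
      · change (a * b) • (b⁻¹ • u + w) ∈ H
        rw [mul_smul, hmul, smul_add]
        exact H.add_mem (hRa.1 hi.1).1 (ha _ (hbR w hi.2))
      · intro hc
        have h1 : b • (b⁻¹ • u + w) ∈ H := hb _ hc
        rw [hmul] at h1
        exact (hRa.1 hi.1).2 ((H.add_mem_cancel_right (hbR w hi.2)).1 h1)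
  · intro x hx hxH
    by_cases hbx : b • x ∈ H
    · obtain ⟨w, ⟨hw, hxw⟩, -⟩ := hRb.2 x hbx hxH
      exact ⟨Sum.inl w, Finset.inl_mem_disjSum.2 hw, hxw⟩
    · have habx : a • b • x ∈ H := by
        rw [smul_smul]
        exact hx
      obtain ⟨u, ⟨hu, hxu⟩, -⟩ := hRa.2 (b • x) habx hbx
      have hxu' : b • (x - b⁻¹ • u) ∈ H := by
        rw [smul_sub, smul_inv_smul₀ hb0]
        exact hxu
      obtain ⟨w, hw, hxw⟩ := hRb.exists_insert_sub_mem (x := x - b⁻¹ • u) hxu'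
      refine ⟨Sum.inr (u, w), Finset.inr_mem_disjSum.2 (Finset.mem_product.2 ⟨hu, hw⟩), ?_⟩
      rw [sub_sub] at hxw
      exact hxw
  · have hcross : ∀ w ∈ Rb, ∀ u ∈ Ra, ∀ w' ∈ insert 0 Rb, b⁻¹ • u + w' - w ∉ H := by
      intro w hw u hu w' hw' hc
      have h1 := hb _ hc
      rw [smul_sub, hmul, add_sub_assoc] at h1
      exact (hRa.1 hu).2 ((H.add_mem_cancel_right
        (H.sub_mem (hbR w' hw') (hbR w (Finset.mem_insert_of_mem hw)))).1 h1)
    rintro (w | ⟨u, w⟩) hi (w' | ⟨u', w'⟩) hj h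
    · rw [Finset.inl_mem_disjSum] at hi hj
      rw [hRb.eq_of_sub_mem hi hj h]
    · rw [Finset.inl_mem_disjSum] at hi
      rw [Finset.inr_mem_disjSum, Finset.mem_product] at hj
      exact absurd (by simpa using H.neg_mem h) (hcross w hi u' hj.1 w' hj.2)
    · rw [Finset.inl_mem_disjSum] at hj
      rw [Finset.inr_mem_disjSum, Finset.mem_product] at hi
      exact absurd h (hcross w' hj u hi.1 w hi.2)
    · rw [Finset.inr_mem_disjSum, Finset.mem_product] at hi hj
      simp only [Sum.elim_inr] at h
      have h1 := hb _ h
      rw [smul_sub, hmul, hmul, add_sub_add_comm] at h1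
      obtain rfl : u = u' := hRa.eq_of_sub_mem hi.1 hj.1
        ((H.add_mem_cancel_right (H.sub_mem (hbR w hi.2) (hbR w' hj.2))).1 h1)
      rw [add_sub_add_left_eq_sub] at h
      obtain rfl : w = w' := hRb.eq_of_sub_mem_insert hi.2 hj.2 h
      rfl

end Representatives

theorem IsRepSet.card_add_one {K : Type*} [Field K] {r : ℕ} {H S : AddSubgroup (Fin r → K)}
    {R : Finset (Fin r → K)}
    (hR : IsRepSet (H : Set (Fin r → K)) (S : Set (Fin r → K)) R) :
    R.card + 1 = H.relIndex S := by
  classical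
  rw [← Finset.card_insert_of_notMem hR.zero_notMem, AddSubgroup.relIndex, AddSubgroup.index,
    ← Nat.card_eq_finsetCard]
  refine Nat.card_congr (Equiv.ofBijective (fun w : {w // w ∈ insert 0 R} =>
    QuotientAddGroup.mk (s := H.addSubgroupOf S) ⟨w.1, hR.mem_of_mem_insert w.2⟩) ⟨?_, ?_⟩)
  · rintro ⟨w, hw⟩ ⟨w', hw'⟩ h
    have h' : -w + w' ∈ H := AddSubgroup.mem_addSubgroupOf.1 (QuotientAddGroup.eq.1 h)
    rw [neg_add_eq_sub] at h'
    exact Subtype.ext (hR.eq_of_sub_mem_insert hw' hw h').symm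
  · intro y
    obtain ⟨⟨x, hx⟩, rfl⟩ := QuotientAddGroup.mk_surjective y
    obtain ⟨w, hw, hxw⟩ := hR.exists_insert_sub_mem hx
    refine ⟨⟨w, hw⟩, QuotientAddGroup.eq.2 ?_⟩
    rwa [AddSubgroup.mem_addSubgroupOf, AddSubgroup.coe_add, AddSubgroup.coe_neg, neg_add_eq_sub]

section Pairing

/-- The pairing with a fixed column vector, as an additive homomorphism. -/
noncomputable def rvPairHom {K : Type*} [Field K] {r : ℕ} (ω : Fin r → K) :
    (Fin r → K) →+ K where
  toFun x := rvPair x ω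
  map_zero' := by simp [rvPair]
  map_add' x y := by simp [rvPair, add_mul, Finset.sum_add_distrib]

theorem rvPair_smul {K : Type*} [Field K] {r : ℕ} (c : K) (x ω : Fin r → K) :
    rvPair (c • x) ω = c * rvPair x ω := by
  simp [rvPair, Finset.mul_sum, mul_assoc]

theorem isBounded_setOf_rvPair_mem {K : Type*} [NontriviallyNormedField K] [CompleteSpace K]
    {E : Subfield K} (hE : IsClosed (E : Set K)) {r : ℕ} {ω : Fin r → K}
    (hω : ∀ x : Fin r → K, (∀ i, x i ∈ E) → rvPair x ω = 0 → x = 0) {B : Set K}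
    (hB : Bornology.IsBounded B) :
    Bornology.IsBounded {x : Fin r → K | (∀ i, x i ∈ E) ∧ rvPair x ω ∈ B} := by
  by_cases htriv : ∀ c ∈ E, ‖c‖ ≤ 1
  · refine isBounded_iff_forall_norm_le.2 ⟨1, fun x hx => ?_⟩
    exact (pi_norm_le_iff_of_nonneg zero_le_one).2 fun i => htriv _ (hx.1 i)
  push Not at htriv
  obtain ⟨c, hcE, hc⟩ := htriv
  let : NontriviallyNormedField E :=
    { (inferInstance : NormedField E) with non_trivial := ⟨⟨c, hcE⟩, hc⟩ }
  have : CompleteSpace E := hE.completeSpace_coe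
  let : NormedSpace E K := { norm_smul_le := fun c x => (norm_mul_le (c : K) x) }
  set f : (Fin r → E) →ₗ[E] K := Fintype.linearCombination E ω with hf
  have hfx : ∀ y : Fin r → E, f y = rvPair (fun i => (y i : K)) ω := fun y => rfl
  have hker : LinearMap.ker f = ⊥ := by
    rw [LinearMap.ker_eq_bot']
    intro y hy
    have := hω _ (fun i => (y i).2) (hfx y ▸ hy)
    ext i
    exact congrFun this i
  obtain ⟨C, -, hC⟩ := f.exists_antilipschitzWith hker
  obtain ⟨D, hD⟩ := isBounded_iff_forall_norm_le.1 (hC.isBounded_preimage hB)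
  refine isBounded_iff_forall_norm_le.2 ⟨D, fun x hx => ?_⟩
  have h1 := hD (fun i => ⟨x i, hx.1 i⟩) hx.2
  have hD0 : 0 ≤ D := (norm_nonneg _).trans h1
  rw [pi_norm_le_iff_of_nonneg hD0] at h1 ⊢
  exact h1

end Pairing

section Discriminant

theorem expF_mul_eq {K : Type*} [NormedField K] {b : K} (hb0 : b ≠ 0) (Λ : Set K) (z : K) :
    expF Λ (b * z) = b * expF {x | b * x ∈ Λ} z := by
  rw [expF, expF, mul_assoc, ← ((Equiv.mulLeft₀ b hb0).subtypeEquiv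
    (p := fun l => l ∈ {x | b * x ∈ Λ} ∧ l ≠ 0) (q := fun l => l ∈ Λ ∧ l ≠ 0)
    fun l => by simp [hb0]).tprod_eq]
  simp [mul_div_mul_left _ _ hb0]

variable {K : Type*} [NontriviallyNormedField K] [IsUltrametricDist K] [CompleteSpace K]
  {r : ℕ} {H : AddSubgroup (Fin r → K)} {ω : Fin r → K}

theorem IsRepSet.expF_mul_prod {b : K} (hb0 : b ≠ 0)
    (hΛ : StronglyDiscrete ((H.map (rvPairHom ω) : AddSubgroup K) : Set K))
    (hinj : ∀ x, b • x ∈ H → rvPair x ω ∈ H.map (rvPairHom ω) → x ∈ H)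
    (hb : ∀ x ∈ H, b • x ∈ H) {R : Finset (Fin r → K)}
    (hR : IsRepSet (H : Set (Fin r → K)) (invSc b H) R) (z : K) :
    expF (H.map (rvPairHom ω) : Set K) (b * z) *
        ∏ w ∈ R, expF (H.map (rvPairHom ω) : Set K) (rvPair w ω) =
      b * (expF (H.map (rvPairHom ω) : Set K) z *
        ∏ w ∈ R, expF (H.map (rvPairHom ω) : Set K) (z + rvPair w ω)) := by
  classical
  set Λ := H.map (rvPairHom ω) with hΛdef
  set Λ' := Λ.comap (AddMonoidHom.mulLeft b) with hΛ'
  have hmemΛ : ∀ x ∈ H, rvPair x ω ∈ Λ := fun x hx => ⟨x, hx, rfl⟩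
  have hle : Λ ≤ Λ' := by
    rintro _ ⟨x, hx, rfl⟩
    change b * rvPair x ω ∈ Λ
    rw [← rvPair_smul]
    exact hmemΛ _ (hb x hx)
  have hdisc : StronglyDiscrete (Λ' : Set K) := by
    intro B hB
    obtain ⟨C, hC⟩ := isBounded_iff_forall_norm_le.1 hB
    refine Set.Finite.of_finite_image (f := fun x => b * x) ?_ (mul_right_injective₀ hb0).injOn
    refine (hΛ (Metric.closedBall 0 (‖b‖ * C)) Metric.isBounded_closedBall).subset ?_
    rintro _ ⟨x, ⟨hx, hxB⟩, rfl⟩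
    refine ⟨hx, ?_⟩
    rw [mem_closedBall_zero_iff, norm_mul]
    exact mul_le_mul_of_nonneg_left (hC x hxB) (norm_nonneg b)
  have hRmem : ∀ w ∈ R, b • w ∈ H := fun w hw => (hR.1 hw).1
  have huniq : ∀ w ∈ R, ∀ w' ∈ R, rvPair w ω - rvPair w' ω ∈ Λ → w = w' := by
    intro w hw w' hw' h
    change IsRepSet _ (H.comap (DistribSMul.toAddMonoidHom (Fin r → K) b) : Set (Fin r → K)) R
      at hR
    refine hR.eq_of_sub_mem hw hw' (hinj _ ?_ ?_)
    · rw [smul_sub]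
      exact H.sub_mem (hRmem w hw) (hRmem w' hw')
    · change rvPairHom ω (w - w') ∈ Λ
      rwa [map_sub]
  have hinjR : Set.InjOn (fun w => rvPair w ω) (R : Set (Fin r → K)) := by
    intro w hw w' hw' h
    refine huniq w hw w' hw' ?_
    rw [show rvPair w ω = rvPair w' ω from h, sub_self]
    exact Λ.zero_mem
  have key := hΛ.expF_mul_prod hdisc hle (R.image fun w => rvPair w ω) ?_ ?_ ?_ z
  · rw [Finset.prod_image hinjR, Finset.prod_image hinjR] at key
    rw [expF_mul_eq hb0, mul_assoc]
    exact congrArg (b * ·) key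
  · intro y hy
    obtain ⟨w, hw, rfl⟩ := Finset.mem_image.1 hy
    refine ⟨?_, fun h => (hR.1 hw).2 (hinj w (hRmem w hw) h)⟩
    change b * rvPair w ω ∈ Λ
    rw [← rvPair_smul]
    exact hmemΛ _ (hRmem w hw)
  · intro y hy hyΛ
    obtain ⟨h, hhH, hh : rvPair h ω = b * y⟩ := hy
    have hyx : rvPair (b⁻¹ • h) ω = y := by
      rw [rvPair_smul, hh, inv_mul_cancel_left₀ hb0]
    have hbH : b • b⁻¹ • h ∈ H := by rwa [smul_inv_smul₀ hb0]
    obtain ⟨w, ⟨hw, hxw⟩, -⟩ := hR.2 (b⁻¹ • h) hbH fun hc => hyΛ (hyx ▸ hmemΛ _ hc)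
    refine ⟨_, Finset.mem_image_of_mem _ hw, ?_⟩
    rw [← hyx]
    exact (map_sub (rvPairHom ω) (b⁻¹ • h) w) ▸ hmemΛ _ hxw
  · intro y hy y' hy' h
    obtain ⟨w, hw, rfl⟩ := Finset.mem_image.1 hy
    obtain ⟨w', hw', rfl⟩ := Finset.mem_image.1 hy'
    rw [huniq w hw w' hw' h]

theorem discVal_mul {a b : K} (hb0 : b ≠ 0)
    (hΛ : StronglyDiscrete ((H.map (rvPairHom ω) : AddSubgroup K) : Set K))
    (hinj : ∀ x, b • x ∈ H → rvPair x ω ∈ H.map (rvPairHom ω) → x ∈ H)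
    (ha : ∀ x ∈ H, a • x ∈ H) (hb : ∀ x ∈ H, b • x ∈ H) {Ra Rb Rab : Finset (Fin r → K)}
    (hRa : IsRepSet (H : Set (Fin r → K)) (invSc a H) Ra)
    (hRb : IsRepSet (H : Set (Fin r → K)) (invSc b H) Rb)
    (hRab : IsRepSet (H : Set (Fin r → K)) (invSc (a * b) H) Rab) :
    discVal (a * b) (H : Set (Fin r → K)) Rab ω =
      discVal a (H : Set (Fin r → K)) Ra ω *
        discVal b (H : Set (Fin r → K)) Rb ω ^ (Ra.card + 1) := by
  classical
  set Λ := H.map (rvPairHom ω) with hΛdef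
  set ℓ : (Fin r → K) → K := fun x => expF (Λ : Set K) (rvPair x ω) with hℓ
  have hdisc : ∀ (c : K) (R : Finset (Fin r → K)),
      discVal c (H : Set (Fin r → K)) R ω = c * (∏ w ∈ R, ℓ w)⁻¹ := by
    intro c R
    rw [← Finset.prod_inv_distrib]
    rfl
  have hadd : ∀ x y, rvPair (x + y) ω = rvPair x ω + rvPair y ω := map_add (rvPairHom ω)
  have hper : ∀ x, ∀ h ∈ H, ℓ (x + h) = ℓ x := by
    intro x h hh
    simp only [hℓ, hadd]
    exact hΛ.expF_add _ ⟨h, hh, rfl⟩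
  have hPb : ∏ w ∈ Rb, ℓ w ≠ 0 := by
    refine Finset.prod_ne_zero_iff.2 fun w hw => ?_
    have hw' : rvPair w ω ∉ Λ := fun h => (hRb.1 hw).2 (hinj w (hRb.1 hw).1 h)
    exact hΛ.expF_ne_zero (fun h => hw' (h ▸ Λ.zero_mem)) hw'
  have h0 : (0 : Fin r → K) ∉ Rb := fun h => (hRb.1 h).2 H.zero_mem
  have hfib : ∀ u, ∏ w ∈ insert 0 Rb, ℓ (b⁻¹ • u + w) = ℓ u * (∏ w ∈ Rb, ℓ w) * b⁻¹ := by
    intro u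
    have key := hRb.expF_mul_prod hb0 hΛ hinj hb (rvPair (b⁻¹ • u) ω)
    rw [← rvPair_smul, smul_inv_smul₀ hb0] at key
    rw [Finset.prod_insert h0, add_zero, eq_mul_inv_iff_mul_eq₀ hb0, mul_comm _ b]
    simp only [hℓ, hadd]
    exact key.symm
  rw [hdisc, hdisc, hdisc, hRa.prod_mul hb0 ha hb hRb hRab hper]
  simp only [hfib, Finset.prod_mul_distrib, Finset.prod_const]
  simp only [mul_inv, mul_pow, inv_pow, inv_inv, pow_succ]
  ring

end Discriminant

theorem IsRepSet.card_add_one_eq {K : Type*} [Field K] {A : Subring K} {F : Subfield K}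
    (hAF : (A : Set K) ⊆ F) (hFrac : ∀ z ∈ F, ∃ a ∈ A, ∃ b ∈ A, b ≠ 0 ∧ z * b = a)
    (hquot : ∀ I : Ideal A, I ≠ ⊥ → Finite (A ⧸ I)) {r : ℕ} {G : AddSubgroup (Fin r → K)}
    (hLF : ∀ x ∈ G, ∀ i, x i ∈ F) (hLA : ∀ a ∈ A, ∀ x ∈ G, a • x ∈ G)
    (hLfg : ∃ T : Finset (Fin r → K), (T : Set (Fin r → K)) ⊆ G ∧
      ∀ x ∈ G, x ∈ AddSubgroup.closure
        {y | ∃ a ∈ (A : Set K), ∃ t ∈ (T : Set (Fin r → K)), y = a • t})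
    (hLspan : ∀ y : Fin r → K, (∀ i, y i ∈ F) →
      y ∈ AddSubgroup.closure {z | ∃ c ∈ (F : Set K), ∃ x ∈ (G : Set (Fin r → K)), z = c • x})
    {a : A} (ha : a ≠ 0) {R : Finset (Fin r → K)}
    (hR : IsRepSet (G : Set (Fin r → K)) (invSc (a : K) G) R) :
    R.card + 1 = Nat.card (A ⧸ Ideal.span {a}) ^ r := by
  let : Algebra A F := (Subring.inclusion (S := A) (T := F.toSubring) hAF).toAlgebra
  have : IsScalarTower A F (Fin r → K) :=
    ⟨fun c d x => by
      ext i
      exact mul_assoc (c : K) d (x i)⟩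
  have : FaithfulSMul A F := (faithfulSMul_iff_algebraMap_injective A F).2
    (Subring.inclusion_injective _)
  have : IsFractionRing A F := by
    refine IsFractionRing.of_field A F fun z => ?_
    obtain ⟨c, hc, d, hd, hd0, hz⟩ := hFrac z z.2
    refine ⟨⟨c, hc⟩, ⟨d, hd⟩, Subtype.ext ?_⟩
    exact eq_div_of_mul_eq hd0 hz
  let L : Submodule A (Fin r → K) := { G with smul_mem' := fun c x hx => hLA c c.2 x hx }
  have hLG : L.toAddSubgroup = G := rfl
  have hfg : L.FG := by
    obtain ⟨T, hTL, hT⟩ := hLfg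
    refine ⟨T, le_antisymm (Submodule.span_le.2 hTL) fun x hx => ?_⟩
    refine (AddSubgroup.closure_le (Submodule.span A (T : Set (Fin r → K))).toAddSubgroup).2 ?_
      (hT x hx)
    rintro _ ⟨c, hc, t, ht, rfl⟩
    exact Submodule.smul_mem _ (⟨c, hc⟩ : A) (Submodule.subset_span ht)
  let φ : (Fin r → F) →ₗ[F] (Fin r → K) := (Algebra.linearMap F K).compLeft (Fin r)
  have hφ : Function.Injective φ := fun x y h => by
    ext i
    exact congrFun h i
  have hspan : Submodule.span F (L : Set (Fin r → K)) = LinearMap.range φ := by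
    refine le_antisymm (Submodule.span_le.2 fun x hx => ⟨fun i => ⟨x i, hLF x hx i⟩, rfl⟩) ?_
    rintro _ ⟨y, rfl⟩
    refine (AddSubgroup.closure_le
      (Submodule.span F (L : Set (Fin r → K))).toAddSubgroup).2 ?_ (hLspan _ fun i => (y i).2)
    rintro _ ⟨c, hc, x, hx, rfl⟩
    exact Submodule.smul_mem _ (⟨c, hc⟩ : F) (Submodule.subset_span hx)
  have : FiniteDimensional F (Submodule.span F (L : Set (Fin r → K))) := by
    rw [hspan]
    infer_instance
  have ha' : (a : K) ≠ 0 := by simpa using ha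
  have hidx := relIndex_map_smul (F := F) hquot hfg ha
  rw [hspan, LinearMap.finrank_range_of_inj hφ, Module.finrank_fin_fun, hLG] at hidx
  set σ := DistribSMul.toAddMonoidHom (Fin r → K) a with hσ
  change IsRepSet _ (G.comap σ : Set (Fin r → K)) R at hR
  have hσinj : Function.Injective σ := fun x y h => smul_right_injective (Fin r → K) ha' h
  have hσsurj : Function.Surjective σ := fun x => ⟨(a : K)⁻¹ • x, smul_inv_smul₀ ha' x⟩
  rw [hR.card_add_one, ← AddSubgroup.relIndex_map_map_of_injective _ _ hσinj,
    AddSubgroup.map_comap_eq_self_of_surjective hσsurj, hidx]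

/-- multiplicativity `Δ^L_{ab}(ω) = Δ^L_a(ω)·(Δ^L_b(ω))^{q^{r·deg a}}`
of discriminant forms. -/
theorem disc_multiplicative
    (K : Type*) [NontriviallyNormedField K] [IsUltrametricDist K] [CompleteSpace K]
    [IsAlgClosed K]
    (Finf : Subfield K) (hFinfclosed : IsClosed (Finf : Set K))
    (hFinfloc : LocallyCompactSpace Finf)
    (Fq : Subfield K) (hFqfin : Finite Fq) (q : ℕ) (hq : Nat.card Fq = q)
    (A : Subring K) (hFqA : (Fq : Set K) ⊆ A)
    (F : Subfield K) (hAF : (A : Set K) ⊆ F) (hFFinf : F ≤ Finf)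
    (hDed : IsDedekindDomain A)
    (hFrac : ∀ z ∈ F, ∃ a ∈ A, ∃ b ∈ A, b ≠ 0 ∧ z * b = a)
    (hquot : ∀ I : Ideal A, I ≠ ⊥ → Finite (A ⧸ I))
    (r : ℕ) (hr : 2 ≤ r)
    (L : Set (Fin r → K))
    (hLsub : ∃ G : AddSubgroup (Fin r → K), (G : Set (Fin r → K)) = L)
    (hLF : ∀ x ∈ L, ∀ i, x i ∈ F)
    (hLA : ∀ a ∈ (A : Set K), ∀ x ∈ L, a • x ∈ L)
    (hLfg : ∃ T : Finset (Fin r → K), (T : Set (Fin r → K)) ⊆ L ∧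
      ∀ x ∈ L, x ∈ AddSubgroup.closure
        {y | ∃ a ∈ (A : Set K), ∃ t ∈ (T : Set (Fin r → K)), y = a • t})
    (hLspan : ∀ y : Fin r → K, (∀ i, y i ∈ F) →
      y ∈ AddSubgroup.closure {z | ∃ c ∈ (F : Set K), ∃ x ∈ L, z = c • x})
    (hLdisc : StronglyDiscrete L)
    (a b : A) (ha : a ≠ 0) (hb : b ≠ 0)
    (dega : ℕ) (hdega : Nat.card (A ⧸ Ideal.span {a}) = q ^ dega)
    (ω : Fin r → K)
    (hω : ∀ x : Fin r → K, (∀ i, x i ∈ Finf) → rvPair x ω = 0 → x = 0)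
    (Ra Rb Rab : Finset (Fin r → K))
    (hRa : IsRepSet L (invSc ((a : K)) L) Ra)
    (hRb : IsRepSet L (invSc ((b : K)) L) Rb)
    (hRab : IsRepSet L (invSc ((a : K) * (b : K)) L) Rab) :
    discVal ((a : K) * (b : K)) L Rab ω =
      discVal (a : K) L Ra ω * (discVal (b : K) L Rb ω) ^ (q ^ (r * dega)) := by
  obtain ⟨G, rfl⟩ := hLsub
  have ha0 : (a : K) ≠ 0 := by simpa using ha
  have hb0 : (b : K) ≠ 0 := by simpa using hb
  have hF : ∀ x : Fin r → K, (b : K) • x ∈ G → ∀ i, x i ∈ F := by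
    intro x hx i
    have h1 := F.mul_mem (F.inv_mem (hAF b.2)) (hLF _ hx i)
    rwa [Pi.smul_apply, smul_eq_mul, inv_mul_cancel_left₀ hb0] at h1
  have hΛ : StronglyDiscrete ((G.map (rvPairHom ω) : AddSubgroup K) : Set K) := by
    intro B hB
    refine ((hLdisc _ (isBounded_setOf_rvPair_mem hFinfclosed hω hB)).image
      (rvPairHom ω)).subset ?_
    rintro _ ⟨⟨x, hx, rfl⟩, hxB⟩
    exact ⟨x, ⟨hx, fun i => hFFinf (hLF x hx i), hxB⟩, rfl⟩
  have hinj : ∀ x, (b : K) • x ∈ G → rvPair x ω ∈ G.map (rvPairHom ω) → x ∈ G := by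
    rintro x hbx ⟨y, hy, hyx⟩
    have h0 : rvPair (x - y) ω = 0 := by
      change rvPairHom ω (x - y) = 0
      rw [map_sub, sub_eq_zero]
      exact hyx.symm
    have hxy := hω (x - y)
      (fun i => hFFinf (F.sub_mem (hF x hbx i) (hLF y hy i))) h0
    rwa [sub_eq_zero.1 hxy]
  rw [discVal_mul hb0 hΛ hinj (fun x hx => hLA a a.2 x hx) (fun x hx => hLA b b.2 x hx)
    hRa hRb hRab, IsRepSet.card_add_one_eq hAF hFrac hquot hLF (fun c hc x hx => hLA c hc x hx)
    hLfg hLspan ha hRa, hdega, ← pow_mul, mul_comm dega r]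
end

section
/- For all a, b ∈ A∖{0} and every ω ∈ K^r with ω_1,…,ω_r linearly independent over F_∞, one has (Δ^L_a(ω))^{q^{r·deg(b)}−1} = (Δ^L_b(ω))^{q^{r·deg(a)}−1}. (Key relation (16.6) in the proof of Proposition 16.3.) -/
open scoped BigOperators

namespace DiscPower

open Filter Topology

section InfiniteProduct

variable {K : Type*} [NormedField K] [IsUltrametricDist K]

lemma norm_one_add_eq_one {x : K} (hx : ‖x‖ < 1) : ‖1 + x‖ = 1 := by
  rw [IsUltrametricDist.norm_add_eq_max_of_norm_ne_norm (by rw [norm_one]; exact hx.ne'), norm_one,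
    max_eq_left hx.le]

lemma norm_prod_one_add_sub_one_le {ι : Type*} (f : ι → K) {ε : ℝ} (hε : 0 ≤ ε) (hε1 : ε < 1)
    (T : Finset ι) (hT : ∀ i ∈ T, ‖f i‖ ≤ ε) : ‖∏ i ∈ T, (1 + f i) - 1‖ ≤ ε := by
  classical
  induction T using Finset.induction_on with
  | empty => simpa using hε
  | insert i T hi ih =>
    have hP : ‖∏ j ∈ T, (1 + f j)‖ = 1 := by
      rw [norm_prod]
      exact Finset.prod_eq_one fun j hj =>
        norm_one_add_eq_one ((hT j (Finset.mem_insert_of_mem hj)).trans_lt hε1)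
    rw [Finset.prod_insert hi, show (1 + f i) * ∏ j ∈ T, (1 + f j) - 1 =
      (∏ j ∈ T, (1 + f j) - 1) + f i * ∏ j ∈ T, (1 + f j) by ring]
    refine (IsUltrametricDist.norm_add_le_max _ _).trans (max_le ?_ ?_)
    · exact ih fun j hj => hT j (Finset.mem_insert_of_mem hj)
    · rw [norm_mul, hP, mul_one]
      exact hT i (Finset.mem_insert_self i T)

/-- Over a complete ultrametric field, `∏ (1 + f i)` converges as soon as `f` tends to `0` along
the cofinite filter, and the limit vanishes only if some factor does. -/
lemma exists_hasProd_one_add [CompleteSpace K] {ι : Type*} (f : ι → K)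
    (hf : ∀ ε > 0, {i | ε ≤ ‖f i‖}.Finite) :
    ∃ P, HasProd (fun i => 1 + f i) P ∧ ((∀ i, 1 + f i ≠ 0) → P ≠ 0) := by
  classical
  set T₁ := (hf 1 one_pos).toFinset with hT₁
  set C := ‖∏ i ∈ T₁, (1 + f i)‖ with hC
  have hnorm : ∀ T, T₁ ⊆ T → ‖∏ i ∈ T, (1 + f i)‖ = C := by
    intro T hT
    rw [← Finset.prod_sdiff hT, norm_mul, norm_prod, Finset.prod_eq_one, one_mul]
    intro i hi
    refine norm_one_add_eq_one ?_
    simpa [hT₁] using (Finset.mem_sdiff.mp hi).2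
  have hcauchy : CauchySeq fun T : Finset ι => ∏ i ∈ T, (1 + f i) := by
    rw [Metric.cauchySeq_iff']
    intro ε hε
    have hC0 : 0 ≤ C := norm_nonneg _
    obtain ⟨δ, hδ0, hδ1, hδ⟩ : ∃ δ : ℝ, 0 < δ ∧ δ < 1 ∧ C * δ < ε := by
      refine ⟨min (1 / 2) (ε / (2 * (C + 1))), by positivity,
        (min_le_left _ _).trans_lt (by norm_num), ?_⟩
      calc C * min (1 / 2) (ε / (2 * (C + 1))) ≤ C * (ε / (2 * (C + 1))) := by
            gcongr; exact min_le_right _ _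
        _ < ε := by
            rw [mul_div_assoc', div_lt_iff₀ (by positivity)]
            nlinarith
    set T₀ := (hf δ hδ0).toFinset with hT₀
    have hT₁₀ : T₁ ⊆ T₀ := by
      intro i hi
      simp only [hT₁, hT₀, Set.Finite.mem_toFinset, Set.mem_ofPred_eq] at hi ⊢
      exact hδ1.le.trans hi
    refine ⟨T₀, fun T hT => ?_⟩
    rw [dist_eq_norm, ← Finset.prod_sdiff (show T₀ ⊆ T from hT), ← sub_one_mul, norm_mul,
      hnorm T₀ hT₁₀, mul_comm]
    refine lt_of_le_of_lt ?_ hδ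
    refine mul_le_mul_of_nonneg_left ?_ hC0
    refine norm_prod_one_add_sub_one_le f hδ0.le hδ1 _ fun i hi => ?_
    have := (Finset.mem_sdiff.mp hi).2
    simp only [hT₀, Set.Finite.mem_toFinset, Set.mem_ofPred_eq, not_le] at this
    exact this.le
  obtain ⟨P, hP⟩ := cauchySeq_tendsto_of_complete hcauchy
  refine ⟨P, by simpa [HasProd] using hP, fun hne hP0 => ?_⟩
  have h1 : Tendsto (fun T : Finset ι => ‖∏ i ∈ T, (1 + f i)‖) atTop (𝓝 C) :=
    tendsto_const_nhds.congr' ((eventually_ge_atTop T₁).mono fun T hT => (hnorm T hT).symm)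
  have h2 : ‖P‖ = C := tendsto_nhds_unique hP.norm h1
  rw [hP0, norm_zero, hC, eq_comm, norm_eq_zero, Finset.prod_eq_zero_iff] at h2
  obtain ⟨i, -, hi⟩ := h2
  exact hne i hi

end InfiniteProduct

section Representatives

/-- `W` is a set of representatives of the cosets of `Λ` in `M`, with `0` representing `Λ`. -/
structure IsCompleteReps {G : Type*} [AddCommGroup G] (Λ M : AddSubgroup G) (W : Finset G) :
    Prop where
  zero_mem : 0 ∈ W
  mem : ∀ w ∈ W, w ∈ M
  exists_sub_mem : ∀ x ∈ M, ∃ w ∈ W, x - w ∈ Λ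
  eq_of_sub_mem : ∀ w ∈ W, ∀ w' ∈ W, w - w' ∈ Λ → w = w'

variable {K : Type*} [Field K]

/-- The subgroup `a⁻¹ Λ`. -/
def invMul {G : Type*} [AddCommGroup G] [Module K G] (a : K) (Λ : AddSubgroup G) : AddSubgroup G :=
  Λ.comap (DistribSMul.toAddMonoidHom G a)

lemma mem_invMul {G : Type*} [AddCommGroup G] [Module K G] (a : K) (Λ : AddSubgroup G) (x : G) :
    x ∈ invMul a Λ ↔ a • x ∈ Λ := Iff.rfl

lemma exists_rep_of_mul {Λ : AddSubgroup K} {a b : K} (hb : b ≠ 0) {Wa Wb : Finset K}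
    (hWa : IsCompleteReps Λ (invMul a Λ) Wa) (hWb : IsCompleteReps Λ (invMul b Λ) Wb)
    {x : K} (hx : a * (b * x) ∈ Λ) : ∃ w ∈ Wa, ∃ u ∈ Wb, x - (w / b + u) ∈ Λ := by
  obtain ⟨w, hw, hwΛ⟩ := hWa.exists_sub_mem (b * x) hx
  obtain ⟨u, hu, huΛ⟩ := hWb.exists_sub_mem (x - w / b) (by
    rw [mem_invMul, smul_eq_mul, mul_sub, mul_div_cancel₀ _ hb]
    exact hwΛ)
  exact ⟨w, hw, u, hu, by rwa [← sub_sub]⟩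

lemma eq_of_rep_of_mul {Λ : AddSubgroup K} {a b : K} (hb : b ≠ 0) (hbΛ : ∀ x ∈ Λ, b * x ∈ Λ)
    {Wa Wb : Finset K}
    (hWa : IsCompleteReps Λ (invMul a Λ) Wa) (hWb : IsCompleteReps Λ (invMul b Λ) Wb)
    {w w' u u' : K} (hw : w ∈ Wa) (hw' : w' ∈ Wa) (hu : u ∈ Wb) (hu' : u' ∈ Wb)
    (h : (w / b + u) - (w' / b + u') ∈ Λ) : w = w' ∧ u = u' := by
  have hww : w = w' := by
    refine hWa.eq_of_sub_mem w hw w' hw' ?_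
    rw [show w - w' = b * ((w / b + u) - (w' / b + u')) - (b * u - b * u') by field_simp; ring]
    exact Λ.sub_mem (hbΛ _ h) (Λ.sub_mem (hWb.mem u hu) (hWb.mem u' hu'))
  subst hww
  exact ⟨rfl, hWb.eq_of_sub_mem u hu u' hu' (by simpa using h)⟩

end Representatives

section Exponential

variable {K : Type*} [NormedField K]

/-- The elements of norm at most `n` in a strongly discrete subset. -/
noncomputable def truncation {Λ : Set K} (hΛ : StronglyDiscrete Λ) (n : ℕ) : Finset K :=
  (hΛ (Metric.closedBall 0 n) Metric.isBounded_closedBall).toFinset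

lemma mem_truncation {Λ : Set K} (hΛ : StronglyDiscrete Λ) (n : ℕ) (x : K) :
    x ∈ truncation hΛ n ↔ x ∈ Λ ∧ ‖x‖ ≤ n := by
  simp [truncation]

open Classical in
/-- The polynomial `z * ∏ (1 - z / x)`, the product running over the nonzero `x ∈ S`, where the
factor `z` is present if and only if `0 ∈ S`. -/
noncomputable def expPoly (S : Finset K) (z : K) : K :=
  ∏ x ∈ S, if x = 0 then z else 1 - z / x

open Classical in
/-- The product of `-x` over the nonzero `x ∈ S`. -/
noncomputable def negProd (S : Finset K) : K :=
  ∏ x ∈ S, if x = 0 then 1 else -x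

lemma negProd_ne_zero (S : Finset K) : negProd S ≠ 0 := by
  refine Finset.prod_ne_zero_iff.mpr fun x _ => ?_
  split_ifs with h
  · exact one_ne_zero
  · exact neg_ne_zero.mpr h

lemma expPoly_mul_negProd (S : Finset K) (z : K) :
    expPoly S z * negProd S = ∏ x ∈ S, (z - x) := by
  rw [expPoly, negProd, ← Finset.prod_mul_distrib]
  refine Finset.prod_congr rfl fun x _ => ?_
  split_ifs with h
  · simp [h]
  · field_simp
    ring

lemma finite_le_norm_div {Λ : Set K} (hΛ : StronglyDiscrete Λ) (z : K) (ε : ℝ) (hε : 0 < ε) :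
    {l : {l : K // l ∈ Λ ∧ l ≠ 0} | ε ≤ ‖-(z / (l : K))‖}.Finite := by
  have h := hΛ (Metric.closedBall 0 (‖z‖ / ε)) Metric.isBounded_closedBall
  refine (h.preimage (f := fun l : {l : K // l ∈ Λ ∧ l ≠ 0} => (l : K))
    Subtype.val_injective.injOn).subset ?_
  rintro ⟨l, hl, hl0⟩ h
  have hl' : 0 < ‖l‖ := norm_pos_iff.mpr hl0
  simp only [Set.mem_ofPred_eq, norm_neg, norm_div] at h
  refine ⟨hl, ?_⟩
  rw [le_div_iff₀ hl'] at h
  rw [mem_closedBall_zero_iff, le_div_iff₀ hε]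
  linarith

lemma zero_mem_truncation {Λ : AddSubgroup K} (hΛ : StronglyDiscrete (Λ : Set K)) (n : ℕ) :
    0 ∈ truncation hΛ n := by
  simp [mem_truncation]

lemma sub_mem_truncation [IsUltrametricDist K] {Λ : AddSubgroup K} (hΛ : StronglyDiscrete (Λ : Set K)) {n : ℕ} {x y : K}
    (hx : x ∈ truncation hΛ n) (hy : y ∈ truncation hΛ n) : x - y ∈ truncation hΛ n := by
  rw [mem_truncation] at *
  refine ⟨Λ.sub_mem hx.1 hy.1, ?_⟩
  rw [sub_eq_add_neg]
  exact (IsUltrametricDist.norm_add_le_max _ _).trans (max_le hx.2 (by rw [norm_neg]; exact hy.2))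

variable [IsUltrametricDist K] [CompleteSpace K]

lemma tendsto_expPoly {Λ : Set K} (hΛ : StronglyDiscrete Λ) (h0 : (0 : K) ∈ Λ) (z : K) :
    Tendsto (fun n => expPoly (truncation hΛ n) z) atTop (𝓝 (expF Λ z)) := by
  classical
  obtain ⟨P, hP, -⟩ := exists_hasProd_one_add (fun l : {l : K // l ∈ Λ ∧ l ≠ 0} => -(z / (l : K)))
    (finite_le_norm_div hΛ z)
  simp only [← sub_eq_add_neg] at hP
  rw [expF, hP.tprod_eq]
  rw [HasProd, SummationFilter.unconditional_filter] at hP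
  have hmono : Tendsto
      (fun n => (truncation hΛ n).subtype fun l => l ∈ Λ ∧ l ≠ 0) atTop atTop := by
    refine tendsto_atTop_finset_of_monotone (fun m n hmn x hx => ?_) fun x => ?_
    · simp only [Finset.mem_subtype, mem_truncation] at hx ⊢
      exact ⟨hx.1, hx.2.trans (by exact_mod_cast hmn)⟩
    · obtain ⟨n, hn⟩ := exists_nat_ge ‖(x : K)‖
      exact ⟨n, by simpa [mem_truncation] using ⟨x.2.1, hn⟩⟩
  refine ((hP.comp hmono).const_mul z).congr fun n => ?_
  have hmem : (0 : K) ∈ truncation hΛ n := by simp [mem_truncation, h0]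
  rw [Function.comp_apply, Finset.prod_subtype_eq_prod_filter (f := fun l : K => 1 - z / l),
    expPoly, ← Finset.mul_prod_erase _ _ hmem, if_pos rfl]
  congr 1
  refine Finset.prod_congr ?_ fun x hx => ?_
  · ext x
    simp only [Finset.mem_filter, Finset.mem_erase, mem_truncation]
    tauto
  · rw [if_neg (Finset.ne_of_mem_erase hx)]

lemma expF_ne_zero {Λ : Set K} (hΛ : StronglyDiscrete Λ) (h0 : (0 : K) ∈ Λ) {z : K}
    (hz : z ∉ Λ) : expF Λ z ≠ 0 := by
  obtain ⟨P, hP, hP0⟩ := exists_hasProd_one_add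
    (fun l : {l : K // l ∈ Λ ∧ l ≠ 0} => -(z / (l : K))) (finite_le_norm_div hΛ z)
  have hne := hP0 fun l h => hz <| by
    rw [← sub_eq_add_neg, sub_eq_zero, eq_comm, div_eq_one_iff_eq l.2.2] at h
    exact h ▸ l.2.1
  simp only [← sub_eq_add_neg] at hP
  rw [expF, hP.tprod_eq]
  exact mul_ne_zero (fun h => hz (h ▸ h0)) hne

lemma expF_add {Λ : AddSubgroup K} (hΛ : StronglyDiscrete (Λ : Set K)) {l : K} (hl : l ∈ Λ)
    (z : K) : expF (Λ : Set K) (z + l) = expF (Λ : Set K) z := by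
  refine tendsto_nhds_unique (tendsto_expPoly hΛ Λ.zero_mem _)
    ((tendsto_expPoly hΛ Λ.zero_mem z).congr' ?_)
  obtain ⟨N, hN⟩ := exists_nat_ge ‖l‖
  filter_upwards [eventually_ge_atTop N] with n hn
  have hln : l ∈ truncation hΛ n :=
    (mem_truncation hΛ n l).mpr ⟨hl, hN.trans (by exact_mod_cast hn)⟩
  have hnl : -l ∈ truncation hΛ n := by
    simpa using sub_mem_truncation hΛ (zero_mem_truncation hΛ n) hln
  refine mul_right_cancel₀ (negProd_ne_zero (truncation hΛ n)) ?_
  rw [expPoly_mul_negProd, expPoly_mul_negProd]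
  refine Finset.prod_nbij' (fun x => x + l) (fun x => x - l) ?_ ?_ ?_ ?_ ?_
  · intro x hx
    simpa using sub_mem_truncation hΛ hx hnl
  · intro x hx
    exact sub_mem_truncation hΛ hx hln
  · simp
  · simp
  · intro x _
    ring

omit [CompleteSpace K] in
lemma prod_truncation_eq {Λ M : AddSubgroup K} (hΛ : StronglyDiscrete (Λ : Set K))
    (hM : StronglyDiscrete (M : Set K)) (hΛM : Λ ≤ M) {W : Finset K} (hW : IsCompleteReps Λ M W)
    {n : ℕ} (hn : ∀ w ∈ W, ‖w‖ ≤ n) (f : K → K) :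
    ∏ y ∈ truncation hM n, f y = ∏ w ∈ W, ∏ x ∈ truncation hΛ n, f (x - w) := by
  have hWM : ∀ w ∈ W, w ∈ truncation hM n := fun w hw =>
    (mem_truncation hM n w).mpr ⟨hW.mem w hw, hn w hw⟩
  have hΛM' : ∀ x ∈ truncation hΛ n, x ∈ truncation hM n := fun x hx => by
    rw [mem_truncation] at *
    exact ⟨hΛM hx.1, hx.2⟩
  rw [← Finset.prod_product']
  symm
  refine Finset.prod_bij (fun p _ => p.2 - p.1) ?_ ?_ ?_ fun _ _ => rfl
  · rintro ⟨w, x⟩ h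
    obtain ⟨hw, hx⟩ := Finset.mem_product.mp h
    exact sub_mem_truncation hM (hΛM' x hx) (hWM w hw)
  · rintro ⟨w, x⟩ h ⟨w', x'⟩ h' heq
    obtain ⟨hw, hx⟩ := Finset.mem_product.mp h
    obtain ⟨hw', hx'⟩ := Finset.mem_product.mp h'
    simp only at heq hw hx hw' hx'
    have hww : w = w' := by
      refine hW.eq_of_sub_mem w hw w' hw' ?_
      rw [show w - w' = x - x' by linear_combination -heq]
      exact ((mem_truncation hΛ n _).mp (sub_mem_truncation hΛ hx hx')).1
    subst hww
    simpa using heq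
  · intro y hy
    have hny := sub_mem_truncation hM (zero_mem_truncation hM n) hy
    rw [zero_sub] at hny
    obtain ⟨w, hw, hwΛ⟩ := hW.exists_sub_mem (-y) ((mem_truncation hM n _).mp hny).1
    refine ⟨(w, y + w), Finset.mem_product.mpr ⟨hw, ?_⟩, by simp⟩
    rw [mem_truncation]
    constructor
    · simpa [add_comm] using Λ.neg_mem hwΛ
    · have := sub_mem_truncation hM (hWM w hw) hny
      rw [sub_neg_eq_add, add_comm] at this
      exact ((mem_truncation hM n _).mp this).2

open Classical in
/-- The exponential of an overlattice of finite index, up to normalization. -/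
lemma expF_mul_prod_expF {Λ M : AddSubgroup K} (hΛ : StronglyDiscrete (Λ : Set K))
    (hM : StronglyDiscrete (M : Set K)) (hΛM : Λ ≤ M) {W : Finset K} (hW : IsCompleteReps Λ M W)
    (z : K) :
    expF (M : Set K) z * ∏ w ∈ W.erase 0, expF (Λ : Set K) w =
      ∏ w ∈ W, expF (Λ : Set K) (z + w) := by
  have hlim : ∀ z, Tendsto (fun n => expPoly (truncation hΛ n) z) atTop
    (𝓝 (expF (Λ : Set K) z)) := tendsto_expPoly hΛ Λ.zero_mem
  refine tendsto_nhds_unique ((tendsto_expPoly hM M.zero_mem z).mul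
    (tendsto_finsetProd (W.erase 0) fun w _ => hlim w))
    ((tendsto_finsetProd W fun w _ => hlim (z + w)).congr' ?_)
  obtain ⟨N, hN⟩ : ∃ N : ℕ, ∀ w ∈ W, ‖w‖ ≤ N := by
    obtain ⟨N, hN⟩ := exists_nat_ge (∑ w ∈ W, ‖w‖)
    exact ⟨N, fun w hw =>
      (Finset.single_le_sum (f := fun w => ‖w‖) (fun _ _ => norm_nonneg _) hw).trans hN⟩
  filter_upwards [eventually_ge_atTop N] with n hn
  have hn' : ∀ w ∈ W, ‖w‖ ≤ n := fun w hw => (hN w hw).trans (by exact_mod_cast hn)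
  set S := truncation hΛ n
  set c := negProd S
  have hc : c ≠ 0 := negProd_ne_zero S
  have hM_neg : negProd (truncation hM n) =
      c * ((∏ w ∈ W.erase 0, expPoly S w) * c ^ (W.erase 0).card) := by
    rw [negProd, prod_truncation_eq hΛ hM hΛM hW hn', ← Finset.mul_prod_erase _ _ hW.zero_mem,
      ← Finset.prod_const, ← Finset.prod_mul_distrib]
    congr 1
    · simp [c, negProd, S]
    · refine Finset.prod_congr rfl fun w hw => ?_
      rw [expPoly_mul_negProd]
      refine Finset.prod_congr rfl fun x hx => ?_
      rw [if_neg, neg_sub]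
      intro h
      refine Finset.ne_of_mem_erase hw
        (hW.eq_of_sub_mem w (Finset.mem_of_mem_erase hw) 0 hW.zero_mem ?_)
      rw [sub_zero, ← sub_eq_zero.mp h]
      exact ((mem_truncation hΛ n x).mp hx).1
  have hM_prod : expPoly (truncation hM n) z * negProd (truncation hM n) =
      (∏ w ∈ W, expPoly S (z + w)) * c ^ W.card := by
    rw [expPoly_mul_negProd, prod_truncation_eq hΛ hM hΛM hW hn', ← Finset.prod_const,
      ← Finset.prod_mul_distrib]
    refine Finset.prod_congr rfl fun w _ => ?_
    rw [expPoly_mul_negProd]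
    exact Finset.prod_congr rfl fun x _ => by ring
  rw [← Finset.card_erase_add_one hW.zero_mem, hM_neg] at hM_prod
  refine mul_right_cancel₀ (pow_ne_zero ((W.erase 0).card + 1) hc) ?_
  rw [← hM_prod]
  ring

end Exponential

section Scaling

variable {K : Type*} [NormedField K]

lemma expF_smul {Λ M : Set K} {b : K} (hb : b ≠ 0) (hM : ∀ x, x ∈ M ↔ b * x ∈ Λ) (z : K) :
    expF Λ (b * z) = b * expF M z := by
  rw [expF, expF, mul_assoc]
  congr 2
  let e : {l : K // l ∈ M ∧ l ≠ 0} ≃ {l : K // l ∈ Λ ∧ l ≠ 0} :=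
    (Equiv.mulLeft₀ b hb).subtypeEquiv fun x => by simp [hM, hb]
  rw [← e.tprod_eq]
  refine tprod_congr fun l => ?_
  have : ((e l : {l : K // l ∈ Λ ∧ l ≠ 0}) : K) = b * l := rfl
  rw [this, mul_div_mul_left _ _ hb]

lemma stronglyDiscrete_of_mul_mem {Λ M : Set K} {b : K} (hb : b ≠ 0) (hΛ : StronglyDiscrete Λ)
    (hM : ∀ x ∈ M, b * x ∈ Λ) : StronglyDiscrete M := by
  intro B hB
  obtain ⟨R, hR⟩ := hB.exists_norm_le
  refine ((hΛ (Metric.closedBall 0 (‖b‖ * R)) Metric.isBounded_closedBall).preimage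
    (mul_right_injective₀ hb).injOn).subset ?_
  rintro x ⟨hx, hxB⟩
  refine ⟨hM x hx, ?_⟩
  rw [mem_closedBall_zero_iff, norm_mul]
  exact mul_le_mul_of_nonneg_left (hR x hxB) (norm_nonneg b)

end Scaling

section Discriminant

variable {K : Type*} [NontriviallyNormedField K] [IsUltrametricDist K] [CompleteSpace K]

open Classical in
/-- The discriminant value attached to a set of representatives containing `0`. -/
noncomputable def disc (Λ : Set K) (a : K) (W : Finset K) : K :=
  a * ∏ w ∈ W.erase 0, (expF Λ w)⁻¹

lemma prod_expF_ne_zero {Λ : AddSubgroup K} (hΛ : StronglyDiscrete (Λ : Set K)) {a : K}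
    {W : Finset K} (hW : IsCompleteReps Λ (invMul a Λ) W) [DecidableEq K] :
    ∏ w ∈ W.erase 0, expF (Λ : Set K) w ≠ 0 := by
  refine Finset.prod_ne_zero_iff.mpr fun w hw => expF_ne_zero hΛ Λ.zero_mem fun h => ?_
  exact Finset.ne_of_mem_erase hw (hW.eq_of_sub_mem w (Finset.mem_of_mem_erase hw) 0 hW.zero_mem
    (by simpa using h))

lemma disc_ne_zero {Λ : AddSubgroup K} (hΛ : StronglyDiscrete (Λ : Set K)) {a : K} (ha : a ≠ 0)
    {W : Finset K} (hW : IsCompleteReps Λ (invMul a Λ) W) : disc (Λ : Set K) a W ≠ 0 := by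
  classical
  rw [disc, Finset.prod_inv_distrib]
  exact mul_ne_zero ha (inv_ne_zero (prod_expF_ne_zero hΛ hW))

/-- The functional equation `e_Λ(az) = φ_a(e_Λ(z))`, in product form. -/
lemma expF_mul_eq {Λ : AddSubgroup K} (hΛ : StronglyDiscrete (Λ : Set K)) {a : K} (ha : a ≠ 0)
    (haΛ : ∀ x ∈ Λ, a * x ∈ Λ) {W : Finset K} (hW : IsCompleteReps Λ (invMul a Λ) W) (z : K) :
    expF (Λ : Set K) (a * z) = disc (Λ : Set K) a W * ∏ w ∈ W, expF (Λ : Set K) (z + w) := by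
  classical
  have hP := prod_expF_ne_zero hΛ hW
  rw [expF_smul (Λ := (Λ : Set K)) (M := (invMul a Λ : Set K)) ha fun x => Iff.rfl,
    ← expF_mul_prod_expF hΛ (stronglyDiscrete_of_mul_mem ha hΛ fun x hx => hx) haΛ hW, disc,
    Finset.prod_inv_distrib]
  field_simp

omit [IsUltrametricDist K] [CompleteSpace K] in
lemma exists_mul_notMem {Λ : AddSubgroup K} (hΛ : StronglyDiscrete (Λ : Set K)) {c : K}
    (hc : c ≠ 0) : ∃ z, c * z ∉ Λ := by
  by_contra! h
  have hfin := stronglyDiscrete_of_mul_mem (M := Set.univ) hc hΛ (fun x _ => h x) (Metric.closedBall 0 1)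
    Metric.isBounded_closedBall
  rw [Set.univ_inter] at hfin
  exact infinite_of_mem_nhds (0 : K) (Metric.closedBall_mem_nhds 0 one_pos) hfin

lemma expF_mul_mul_eq {Λ : AddSubgroup K} (hΛ : StronglyDiscrete (Λ : Set K)) {a b : K}
    (ha : a ≠ 0) (hb : b ≠ 0) (haΛ : ∀ x ∈ Λ, a * x ∈ Λ) (hbΛ : ∀ x ∈ Λ, b * x ∈ Λ)
    {Wa Wb : Finset K} (hWa : IsCompleteReps Λ (invMul a Λ) Wa)
    (hWb : IsCompleteReps Λ (invMul b Λ) Wb) (z : K) :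
    expF (Λ : Set K) (a * (b * z)) = disc (Λ : Set K) a Wa * disc (Λ : Set K) b Wb ^ Wa.card *
      ∏ p ∈ Wa ×ˢ Wb, expF (Λ : Set K) (z + (p.1 / b + p.2)) := by
  rw [expF_mul_eq hΛ ha haΛ hWa, Finset.prod_product, mul_assoc, ← Finset.prod_const,
    ← Finset.prod_mul_distrib]
  congr 1
  refine Finset.prod_congr rfl fun w _ => ?_
  rw [show b * z + w = b * (z + w / b) by field_simp, expF_mul_eq hΛ hb hbΛ hWb]
  simp only [add_assoc]

lemma prod_expF_symm {Λ : AddSubgroup K} (hΛ : StronglyDiscrete (Λ : Set K)) {a b : K}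
    (ha : a ≠ 0) (hb : b ≠ 0) (haΛ : ∀ x ∈ Λ, a * x ∈ Λ) (hbΛ : ∀ x ∈ Λ, b * x ∈ Λ)
    {Wa Wb : Finset K} (hWa : IsCompleteReps Λ (invMul a Λ) Wa)
    (hWb : IsCompleteReps Λ (invMul b Λ) Wb) (z : K) :
    ∏ p ∈ Wa ×ˢ Wb, expF (Λ : Set K) (z + (p.1 / b + p.2)) =
      ∏ p ∈ Wb ×ˢ Wa, expF (Λ : Set K) (z + (p.1 / a + p.2)) := by
  have hmem : ∀ {a b : K}, b ≠ 0 → (∀ x ∈ Λ, a * x ∈ Λ) → ∀ {Wa Wb : Finset K},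
      IsCompleteReps Λ (invMul a Λ) Wa → IsCompleteReps Λ (invMul b Λ) Wb →
      ∀ p ∈ Wa ×ˢ Wb, b * (a * (p.1 / b + p.2)) ∈ Λ := by
    intro a b hb haΛ Wa Wb hWa hWb p hp
    obtain ⟨h1, h2⟩ := Finset.mem_product.mp hp
    rw [show b * (a * (p.1 / b + p.2)) = a * p.1 + a * (b * p.2) by field_simp]
    exact Λ.add_mem (hWa.mem _ h1) (haΛ _ (hWb.mem _ h2))
  have hex : ∀ p ∈ Wa ×ˢ Wb, ∃ p' ∈ Wb ×ˢ Wa,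
      (p.1 / b + p.2) - (p'.1 / a + p'.2) ∈ Λ := by
    intro p hp
    obtain ⟨u, hu, w, hw, h⟩ := exists_rep_of_mul ha hWb hWa (hmem hb haΛ hWa hWb p hp)
    exact ⟨(u, w), Finset.mem_product.mpr ⟨hu, hw⟩, h⟩
  choose! i hi hiΛ using hex
  refine Finset.prod_bij (fun p _ => i p) hi ?_ ?_ ?_
  · intro p hp p' hp' h
    have h1 := Λ.sub_mem (hiΛ p hp) (hiΛ p' hp')
    rw [h, sub_sub_sub_cancel_right] at h1
    rw [Finset.mem_product] at hp hp'
    obtain ⟨h2, h3⟩ := eq_of_rep_of_mul hb hbΛ hWa hWb hp.1 hp'.1 hp.2 hp'.2 h1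
    exact Prod.ext h2 h3
  · intro p' hp'
    obtain ⟨w, hw, u, hu, h⟩ := exists_rep_of_mul hb hWa hWb (hmem ha hbΛ hWb hWa p' hp')
    have hp : (w, u) ∈ Wa ×ˢ Wb := Finset.mem_product.mpr ⟨hw, hu⟩
    refine ⟨(w, u), hp, ?_⟩
    have h1 := Λ.neg_mem (Λ.add_mem h (hiΛ _ hp))
    have h2 := hi _ hp
    rw [sub_add_sub_cancel, neg_sub] at h1
    rw [Finset.mem_product] at hp' h2
    obtain ⟨h3, h4⟩ := eq_of_rep_of_mul ha haΛ hWb hWa h2.1 hp'.1 h2.2 hp'.2 h1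
    exact Prod.ext h3 h4
  · intro p hp
    rw [← expF_add hΛ (hiΛ p hp) (z + ((i p).1 / a + (i p).2))]
    congr 1
    ring

theorem disc_pow_eq {Λ : AddSubgroup K} (hΛ : StronglyDiscrete (Λ : Set K)) {a b : K}
    (ha : a ≠ 0) (hb : b ≠ 0) (haΛ : ∀ x ∈ Λ, a * x ∈ Λ) (hbΛ : ∀ x ∈ Λ, b * x ∈ Λ)
    {Wa Wb : Finset K} (hWa : IsCompleteReps Λ (invMul a Λ) Wa)
    (hWb : IsCompleteReps Λ (invMul b Λ) Wb) :
    disc (Λ : Set K) a Wa ^ (Wb.card - 1) = disc (Λ : Set K) b Wb ^ (Wa.card - 1) := by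
  obtain ⟨z, hz⟩ := exists_mul_notMem hΛ (mul_ne_zero ha hb)
  rw [mul_assoc] at hz
  have hne := expF_ne_zero hΛ Λ.zero_mem hz
  have h1 := expF_mul_mul_eq hΛ ha hb haΛ hbΛ hWa hWb z
  have h2 := expF_mul_mul_eq hΛ hb ha hbΛ haΛ hWb hWa z
  rw [← prod_expF_symm hΛ ha hb haΛ hbΛ hWa hWb, mul_left_comm, h1] at h2
  rw [h1] at hne
  have h3 := mul_right_cancel₀ (right_ne_zero_of_mul hne) h2
  obtain ⟨m, hm⟩ := Nat.exists_eq_add_one_of_ne_zero (Finset.card_ne_zero_of_mem hWa.zero_mem)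
  obtain ⟨n, hn⟩ := Nat.exists_eq_add_one_of_ne_zero (Finset.card_ne_zero_of_mem hWb.zero_mem)
  rw [hm, hn] at h3 ⊢
  simp only [Nat.add_sub_cancel]
  refine mul_left_cancel₀ (mul_ne_zero (disc_ne_zero hΛ ha hWa) (disc_ne_zero hΛ hb hWb)) ?_
  linear_combination -h3

end Discriminant

section LatticeIndex

variable {K : Type*} [Field K] {V : Type*} [AddCommGroup V] [Module K V]

lemma invMul_mono (a : K) {H J : AddSubgroup V} (h : H ≤ J) : invMul a H ≤ invMul a J :=
  AddSubgroup.comap_mono h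

lemma invMul_mul (a b : K) (H : AddSubgroup V) : invMul (a * b) H = invMul b (invMul a H) := by
  ext x
  simp only [mem_invMul, mul_smul]

lemma relIndex_invMul {c : K} (hc : c ≠ 0) (H J : AddSubgroup V) :
    (invMul c H).relIndex (invMul c J) = H.relIndex J := by
  rw [invMul, AddSubgroup.relIndex_comap, invMul, AddSubgroup.map_comap_eq_self_of_surjective]
  intro x
  exact ⟨c⁻¹ • x, by simp [smul_smul, hc]⟩

/-- The index `[a⁻¹H : H]` only depends on the commensurability class of `H`. -/
lemma relIndex_invMul_eq {H M : AddSubgroup V} {a e : K} (ha : a ≠ 0) (he : e ≠ 0)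
    (hHM : H ≤ M) (hMH : M ≤ invMul e H) (hH : H ≤ invMul a H) (hM : M ≤ invMul a M)
    (hfin : M.relIndex (invMul e M) ≠ 0) :
    H.relIndex (invMul a H) = M.relIndex (invMul a M) := by
  have h1 := AddSubgroup.relIndex_mul_relIndex _ _ _ hMH (invMul_mono e hHM)
  rw [relIndex_invMul he] at h1
  have hne : H.relIndex M ≠ 0 := fun h => hfin (by rw [← h1, h, mul_zero])
  have h2 := AddSubgroup.relIndex_mul_relIndex _ _ _ hHM hM
  have h3 := AddSubgroup.relIndex_mul_relIndex _ _ _ hH (invMul_mono a hHM)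
  rw [relIndex_invMul ha, ← h2, mul_comm] at h3
  exact Nat.eq_of_mul_eq_mul_left (Nat.pos_of_ne_zero hne) h3

variable {A : Subring K} {r : ℕ}

variable (A r) in
/-- The standard lattice `A^r` in `K^r`. -/
def stdLattice : AddSubgroup (Fin r → K) :=
  AddSubgroup.pi Set.univ fun _ => A.toAddSubgroup

lemma mem_stdLattice {x : Fin r → K} : x ∈ stdLattice A r ↔ ∀ i, x i ∈ A := by
  simp [stdLattice, AddSubgroup.mem_pi]

lemma stdLattice_le_invMul (a : A) : stdLattice A r ≤ invMul (a : K) (stdLattice A r) := by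
  intro x hx
  rw [mem_stdLattice] at hx
  rw [mem_invMul, mem_stdLattice]
  exact fun i => A.mul_mem a.2 (hx i)

lemma relIndex_stdLattice {a : A} (ha : a ≠ 0) :
    (stdLattice A r).relIndex (invMul (a : K) (stdLattice A r)) =
      Nat.card (A ⧸ Ideal.span {a}) ^ r := by
  have ha' : (a : K) ≠ 0 := by simpa using ha
  let φ : (Fin r → A) →+ (Fin r → K) :=
    { toFun := fun x i => x i
      map_zero' := rfl
      map_add' := fun _ _ => rfl }
  have hφ : Function.Injective φ := fun x y h => funext fun i => Subtype.ext (congrFun h i)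
  let I : AddSubgroup (Fin r → A) :=
    AddSubgroup.pi Set.univ fun _ => (Ideal.span {a}).toAddSubgroup
  have htop : AddSubgroup.map φ ⊤ = stdLattice A r := by
    ext x
    rw [mem_stdLattice]
    constructor
    · rintro ⟨y, -, rfl⟩ i
      exact (y i).2
    · intro h
      exact ⟨fun i => ⟨x i, h i⟩, trivial, rfl⟩
  have hI : invMul (a : K) (AddSubgroup.map φ I) = stdLattice A r := by
    ext x
    rw [mem_stdLattice, mem_invMul]
    constructor
    · rintro ⟨y, hy, hyx⟩ i
      obtain ⟨s, hs⟩ := Ideal.mem_span_singleton'.mp (hy i trivial)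
      have h1 : (y i : K) = a * x i := congrFun hyx i
      rw [← hs, Subring.coe_mul, mul_comm] at h1
      rw [← mul_left_cancel₀ ha' h1]
      exact s.2
    · intro h
      refine ⟨fun i => a * ⟨x i, h i⟩, fun i _ => ?_, rfl⟩
      exact Ideal.mul_mem_right _ _ (Ideal.mem_span_singleton_self a)
  nth_rw 1 [← hI]
  rw [relIndex_invMul ha', ← htop, AddSubgroup.relIndex_map_map_of_injective _ _ hφ,
    AddSubgroup.relIndex_top_right, AddSubgroup.index_pi, Finset.prod_const, Finset.card_univ,
    Fintype.card_fin]
  rfl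

lemma exists_common_denominator {F : Subfield K}
    (hFrac : ∀ z ∈ F, ∃ a ∈ A, ∃ b ∈ A, b ≠ 0 ∧ z * b = a) (s : Finset K)
    (hs : ∀ x ∈ s, x ∈ F) : ∃ c ∈ A, c ≠ 0 ∧ ∀ x ∈ s, c * x ∈ A := by
  classical
  induction s using Finset.induction_on with
  | empty => exact ⟨1, A.one_mem, one_ne_zero, by simp⟩
  | insert x s _ ih =>
    obtain ⟨c, hc, hc0, h⟩ := ih fun y hy => hs y (Finset.mem_insert_of_mem hy)
    obtain ⟨y, hy, b, hb, hb0, hxb⟩ := hFrac x (hs x (Finset.mem_insert_self x s))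
    refine ⟨b * c, A.mul_mem hb hc, mul_ne_zero hb0 hc0, fun z hz => ?_⟩
    rcases Finset.mem_insert.mp hz with rfl | hz
    · rw [show b * c * z = c * (z * b) by ring, hxb]
      exact A.mul_mem hc hy
    · rw [mul_assoc]
      exact A.mul_mem hb (h z hz)

/-- A finitely generated `A`-submodule of `F^r` is contained in `c⁻¹A^r` for some `c ≠ 0`. -/
lemma exists_le_invMul_stdLattice {F : Subfield K}
    (hFrac : ∀ z ∈ F, ∃ a ∈ A, ∃ b ∈ A, b ≠ 0 ∧ z * b = a) {L : AddSubgroup (Fin r → K)}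
    (hLF : ∀ x ∈ L, ∀ i, x i ∈ F)
    (hLfg : ∃ T : Finset (Fin r → K), (T : Set (Fin r → K)) ⊆ L ∧
      ∀ x ∈ L, x ∈ AddSubgroup.closure
        {y | ∃ a ∈ (A : Set K), ∃ t ∈ (T : Set (Fin r → K)), y = a • t}) :
    ∃ c : A, c ≠ 0 ∧ L ≤ invMul (c : K) (stdLattice A r) := by
  classical
  obtain ⟨T, hTL, hT⟩ := hLfg
  obtain ⟨c, hc, hc0, h⟩ := exists_common_denominator hFrac
    (T.biUnion fun t => Finset.univ.image t) (by
      intro x hx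
      simp only [Finset.mem_biUnion, Finset.mem_image, Finset.mem_univ, true_and] at hx
      obtain ⟨t, ht, i, rfl⟩ := hx
      exact hLF t (hTL ht) i)
  refine ⟨⟨c, hc⟩, by simpa [Subtype.ext_iff] using hc0, fun x hx => ?_⟩
  refine (AddSubgroup.closure_le _).mpr ?_ (hT x hx)
  rintro y ⟨a, ha, t, ht, rfl⟩
  rw [SetLike.mem_coe, mem_invMul, mem_stdLattice]
  intro i
  rw [Pi.smul_apply, Pi.smul_apply, smul_eq_mul, smul_eq_mul, mul_left_comm]
  refine A.mul_mem ha (h _ ?_)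
  simp only [Finset.mem_biUnion, Finset.mem_image, Finset.mem_univ, true_and]
  exact ⟨t, ht, i, rfl⟩

/-- An `A`-submodule spanning `F^r` contains `dA^r` for some `d ≠ 0`. -/
lemma exists_stdLattice_le_invMul {F : Subfield K}
    (hFrac : ∀ z ∈ F, ∃ a ∈ A, ∃ b ∈ A, b ≠ 0 ∧ z * b = a) {L : AddSubgroup (Fin r → K)}
    (hLA : ∀ a ∈ A, ∀ x ∈ L, a • x ∈ L)
    (hLspan : ∀ y : Fin r → K, (∀ i, y i ∈ F) →
      y ∈ AddSubgroup.closure {z | ∃ c ∈ (F : Set K), ∃ x ∈ L, z = c • x}) :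
    ∃ d : A, d ≠ 0 ∧ stdLattice A r ≤ invMul (d : K) L := by
  classical
  have key : ∀ y : Fin r → K, (∀ i, y i ∈ F) → ∃ d ∈ A, d ≠ 0 ∧ d • y ∈ L := by
    intro y hy
    replace hy := hLspan y hy
    induction hy using AddSubgroup.closure_induction with
    | mem z hz =>
      obtain ⟨c, hc, x, hx, rfl⟩ := hz
      obtain ⟨e, he, b, hb, hb0, hcb⟩ := hFrac c hc
      refine ⟨b, hb, hb0, ?_⟩
      rw [smul_smul, mul_comm, hcb]
      exact hLA e he x hx
    | zero => exact ⟨1, A.one_mem, one_ne_zero, by simp⟩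
    | add x y _ _ hx hy =>
      obtain ⟨d, hd, hd0, hdx⟩ := hx
      obtain ⟨e, he, he0, hey⟩ := hy
      refine ⟨d * e, A.mul_mem hd he, mul_ne_zero hd0 he0, ?_⟩
      rw [smul_add, mul_smul d e y, mul_comm d e, mul_smul]
      exact L.add_mem (hLA e he _ hdx) (hLA d hd _ hey)
    | neg x _ hx =>
      obtain ⟨d, hd, hd0, hdx⟩ := hx
      exact ⟨d, hd, hd0, by rw [smul_neg]; exact L.neg_mem hdx⟩
  have hbasis : ∀ i : Fin r, ∃ d ∈ A, d ≠ 0 ∧ d • (Pi.single i (1 : K) : Fin r → K) ∈ L := by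
    refine fun i => key _ fun j => ?_
    rw [Pi.single_apply]
    split_ifs
    exacts [F.one_mem, F.zero_mem]
  choose d hd hd0 hdL using hbasis
  refine ⟨∏ i, ⟨d i, hd i⟩, ?_, fun x hx => ?_⟩
  · refine Finset.prod_ne_zero_iff.mpr fun i _ => ?_
    simpa [Subtype.ext_iff] using hd0 i
  · rw [mem_stdLattice] at hx
    have hx' : x = ∑ i, x i • (Pi.single i (1 : K) : Fin r → K) := by
      ext j
      simp [Finset.sum_apply, Pi.single_apply]
    rw [mem_invMul, hx', Finset.smul_sum]
    refine L.sum_mem fun i _ => ?_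
    rw [SubmonoidClass.coe_finsetProd, ← Finset.prod_erase_mul _ _ (Finset.mem_univ i), smul_smul,
      show ∀ P : K, P * d i * x i = P * x i * d i from fun P => by ring, mul_smul]
    exact hLA _ (A.mul_mem (A.prod_mem fun j _ => hd j) (hx i)) _ (hdL i)

theorem relIndex_lattice {F : Subfield K}
    (hFrac : ∀ z ∈ F, ∃ a ∈ A, ∃ b ∈ A, b ≠ 0 ∧ z * b = a)
    (hquot : ∀ I : Ideal A, I ≠ ⊥ → Finite (A ⧸ I)) {L : AddSubgroup (Fin r → K)}
    (hLF : ∀ x ∈ L, ∀ i, x i ∈ F) (hLA : ∀ a ∈ A, ∀ x ∈ L, a • x ∈ L)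
    (hLfg : ∃ T : Finset (Fin r → K), (T : Set (Fin r → K)) ⊆ L ∧
      ∀ x ∈ L, x ∈ AddSubgroup.closure
        {y | ∃ a ∈ (A : Set K), ∃ t ∈ (T : Set (Fin r → K)), y = a • t})
    (hLspan : ∀ y : Fin r → K, (∀ i, y i ∈ F) →
      y ∈ AddSubgroup.closure {z | ∃ c ∈ (F : Set K), ∃ x ∈ L, z = c • x})
    {a : A} (ha : a ≠ 0) :
    L.relIndex (invMul (a : K) L) = Nat.card (A ⧸ Ideal.span {a}) ^ r := by
  obtain ⟨c, hc, hLc⟩ := exists_le_invMul_stdLattice hFrac hLF hLfg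
  obtain ⟨d, hd, hLd⟩ := exists_stdLattice_le_invMul hFrac hLA hLspan
  have hc' : (c : K) ≠ 0 := by simpa using hc
  have ha' : (a : K) ≠ 0 := by simpa using ha
  have hindex : ∀ e : A, e ≠ 0 →
      (invMul (c : K) (stdLattice A r)).relIndex
        (invMul (e : K) (invMul (c : K) (stdLattice A r))) =
        Nat.card (A ⧸ Ideal.span {e}) ^ r := by
    intro e he
    rw [← invMul_mul, mul_comm, invMul_mul, relIndex_invMul hc', relIndex_stdLattice he]
  rw [← hindex a ha]
  refine relIndex_invMul_eq (e := ((d * c : A) : K)) ha' (by simp [hd, hc]) hLc ?_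
    (fun x hx => hLA a a.2 x hx) ?_ ?_
  · rw [Subring.coe_mul, invMul_mul]
    exact invMul_mono _ hLd
  · rw [← invMul_mul, mul_comm, invMul_mul]
    exact invMul_mono _ (stdLattice_le_invMul a)
  · rw [hindex _ (mul_ne_zero hd hc)]
    have := hquot (Ideal.span {d * c}) (by
      rw [Ne, Ideal.span_singleton_eq_bot]
      exact mul_ne_zero hd hc)
    exact pow_ne_zero _ Nat.card_pos.ne'

end LatticeIndex

section Reps

lemma IsCompleteReps.card_eq {G : Type*} [AddCommGroup G] {Λ M : AddSubgroup G} {W : Finset G}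
    (hW : IsCompleteReps Λ M W) : W.card = Λ.relIndex M := by
  rw [AddSubgroup.relIndex, AddSubgroup.index, ← Fintype.card_coe, ← Nat.card_eq_fintype_card]
  refine Nat.card_eq_of_bijective
    (fun w => QuotientAddGroup.mk (s := Λ.addSubgroupOf M) ⟨w, hW.mem w w.2⟩) ⟨?_, ?_⟩
  · intro w w' h
    rw [QuotientAddGroup.eq, AddSubgroup.mem_addSubgroupOf] at h
    refine Subtype.ext (hW.eq_of_sub_mem w' w'.2 w w.2 ?_).symm
    rw [sub_eq_neg_add]
    exact h
  · intro x
    obtain ⟨x, rfl⟩ := QuotientAddGroup.mk_surjective x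
    obtain ⟨w, hw, h⟩ := hW.exists_sub_mem x x.2
    refine ⟨⟨w, hw⟩, ?_⟩
    rw [QuotientAddGroup.eq, AddSubgroup.mem_addSubgroupOf]
    rw [sub_eq_neg_add] at h
    exact h

variable {K : Type*} [Field K] {r : ℕ}

lemma isCompleteReps_insert {L : AddSubgroup (Fin r → K)} {a : K} {R : Finset (Fin r → K)}
    [DecidableEq (Fin r → K)] (hR : IsRepSet (L : Set (Fin r → K)) (invSc a L) R) :
    IsCompleteReps L (invMul a L) (insert 0 R) where
  zero_mem := Finset.mem_insert_self 0 R
  mem w hw := by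
    rcases Finset.mem_insert.mp hw with rfl | hw
    · exact AddSubgroup.zero_mem _
    · exact (hR.1 hw).1
  exists_sub_mem x hx := by
    by_cases hxL : x ∈ L
    · exact ⟨0, Finset.mem_insert_self 0 R, by simpa using hxL⟩
    · obtain ⟨y, ⟨hy, hyL⟩, -⟩ := hR.2 x hx hxL
      exact ⟨y, Finset.mem_insert_of_mem hy, hyL⟩
  eq_of_sub_mem w hw w' hw' h := by
    rcases Finset.mem_insert.mp hw with rfl | hw <;> rcases Finset.mem_insert.mp hw' with rfl | hw'
    · rfl
    · rw [zero_sub, L.neg_mem_iff] at h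
      exact ((hR.1 hw').2 h).elim
    · rw [sub_zero] at h
      exact ((hR.1 hw).2 h).elim
    · exact (hR.2 w (hR.1 hw).1 (hR.1 hw).2).unique ⟨hw, by simp⟩ ⟨hw', h⟩

end Reps

section Pairing

/-- The pairing with `ω`, as a linear form. -/
noncomputable def pairing {K : Type*} [Field K] {r : ℕ} (ω : Fin r → K) : (Fin r → K) →ₗ[K] K where
  toFun x := rvPair x ω
  map_add' x y := by simp [rvPair, add_mul, Finset.sum_add_distrib]
  map_smul' c x := by simp [rvPair, mul_assoc, Finset.mul_sum]

lemma IsCompleteReps.image {K V : Type*} [Field K] [DecidableEq K] [AddCommGroup V] [Module K V]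
    (p : V →ₗ[K] K) {U L : AddSubgroup V} {a : K} (ha : a ≠ 0) (hp : ∀ x ∈ U, p x = 0 → x = 0)
    (hLU : L ≤ U) (haU : invMul a L ≤ U) {W : Finset V} (hW : IsCompleteReps L (invMul a L) W) :
    IsCompleteReps (L.map p.toAddMonoidHom) (invMul a (L.map p.toAddMonoidHom)) (W.image p) where
  zero_mem := Finset.mem_image.mpr ⟨0, hW.zero_mem, map_zero p⟩
  mem := by
    intro y hy
    obtain ⟨w, hw, rfl⟩ := Finset.mem_image.mp hy
    exact ⟨a • w, hW.mem w hw, map_smul p a w⟩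
  exists_sub_mem := by
    rintro y ⟨l, hl, hly⟩
    have hl' : a⁻¹ • l ∈ invMul a L := by
      rw [mem_invMul, smul_inv_smul₀ ha]
      exact hl
    obtain ⟨w, hw, h⟩ := hW.exists_sub_mem _ hl'
    refine ⟨p w, Finset.mem_image_of_mem p hw, _, h, ?_⟩
    have hly' : p l = a • y := hly
    rw [LinearMap.toAddMonoidHom_coe, map_sub, map_smul, hly', inv_smul_smul₀ ha]
  eq_of_sub_mem := by
    intro y hy y' hy' h
    obtain ⟨w, hw, rfl⟩ := Finset.mem_image.mp hy
    obtain ⟨w', hw', rfl⟩ := Finset.mem_image.mp hy'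
    obtain ⟨l, hl, hlw⟩ := h
    have hlw' : p l = p w - p w' := hlw
    have h0 : l - (w - w') = 0 := by
      refine hp _ (U.sub_mem (hLU hl) (U.sub_mem (haU (hW.mem w hw)) (haU (hW.mem w' hw')))) ?_
      rw [map_sub, map_sub, hlw', sub_self]
    rw [hW.eq_of_sub_mem w hw w' hw' (by rwa [← sub_eq_zero.mp h0])]

/-- If the entries of `ω` are linearly independent over a closed subfield `E`, then `x ↦ xω` maps
strongly discrete subsets of `E^r` to strongly discrete subsets. -/
lemma stronglyDiscrete_image_rvPair {K : Type*} [NontriviallyNormedField K] [CompleteSpace K]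
    {E : Subfield K} (hE : IsClosed (E : Set K)) {r : ℕ} {L : Set (Fin r → K)}
    (hLE : ∀ x ∈ L, ∀ i, x i ∈ E) (hL : StronglyDiscrete L) {ω : Fin r → K}
    (hω : ∀ x : Fin r → K, (∀ i, x i ∈ E) → rvPair x ω = 0 → x = 0) :
    StronglyDiscrete ((fun x => rvPair x ω) '' L) := by
  by_cases htriv : ∀ x ∈ E, ‖x‖ ≤ 1
  · have hfin : L.Finite := (hL (Metric.closedBall 0 1) Metric.isBounded_closedBall).subset
      fun x hx => ⟨hx, mem_closedBall_zero_iff.mpr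
        ((pi_norm_le_iff_of_nonneg zero_le_one).mpr fun i => htriv _ (hLE x hx i))⟩
    exact fun B _ => (hfin.image _).subset Set.inter_subset_left
  push Not at htriv
  obtain ⟨t, htE, ht⟩ := htriv
  let _ : NontriviallyNormedField E :=
    { SubfieldClass.toNormedField E with non_trivial := ⟨⟨t, htE⟩, ht⟩ }
  have : CompleteSpace E := hE.completeSpace_coe
  let _ : NormedSpace E K := { norm_smul_le := fun c x => (norm_mul (c : K) x).le }
  let f : (Fin r → E) →ₗ[E] K :=
    { toFun := fun x => rvPair (fun i => (x i : K)) ω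
      map_add' := fun x y => by simp [rvPair, add_mul, Finset.sum_add_distrib]
      map_smul' := fun c x => by
        simp [rvPair, mul_assoc, Finset.mul_sum, Subfield.smul_def] }
  have hf : LinearMap.ker f = ⊥ := by
    rw [LinearMap.ker_eq_bot']
    intro x hx
    have := hω (fun i => (x i : K)) (fun i => (x i).2) hx
    exact funext fun i => Subtype.ext (congrFun this i)
  obtain ⟨C, -, hC⟩ := f.exists_antilipschitzWith hf
  intro B hB
  obtain ⟨R, hR⟩ := hB.exists_norm_le
  refine ((hL (Metric.closedBall 0 (C * max R 0)) Metric.isBounded_closedBall).image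
    fun x => rvPair x ω).subset ?_
  rintro _ ⟨⟨x, hx, rfl⟩, hxB⟩
  refine ⟨x, ⟨hx, ?_⟩, rfl⟩
  have h1 := hC.le_mul_dist (fun i => ⟨x i, hLE x hx i⟩) 0
  rw [map_zero, dist_zero_right, dist_zero_right] at h1
  have h2 : ‖f fun i => ⟨x i, hLE x hx i⟩‖ ≤ max R 0 := (hR _ hxB).trans (le_max_left _ _)
  rw [mem_closedBall_zero_iff, pi_norm_le_iff_of_nonneg (by positivity)]
  intro i
  exact (norm_le_pi_norm (fun i => (⟨x i, hLE x hx i⟩ : E)) i).trans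
    (h1.trans (mul_le_mul_of_nonneg_left h2 C.2))

lemma discVal_eq_disc {K : Type*} [NontriviallyNormedField K] {r : ℕ} {L : AddSubgroup (Fin r → K)}
    {U : AddSubgroup (Fin r → K)} {ω : Fin r → K} (hω : ∀ x ∈ U, rvPair x ω = 0 → x = 0) {a : K}
    (haU : invMul a L ≤ U) {R : Finset (Fin r → K)}
    (hR : IsRepSet (L : Set (Fin r → K)) (invSc a L) R) [DecidableEq K] :
    discVal a (L : Set (Fin r → K)) R ω =
      disc (L.map (pairing ω).toAddMonoidHom : AddSubgroup K) a
        ((insert 0 R).image (pairing ω)) := by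
  have hRU : ∀ x ∈ R, x ∈ U := fun x hx => haU (hR.1 hx).1
  have hR0 : ∀ x ∈ R, pairing ω x ≠ 0 := fun x hx h => (hR.1 hx).2 <| by
    rw [hω x (hRU x hx) h]
    exact L.zero_mem
  have hinj : Set.InjOn (pairing ω) (R : Set (Fin r → K)) := fun x hx y hy h =>
    sub_eq_zero.mp (hω _ (U.sub_mem (hRU x hx) (hRU y hy)) (by
      change pairing ω (x - y) = 0
      rw [map_sub, h, sub_self]))
  have herase : ((insert 0 R).image (pairing ω)).erase 0 = R.image (pairing ω) := by
    rw [Finset.image_insert, map_zero, Finset.erase_insert]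
    intro h
    obtain ⟨x, hx, h⟩ := Finset.mem_image.mp h
    exact hR0 x hx h
  rw [discVal, disc]
  convert! rfl using 2
  convert! Finset.prod_image hinj using 2
  convert! herase

lemma card_image_pairing {K : Type*} [Field K] {r : ℕ} {U : AddSubgroup (Fin r → K)}
    {ω : Fin r → K} (hω : ∀ x ∈ U, rvPair x ω = 0 → x = 0) {W : Finset (Fin r → K)}
    (hW : ∀ w ∈ W, w ∈ U) [DecidableEq K] : (W.image (pairing ω)).card = W.card :=
  Finset.card_image_of_injOn fun x hx y hy h =>
    sub_eq_zero.mp (hω _ (U.sub_mem (hW x hx) (hW y hy)) (by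
      change pairing ω (x - y) = 0
      rw [map_sub, h, sub_self]))

end Pairing

end DiscPower

/-- the relation `(Δ^L_a(ω))^{q^{r·deg b}−1} = (Δ^L_b(ω))^{q^{r·deg a}−1}`. -/
theorem disc_power_relation
    (K : Type*) [NontriviallyNormedField K] [IsUltrametricDist K] [CompleteSpace K]
    [IsAlgClosed K]
    (Finf : Subfield K) (hFinfclosed : IsClosed (Finf : Set K))
    (hFinfloc : LocallyCompactSpace Finf)
    (Fq : Subfield K) (hFqfin : Finite Fq) (q : ℕ) (hq : Nat.card Fq = q)
    (A : Subring K) (hFqA : (Fq : Set K) ⊆ A)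
    (F : Subfield K) (hAF : (A : Set K) ⊆ F) (hFFinf : F ≤ Finf)
    (hDed : IsDedekindDomain A)
    (hFrac : ∀ z ∈ F, ∃ a ∈ A, ∃ b ∈ A, b ≠ 0 ∧ z * b = a)
    (hquot : ∀ I : Ideal A, I ≠ ⊥ → Finite (A ⧸ I))
    (r : ℕ) (hr : 2 ≤ r)
    (L : Set (Fin r → K))
    (hLsub : ∃ G : AddSubgroup (Fin r → K), (G : Set (Fin r → K)) = L)
    (hLF : ∀ x ∈ L, ∀ i, x i ∈ F)
    (hLA : ∀ a ∈ (A : Set K), ∀ x ∈ L, a • x ∈ L)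
    (hLfg : ∃ T : Finset (Fin r → K), (T : Set (Fin r → K)) ⊆ L ∧
      ∀ x ∈ L, x ∈ AddSubgroup.closure
        {y | ∃ a ∈ (A : Set K), ∃ t ∈ (T : Set (Fin r → K)), y = a • t})
    (hLspan : ∀ y : Fin r → K, (∀ i, y i ∈ F) →
      y ∈ AddSubgroup.closure {z | ∃ c ∈ (F : Set K), ∃ x ∈ L, z = c • x})
    (hLdisc : StronglyDiscrete L)
    (a b : A) (ha : a ≠ 0) (hb : b ≠ 0)
    (dega degb : ℕ)
    (hdega : Nat.card (A ⧸ Ideal.span {a}) = q ^ dega)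
    (hdegb : Nat.card (A ⧸ Ideal.span {b}) = q ^ degb)
    (ω : Fin r → K)
    (hω : ∀ x : Fin r → K, (∀ i, x i ∈ Finf) → rvPair x ω = 0 → x = 0)
    (Ra Rb : Finset (Fin r → K))
    (hRa : IsRepSet L (invSc ((a : K)) L) Ra)
    (hRb : IsRepSet L (invSc ((b : K)) L) Rb) :
    (discVal (a : K) L Ra ω) ^ (q ^ (r * degb) - 1) =
      (discVal (b : K) L Rb ω) ^ (q ^ (r * dega) - 1) := by
  classical
  obtain ⟨L, rfl⟩ := hLsub
  let U : AddSubgroup (Fin r → K) := AddSubgroup.pi Set.univ fun _ => F.toSubring.toAddSubgroup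
  have hU : ∀ x, x ∈ U ↔ ∀ i, x i ∈ F := fun x => by simp [U, AddSubgroup.mem_pi]
  have hωU : ∀ x ∈ U, rvPair x ω = 0 → x = 0 := fun x hx =>
    hω x fun i => hFFinf ((hU x).mp hx i)
  have hLU : L ≤ U := fun x hx => (hU x).mpr (hLF x hx)
  have hinvU : ∀ c : A, c ≠ 0 → DiscPower.invMul (c : K) L ≤ U := by
    intro c hc x hx
    rw [hU]
    intro i
    have hc' : (c : K) ≠ 0 := by simpa using hc
    rw [show x i = (c : K)⁻¹ * (c • x) i from (inv_mul_cancel_left₀ hc' (x i)).symm]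
    exact F.mul_mem (F.inv_mem (hAF c.2)) (hLF _ hx i)
  have hΛ : StronglyDiscrete
      ((L.map (DiscPower.pairing ω).toAddMonoidHom : AddSubgroup K) : Set K) :=
    DiscPower.stronglyDiscrete_image_rvPair hFinfclosed (fun x hx i => hFFinf (hLF x hx i))
      hLdisc hω
  have hmul : ∀ c : A, ∀ x ∈ L.map (DiscPower.pairing ω).toAddMonoidHom,
      (c : K) * x ∈ L.map (DiscPower.pairing ω).toAddMonoidHom := by
    rintro c _ ⟨x, hx, rfl⟩
    exact ⟨(c : K) • x, hLA c c.2 x hx, map_smul (DiscPower.pairing ω) (c : K) x⟩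
  have hcard : ∀ (c : A) (d : ℕ) (R : Finset (Fin r → K)), c ≠ 0 →
      Nat.card (A ⧸ Ideal.span {c}) = q ^ d →
      IsRepSet (L : Set (Fin r → K)) (invSc (c : K) L) R →
      ((insert 0 R).image (DiscPower.pairing ω)).card = q ^ (r * d) := by
    intro c d R hc hd hR
    have hW := DiscPower.isCompleteReps_insert hR
    rw [DiscPower.card_image_pairing hωU fun w hw => hinvU c hc (hW.mem w hw), hW.card_eq,
      DiscPower.relIndex_lattice hFrac hquot hLF hLA hLfg hLspan hc, hd, ← pow_mul, mul_comm]
  have ha' : (a : K) ≠ 0 := by simpa using ha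
  have hb' : (b : K) ≠ 0 := by simpa using hb
  rw [DiscPower.discVal_eq_disc hωU (hinvU a ha) hRa, DiscPower.discVal_eq_disc hωU (hinvU b hb) hRb,
    ← hcard a dega Ra ha hdega hRa, ← hcard b degb Rb hb hdegb hRb]
  exact DiscPower.disc_pow_eq hΛ ha' hb' (hmul a) (hmul b)
    ((DiscPower.isCompleteReps_insert hRa).image _ ha' hωU hLU (hinvU a ha))
    ((DiscPower.isCompleteReps_insert hRb).image _ hb' hωU hLU (hinvU b hb))
end
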